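/- arXiv:1704.03771 — 2 statements merged into one kernel-verified Lean document; each statement's English description precedes it below -/
import Mathlib

section
/- (Diamond's L¹ criterion.) Let a Beurling generalized number system be given. If ∫_2^∞ |Π(x) − x/log x| x^{−2} dx < ∞, then there exists a constant a > 0 such that N(x)/x → a as x → ∞. -/
open Filter MeasureTheory Set Topology
open scoped Classical

/-- Value `n(α) = ∏ p_k^{α(k)}` of a generalized integer `α`. -/
noncomputable def nval (p : ℕ → ℝ) (α : ℕ →₀ ℕ) : ℝ := α.prod fun k e => p k ^ e

/-- Counting function `N(x)` of the generalized integers. -/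
noncomputable def Ncount (p : ℕ → ℝ) (x : ℝ) : ℕ := Nat.card {α : ℕ →₀ ℕ // nval p α ≤ x}

/-- Riemann prime counting function `Π(x) = Σ_{j ≥ 1} π(x^{1/j})/j`. -/
noncomputable def PiCount (p : ℕ → ℝ) (x : ℝ) : ℝ :=
  ∑' j : ℕ, (Nat.card {k : ℕ // p k ≤ x ^ ((1 : ℝ) / (j + 1))} : ℝ) / (j + 1)

/-- `log ζ(s) = ∫_1^∞ x^{-s} dΠ(x)`, the Lebesgue–Stieltjes integral against the purely
atomic measure `dΠ`, which carries mass `1/j` at each point `p_k^j`. -/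
noncomputable def logZeta (p : ℕ → ℝ) (s : ℂ) : ℂ :=
  ∑' (j : ℕ) (k : ℕ), ((p k : ℂ) ^ (-s * (j + 1))) / (j + 1)

/-- The Beurling zeta function `ζ(s) = exp(∫_1^∞ x^{-s} dΠ(x))`. -/
noncomputable def zetaB (p : ℕ → ℝ) (s : ℂ) : ℂ := Complex.exp (logZeta p s)

/-- Beurling Möbius function. -/
noncomputable def muB (α : ℕ →₀ ℕ) : ℝ :=
  if ∀ k, α k ≤ 1 then (-1 : ℝ) ^ α.support.card else 0

/-- `m(x) = Σ_{n(α) ≤ x} μ(α)/n(α)`. -/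
noncomputable def mB (p : ℕ → ℝ) (x : ℝ) : ℝ :=
  ∑' α : {α : ℕ →₀ ℕ // nval p α ≤ x}, muB α / nval p α

/-- Beurling Liouville function. -/
noncomputable def lambdaB (α : ℕ →₀ ℕ) : ℝ := (-1 : ℝ) ^ (α.sum fun _ e => e)

/-- `ℓ(x) = Σ_{n(α) ≤ x} λ(α)/n(α)`. -/
noncomputable def ellB (p : ℕ → ℝ) (x : ℝ) : ℝ :=
  ∑' α : {α : ℕ →₀ ℕ // nval p α ≤ x}, lambdaB α / nval p α

/-- An analytic function `G` on `{Re s > 1}` has `A_loc`-boundary behavior on `1 + iU`: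
for every compact `K ⊂ U` there is `g ∈ L¹(ℝ)` with `G(σ + it) → ∫ g(x) e^{-itx} dx`
as `σ → 1⁺`, uniformly for `t ∈ K`. -/
def ALocBoundary (G : ℂ → ℂ) (U : Set ℝ) : Prop :=
  ∀ K : Set ℝ, K ⊆ U → IsCompact K → ∃ g : ℝ → ℂ, Integrable g ∧
    TendstoUniformlyOn (fun σ : ℝ => fun t : ℝ => G (σ + t * Complex.I))
      (fun t : ℝ => ∫ x : ℝ, g x * Complex.exp (-(t * x) * Complex.I)) (𝓝[>] 1) K

/-- An analytic function `G` on `{Re s > 1}` has local pseudofunction boundary behavior on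
`1 + iU`: for every smooth compactly supported `φ` with `supp φ ⊂ U` and every `x`, the limit
`g_φ(x) = lim_{σ→1⁺} ∫ G(σ + it) φ(t) e^{-ixt} dt` exists, and `g_φ(x) → 0` as `|x| → ∞`. -/
def LocalPseudofunctionBoundary (G : ℂ → ℂ) (U : Set ℝ) : Prop :=
  ∀ φ : ℝ → ℂ, ContDiff ℝ (⊤ : ℕ∞) φ → HasCompactSupport φ → tsupport φ ⊆ U →
    ∃ gφ : ℝ → ℂ,
      (∀ x : ℝ, Tendsto (fun σ : ℝ => ∫ t : ℝ, G (σ + t * Complex.I) * φ t *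
          Complex.exp (-(x * t) * Complex.I)) (𝓝[>] 1) (𝓝 (gφ x))) ∧
      Tendsto gφ (cocompact ℝ) (𝓝 0)

/-- `Π₀(x) = ∫_1^x (1 - 1/u)/log u du`. -/
noncomputable def Pi0 (x : ℝ) : ℝ := ∫ u in (1:ℝ)..x, (1 - 1/u) / Real.log u

/-- superposition of characters -/
noncomputable def BB (m : ℝ → ℂ) (x : ℝ) : ℂ := ∫ t, m t * Complex.exp ((x * t : ℝ) * Complex.I)

noncomputable def FF (f : ℝ → ℂ) (t : ℝ) : ℂ := ∫ u, f u * Complex.exp (-(t * u : ℝ) * Complex.I)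

lemma norm_char (x : ℝ) : ‖Complex.exp ((x : ℂ) * Complex.I)‖ = 1 := Complex.norm_exp_ofReal_mul_I x
lemma norm_char' (x : ℝ) : ‖Complex.exp (-(x : ℂ) * Complex.I)‖ = 1 := by
  rw [← Complex.ofReal_neg]; exact Complex.norm_exp_ofReal_mul_I _

lemma BB_cont {m : ℝ → ℂ} (hm : Integrable m) : Continuous (BB m) := by
  unfold BB
  refine continuous_of_dominated (bound := fun t => ‖m t‖) ?_ ?_ hm.norm ?_
  · intro x
    exact hm.1.mul (by fun_prop)
  · intro x
    filter_upwards with t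
    rw [norm_mul, norm_char, mul_one]
  · filter_upwards with t
    fun_prop

lemma FF_cont {m : ℝ → ℂ} (hm : Integrable m) : Continuous (FF m) := by
  unfold FF
  refine continuous_of_dominated (bound := fun t => ‖m t‖) ?_ ?_ hm.norm ?_
  · intro x
    exact hm.1.mul (by fun_prop)
  · intro x
    filter_upwards with t
    rw [norm_mul, norm_char', mul_one]
  · filter_upwards with t
    fun_prop

lemma FF_bound {m : ℝ → ℂ} (t : ℝ) : ‖FF m t‖ ≤ ∫ u, ‖m u‖ := by
  refine (norm_integral_le_integral_norm _).trans (le_of_eq ?_)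
  congr 1; ext u; rw [norm_mul, norm_char', mul_one]

lemma conv_BB {f m : ℝ → ℂ} (hf : Integrable f) (hm : Integrable m) (x : ℝ) :
    ∫ u, f u * BB m (x - u) = BB (fun t => FF f t * m t) x := by
  unfold BB FF
  have h1 : ∀ u, f u * ∫ t, m t * Complex.exp (((x - u) * t : ℝ) * Complex.I) =
      ∫ t, (f u * m t) * Complex.exp (((x - u) * t : ℝ) * Complex.I) := by
    intro u; rw [← integral_const_mul]; congr 1; ext t; ring
  have h2 : ∀ t, (∫ u, f u * Complex.exp (-(t * u : ℝ) * Complex.I)) * m t *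
      Complex.exp ((x * t : ℝ) * Complex.I) =
      ∫ u, (f u * m t) * Complex.exp (((x - u) * t : ℝ) * Complex.I) := by
    intro t; rw [mul_assoc, ← integral_mul_const]; congr 1; ext u
    have : Complex.exp (((x - u) * t : ℝ) * Complex.I) =
      Complex.exp (-(t * u : ℝ) * Complex.I) * Complex.exp ((x * t : ℝ) * Complex.I) := by
      rw [← Complex.exp_add]; congr 1; push_cast; ring
    rw [this]; ring
  simp_rw [h1, h2]
  refine integral_integral_swap ?_
  have : Integrable (fun z : ℝ × ℝ => f z.1 * m z.2) (volume.prod volume) := hf.mul_prod hm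
  refine this.mono (this.1.mul (by fun_prop)) ?_
  filter_upwards with z
  simp only [Function.uncurry]
  rw [norm_mul (f z.1 * m z.2), norm_char, mul_one]

/-- families with controlled limits -/
structure Good (h : ℝ → ℝ → ℂ) (h0 : ℝ → ℂ) (C : ℝ) (L : ℂ) : Prop where
  cont : ∀ δ > 0, Continuous (h δ)
  bound : ∀ δ > 0, δ ≤ 1 → ∀ x, ‖h δ x‖ ≤ C
  lim : ∀ x, Tendsto (fun δ => h δ x) (𝓝[>] 0) (𝓝 (h0 x))
  top : Tendsto h0 atTop (𝓝 L)

lemma evd : ∀ᶠ δ : ℝ in 𝓝[>] 0, 0 < δ ∧ δ ≤ 1 :=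
  (Ioc_mem_nhdsGT (by norm_num : (0:ℝ) < 1))

lemma Good.meas {h h0 C L} (H : Good h h0 C L) : Measurable h0 := by
  have h2 : Tendsto (fun n : ℕ => (1 : ℝ) / ((n : ℝ) + 1)) atTop (𝓝[>] 0) := by
    rw [tendsto_nhdsWithin_iff]
    refine ⟨tendsto_one_div_add_atTop_nhds_zero_nat, ?_⟩
    filter_upwards with n
    simp only [mem_Ioi]; positivity
  refine measurable_of_tendsto_metrizable (f := fun (n : ℕ) => h (1 / ((n:ℝ) + 1))) ?_ ?_
  · intro n; exact (H.cont _ (by positivity)).measurable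
  · rw [tendsto_pi_nhds]
    intro x
    exact (H.lim x).comp h2

lemma Good.bound0 {h h0 C L} (H : Good h h0 C L) (x : ℝ) : ‖h0 x‖ ≤ C := by
  refine le_of_tendsto (H.lim x).norm ?_
  filter_upwards [evd] with δ hδ using H.bound δ hδ.1 hδ.2 x

lemma Good.Cnn {h h0 C L} (H : Good h h0 C L) : 0 ≤ C := (norm_nonneg _).trans (H.bound0 0)

lemma Good.congr {h h' h0 C L} (H : Good h h0 C L) (e : ∀ δ > 0, ∀ x, h' δ x = h δ x) :
    Good h' h0 C L where
  cont δ hδ := by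
    have : h' δ = h δ := funext (e δ hδ)
    rw [this]; exact H.cont δ hδ
  bound δ hδ h1 x := by rw [e δ hδ]; exact H.bound δ hδ h1 x
  lim x := by
    refine (H.lim x).congr' ?_
    filter_upwards [evd] with δ hδ using (e δ hδ.1 x).symm
  top := H.top

lemma Good.add {h h0 C L h' h0' C' L'} (H : Good h h0 C L) (H' : Good h' h0' C' L') :
    Good (fun δ x => h δ x + h' δ x) (fun x => h0 x + h0' x) (C + C') (L + L') where
  cont δ hδ := (H.cont δ hδ).add (H'.cont δ hδ)
  bound δ hδ h1 x := (norm_add_le _ _).trans (add_le_add (H.bound δ hδ h1 x) (H'.bound δ hδ h1 x))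
  lim x := (H.lim x).add (H'.lim x)
  top := H.top.add H'.top

lemma Good.conv {h h0 C L} (H : Good h h0 C L) (f : ℝ → ℝ → ℂ) (f0 : ℝ → ℂ) (F : ℝ → ℝ)
    (hF : Integrable F) (hf : ∀ δ > 0, AEStronglyMeasurable (f δ)) (hf0 : AEStronglyMeasurable f0)
    (hb : ∀ δ > 0, δ ≤ 1 → ∀ u, ‖f δ u‖ ≤ F u) 
    (hl : ∀ u, Tendsto (fun δ => f δ u) (𝓝[>] 0) (𝓝 (f0 u)))
    (hc : ∀ δ > 0, Continuous (fun x => ∫ u, f δ u * h δ (x - u))) :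
    Good (fun δ x => ∫ u, f δ u * h δ (x - u)) (fun x => ∫ u, f0 u * h0 (x - u)) 
      ((∫ u, F u) * C) ((∫ u, f0 u) * L) := by
  have hb0 : ∀ u, ‖f0 u‖ ≤ F u := by
    intro u
    refine le_of_tendsto (hl u).norm ?_
    filter_upwards [evd] with δ hδ using hb δ hδ.1 hδ.2 u
  refine ⟨hc, ?_, ?_, ?_⟩
  · intro δ hδ h1 x
    rw [← integral_mul_const]
    refine norm_integral_le_of_norm_le (hF.mul_const C) ?_
    filter_upwards with u
    rw [norm_mul]
    exact mul_le_mul (hb δ hδ h1 u) (H.bound δ hδ h1 _) (norm_nonneg _)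
      ((norm_nonneg _).trans (hb δ hδ h1 u))
  · intro x
    refine tendsto_integral_filter_of_dominated_convergence (fun u => F u * C) ?_ ?_
      (hF.mul_const C) ?_
    · filter_upwards [evd] with δ hδ
      exact (hf δ hδ.1).mul ((H.cont δ hδ.1).comp (by fun_prop)).aestronglyMeasurable
    · filter_upwards [evd] with δ hδ
      filter_upwards with u
      rw [norm_mul]
      exact mul_le_mul (hb δ hδ.1 hδ.2 u) (H.bound δ hδ.1 hδ.2 _) (norm_nonneg _)
        ((norm_nonneg _).trans (hb δ hδ.1 hδ.2 u))
    · filter_upwards with u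
      exact (hl u).mul (H.lim _)
  · rw [← integral_mul_const]
    refine tendsto_integral_filter_of_dominated_convergence (fun u => F u * C) ?_ ?_
      (hF.mul_const C) ?_
    · filter_upwards with x
      exact hf0.mul (H.meas.comp (by fun_prop)).aestronglyMeasurable
    · filter_upwards with x
      filter_upwards with u
      rw [norm_mul]
      exact mul_le_mul (hb0 u) (H.bound0 _) (norm_nonneg _)
        ((norm_nonneg _).trans (hb0 u))
    · filter_upwards with u
      refine tendsto_const_nhds.mul (H.top.comp ?_)
      exact tendsto_atTop_add_const_right atTop (-u) tendsto_id

section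
section
open scoped FourierTransform SchwartzMap ContDiff
lemma exists_K1 (Λ : ℝ) (hΛ : 0 < Λ) : ∃ K : ℝ → ℂ, Integrable K ∧
    ∀ t, |t| ≤ Λ → FF K t = t * Complex.I := by
  let χ : ContDiffBump (0 : ℝ) := ⟨Λ, Λ + 1, hΛ, by linarith⟩
  let g : ℝ → ℂ := fun ξ => (χ ξ : ℂ) * ((2 * Real.pi * ξ : ℝ) * Complex.I)
  have h1 : HasCompactSupport g := by
    refine HasCompactSupport.mul_right ?_
    exact χ.hasCompactSupport.comp_left Complex.ofReal_zero
  have h2 : ContDiff ℝ ∞ g := by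
    have : ContDiff ℝ ∞ (fun ξ : ℝ => (χ ξ : ℂ)) := Complex.ofRealCLM.contDiff.comp χ.contDiff
    refine this.mul ?_
    refine ContDiff.mul ?_ contDiff_const
    exact Complex.ofRealCLM.contDiff.comp (contDiff_const.mul contDiff_id)
  let G : 𝓢(ℝ, ℂ) := h1.toSchwartzMap h2
  refine ⟨((𝓕⁻ G : 𝓢(ℝ, ℂ)) : ℝ → ℂ), (𝓕⁻ G : 𝓢(ℝ, ℂ)).integrable, ?_⟩
  intro t ht
  have h3 : 𝓕 (𝓕⁻ G : 𝓢(ℝ, ℂ)) = G := FourierTransform.fourier_fourierInv_eq G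
  have h4 : (𝓕 (𝓕⁻ G : 𝓢(ℝ, ℂ)) : 𝓢(ℝ, ℂ)) (t / (2 * Real.pi)) = G (t / (2 * Real.pi)) := by rw [h3]
  rw [SchwartzMap.fourier_coe, Real.fourier_eq'] at h4
  have h5 : G (t / (2 * Real.pi)) = t * Complex.I := by
    change g _ = _
    simp only [g]
    rw [χ.one_of_mem_closedBall]
    · have := Real.pi_pos.ne'
      simp
      field_simp
    · simp only [mem_closedBall_iff_norm, sub_zero, Real.norm_eq_abs, χ]
      rw [abs_div]
      refine (div_le_self (abs_nonneg _) ?_).trans ht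
      rw [abs_of_pos (by positivity)]
      nlinarith [Real.pi_gt_three]
  rw [← h5, ← h4]
  unfold FF
  congr 1; ext u
  rw [smul_eq_mul, mul_comm]
  congr 2
  have := Real.pi_pos.ne'
  simp
  field_simp
end

noncomputable def tri (t : ℝ) : ℝ := max 0 (1 - |t|)
noncomputable def fej (y : ℝ) : ℝ := if y = 0 then 1 else 2 * (1 - Real.cos y) / y ^ 2

lemma tri_cont : Continuous tri := by unfold tri; fun_prop
lemma tri_nonneg (t : ℝ) : 0 ≤ tri t := le_max_left _ _
lemma tri_zero {t : ℝ} (h : 1 ≤ |t|) : tri t = 0 := max_eq_left (by linarith)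
lemma tri_supp : HasCompactSupport tri := by
  refine HasCompactSupport.intro (isCompact_Icc (a := (-1:ℝ)) (b := 1)) ?_
  intro x hx
  apply tri_zero
  by_contra h
  push Not at h
  exact hx ⟨(abs_lt.1 h).1.le, (abs_lt.1 h).2.le⟩

lemma half_int (y : ℝ) (hy : y ≠ 0) : ∫ t in (0:ℝ)..1, ((1 - t : ℝ) : ℂ) * Complex.exp ((y * t : ℝ) * Complex.I) =
    Complex.exp (y * Complex.I) / (y * Complex.I) ^ 2 - 1 / (y * Complex.I) - 1 / (y * Complex.I) ^ 2 := by
  have hy' : (y : ℂ) * Complex.I ≠ 0 := by simp [hy]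
  have := intervalIntegral.integral_eq_sub_of_hasDerivAt (a := 0) (b := 1)
    (f := fun t : ℝ => ((1 - t : ℝ) : ℂ) * Complex.exp (t * (y * Complex.I)) / (y * Complex.I) + Complex.exp (t * (y * Complex.I)) / (y * Complex.I) ^ 2)
    (f' := fun t : ℝ => ((1 - t : ℝ) : ℂ) * Complex.exp ((y * t : ℝ) * Complex.I)) ?_ ?_
  · rw [this]; simp
    field_simp
    ring
  · intro t _
    have h0 : HasDerivAt (fun t : ℝ => (t : ℂ)) 1 t := Complex.ofRealCLM.hasDerivAt
    have h1 : HasDerivAt (fun t : ℝ => Complex.exp (t * (y * Complex.I))) (Complex.exp (t * (y * Complex.I)) * (1 * (y * Complex.I))) t :=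
      (h0.mul_const _).cexp
    have h2 : HasDerivAt (fun t : ℝ => ((1 - t : ℝ) : ℂ)) (-1) t := by
      have := h0.const_sub 1
      simpa using this
    have h3 := ((h2.mul h1).div_const (y * Complex.I)).add (h1.div_const ((y * Complex.I) ^ 2))
    refine h3.congr_deriv ?_
    have : Complex.exp ((y * t : ℝ) * Complex.I) = Complex.exp (t * (y * Complex.I)) := by
      congr 1; push_cast; ring
    rw [this]
    have yc : (y : ℂ) ≠ 0 := by exact_mod_cast hy
    field_simp
    ring
  · apply Continuous.intervalIntegrable; fun_prop

lemma BB_tri (y : ℝ) : BB (fun t => (tri t : ℂ)) y = fej y := by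
  unfold BB
  have hc : Continuous fun t : ℝ => (tri t : ℂ) * Complex.exp ((y * t : ℝ) * Complex.I) := by
    have := tri_cont
    fun_prop
  have e1 : ∫ t, (tri t : ℂ) * Complex.exp ((y * t : ℝ) * Complex.I) =
     ∫ t in (-1:ℝ)..1, (tri t : ℂ) * Complex.exp ((y * t : ℝ) * Complex.I) := by
    symm
    apply intervalIntegral.integral_eq_integral_of_support_subset
    intro t ht
    by_contra h
    apply ht
    have : tri t = 0 := by
      apply tri_zero
      by_contra h'
      push Not at h'
      exact h ⟨(abs_lt.1 h').1, (abs_lt.1 h').2.le⟩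
    simp [this]
  have e2 : ∫ t in (0:ℝ)..1, (tri t : ℂ) * Complex.exp ((y * t : ℝ) * Complex.I) =
      ∫ t in (0:ℝ)..1, ((1 - t : ℝ) : ℂ) * Complex.exp ((y * t : ℝ) * Complex.I) := by
    apply intervalIntegral.integral_congr
    intro t ht
    rw [uIcc_of_le (by norm_num)] at ht
    simp only [tri]
    rw [abs_of_nonneg ht.1, max_eq_right (by linarith [ht.2])]
  have e3 : ∫ t in (-1:ℝ)..0, (tri t : ℂ) * Complex.exp ((y * t : ℝ) * Complex.I) =
      ∫ t in (0:ℝ)..1, ((1 - t : ℝ) : ℂ) * Complex.exp (((-y) * t : ℝ) * Complex.I) := by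
    have := intervalIntegral.integral_comp_neg (a := 0) (b := 1) (fun t : ℝ => (tri t : ℂ) * Complex.exp ((y * t : ℝ) * Complex.I))
    rw [neg_zero] at this
    rw [← this]
    apply intervalIntegral.integral_congr
    intro t ht
    rw [uIcc_of_le (by norm_num)] at ht
    simp only [tri]
    rw [abs_neg, abs_of_nonneg ht.1, max_eq_right (by linarith [ht.2]), neg_mul_comm]
  rw [e1, ← intervalIntegral.integral_add_adjacent_intervals (hc.intervalIntegrable (-1) 0) (hc.intervalIntegrable 0 1), e2, e3]
  unfold fej
  split_ifs with h
  · subst h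
    have h1 : ∫ t in (0:ℝ)..1, (1 - (t:ℂ)) = ((∫ t in (0:ℝ)..1, (1 - t) : ℝ) : ℂ) := by
      rw [← intervalIntegral.integral_ofReal]; simp
    have h2 : ∫ t in (0:ℝ)..1, (1 - t) = (1 / 2 : ℝ) := by
      rw [intervalIntegral.integral_sub (by simp) (by simp)]; simp; norm_num
    simp
    rw [h1, h2]; norm_num
  · rw [half_int y h, half_int (-y) (by simpa using h)]
    push_cast
    rw [Complex.cos]
    have : (y:ℂ) ≠ 0 := by exact_mod_cast h
    have hI := Complex.I_ne_zero
    field_simp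
    simp only [Complex.I_sq]
    ring

lemma fej_nonneg (y : ℝ) : 0 ≤ fej y := by
  unfold fej
  split_ifs
  · norm_num
  · have := Real.cos_le_one y
    have : 0 ≤ 1 - Real.cos y := by linarith
    positivity

lemma fej_cont : Continuous fej := by
  have h : Continuous (BB (fun t => (tri t : ℂ))) := BB_cont (by
    apply Integrable.ofReal
    exact tri_cont.integrable_of_hasCompactSupport tri_supp)
  have : fej = fun y => (BB (fun t => (tri t : ℂ)) y).re := by
    ext y; rw [BB_tri]; simp
  rw [this]; fun_prop

lemma fej_int : Integrable fej := by
  refine (integrable_inv_one_add_sq.const_mul 5).mono' fej_cont.aestronglyMeasurable ?_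
  filter_upwards with y
  rw [Real.norm_of_nonneg (fej_nonneg y), ← div_eq_mul_inv, le_div_iff₀ (by positivity)]
  unfold fej
  split_ifs with h
  · rw [h]; norm_num
  · have h1 : 0 < y ^ 2 := by positivity
    have h2 := Real.one_sub_sq_div_two_le_cos (x := y)
    have h3 := Real.neg_one_le_cos y
    rw [div_mul_eq_mul_div, div_le_iff₀ h1]
    nlinarith

lemma fej_pos : 0 < ∫ y, fej y := by
  rw [integral_pos_iff_support_of_nonneg fej_nonneg fej_int]
  refine fej_cont.isOpen_support.measure_pos volume ?_
  exact ⟨0, by simp [fej]⟩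

/-- the scaled kernel -/
noncomputable def kk (Λ x : ℝ) : ℝ := Λ * fej (Λ * x)

lemma kk_BB (Λ : ℝ) (hΛ : 0 < Λ) (x : ℝ) : BB (fun t => (tri (t / Λ) : ℂ)) x = kk Λ x := by
  unfold kk
  push_cast
  rw [← BB_tri]
  unfold BB
  have := Measure.integral_comp_div (fun t => (tri t : ℂ) * Complex.exp ((Λ * x * t : ℝ) * Complex.I)) Λ
  rw [abs_of_pos hΛ] at this
  rw [Complex.real_smul] at this
  rw [← this]
  congr 1; ext t; congr 3; field_simp

lemma kk_nonneg (Λ : ℝ) (hΛ : 0 < Λ) (x : ℝ) : 0 ≤ kk Λ x := mul_nonneg hΛ.le (fej_nonneg _)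
lemma kk_cont (Λ : ℝ) : Continuous (kk Λ) := by unfold kk; have := fej_cont; fun_prop
lemma kk_int (Λ : ℝ) (hΛ : 0 < Λ) : Integrable (kk Λ) :=
  (fej_int.comp_mul_left' hΛ.ne').const_mul Λ
lemma kk_integral (Λ : ℝ) (hΛ : 0 < Λ) : ∫ x, kk Λ x = ∫ x, fej x := by
  unfold kk
  rw [integral_const_mul, Measure.integral_comp_mul_left, abs_of_pos (by positivity), smul_eq_mul]
  field_simp
end

noncomputable def dm (f : ℝ → ℝ) (δ u : ℝ) : ℂ := ((f u * Real.exp (-(δ * u)) : ℝ) : ℂ)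

lemma dm_norm {f : ℝ → ℝ} (hf : ∀ u < 0, f u = 0) {δ : ℝ} (hδ : 0 < δ) (u : ℝ) :
    ‖dm f δ u‖ ≤ |f u| := by
  unfold dm
  rw [Complex.norm_real, Real.norm_eq_abs, abs_mul, Real.abs_exp]
  rcases lt_or_ge u 0 with h | h
  · simp [hf u h]
  · refine mul_le_of_le_one_right (abs_nonneg _) ?_
    rw [Real.exp_le_one_iff]; nlinarith [mul_nonneg hδ.le h]

lemma dm_meas {f : ℝ → ℝ} (hf : AEStronglyMeasurable f) (δ : ℝ) : AEStronglyMeasurable (dm f δ) := by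
  unfold dm
  refine Complex.continuous_ofReal.comp_aestronglyMeasurable (hf.mul ?_)
  exact (by fun_prop : Continuous fun u => Real.exp (-(δ * u))).aestronglyMeasurable

lemma dm_int {f : ℝ → ℝ} (hi : Integrable f) (hf : ∀ u < 0, f u = 0) {δ : ℝ} (hδ : 0 < δ) :
    Integrable (dm f δ) :=
  hi.norm.mono' (dm_meas hi.1 δ) (by filter_upwards with u using dm_norm hf hδ u)

lemma dm_lim (f : ℝ → ℝ) (u : ℝ) : Tendsto (fun δ => dm f δ u) (𝓝[>] 0) (𝓝 (f u : ℂ)) := by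
  have : Continuous (fun δ => dm f δ u) := by unfold dm; fun_prop
  have h := (this.tendsto 0).mono_left (nhdsWithin_le_nhds (s := Ioi (0:ℝ)))
  simpa [dm] using h

noncomputable def hv : ℝ → ℝ := (Ioi (0:ℝ)).indicator 1

lemma hv_neg (u : ℝ) (h : u < 0) : hv u = 0 := by
  simp [hv, h.le]
lemma hv_meas : Measurable hv := measurable_one.indicator measurableSet_Ioi
lemma hv_le (u : ℝ) : |hv u| ≤ 1 := by
  unfold hv; rw [indicator_apply]; split_ifs <;> simp

lemma hv_dm (δ : ℝ) : dm hv δ = (Ioi (0:ℝ)).indicator (fun u => ((Real.exp (-δ * u) : ℝ) : ℂ)) := by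
  ext u
  unfold dm hv
  by_cases h : u ∈ Ioi (0:ℝ)
  · simp only [indicator_of_mem h]; simp
  · simp only [indicator_of_notMem h]; simp

lemma hv_dm_int {δ : ℝ} (hδ : 0 < δ) : Integrable (dm hv δ) := by
  rw [hv_dm, integrable_indicator_iff measurableSet_Ioi]
  exact (integrableOn_exp_mul_Ioi (by linarith) 0).ofReal

lemma hv_FF {δ : ℝ} (hδ : 0 < δ) (t : ℝ) : FF (dm hv δ) t = ((δ : ℂ) + t * Complex.I)⁻¹ := by
  unfold FF
  rw [hv_dm]
  have : ∀ u, (Ioi (0:ℝ)).indicator (fun u => ((Real.exp (-δ * u) : ℝ) : ℂ)) u * Complex.exp (-(t * u : ℝ) * Complex.I)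
     = (Ioi (0:ℝ)).indicator (fun u : ℝ => Complex.exp (-(δ + t * Complex.I) * u)) u := by
    intro u
    by_cases h : u ∈ Ioi (0:ℝ)
    · simp only [indicator_of_mem h]
      rw [Complex.ofReal_exp, ← Complex.exp_add]; congr 1; push_cast; ring
    · simp only [indicator_of_notMem h]; simp
  simp_rw [this]
  rw [integral_indicator measurableSet_Ioi, integral_exp_mul_complex_Ioi (by simp [hδ])]
  simp
  rw [← neg_add_rev, neg_div_neg_eq, one_div, add_comm]
  
section core
variable (τ q r : ℝ → ℝ) (c Λ : ℝ)

noncomputable def EE (δ t : ℝ) : ℂ := FF (dm q δ) t + (1 + δ + t * Complex.I) * FF (dm r δ) t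

noncomputable def mm (n : ℕ) (δ t : ℝ) : ℂ :=
  EE q r δ t ^ n * (FF (dm hv δ) t * (tri (t / Λ) : ℂ))

lemma tri_int (hΛ : 0 < Λ) : Integrable (fun t => (tri (t / Λ) : ℂ)) := by
  apply Integrable.ofReal
  exact (tri_cont.integrable_of_hasCompactSupport tri_supp).comp_div hΛ.ne'

variable {q r Λ}

lemma EE_cont (hq : Integrable q) (hqn : ∀ u < 0, q u = 0) (hr : Integrable r)
    (hrn : ∀ u < 0, r u = 0) {δ : ℝ} (hδ : 0 < δ) : Continuous (EE q r δ) := by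
  have h1 := FF_cont (dm_int hq hqn hδ)
  have h2 := FF_cont (dm_int hr hrn hδ)
  unfold EE; fun_prop

lemma triL_supp (hΛ : 0 < Λ) : HasCompactSupport (fun t => (tri (t / Λ) : ℂ)) := by
  refine HasCompactSupport.intro (isCompact_Icc (a := -Λ) (b := Λ)) ?_
  intro x hx
  rw [tri_zero, Complex.ofReal_zero]
  by_contra h
  push Not at h
  rw [abs_div, abs_of_pos hΛ, div_lt_one hΛ] at h
  exact hx ⟨(abs_lt.1 h).1.le, (abs_lt.1 h).2.le⟩

lemma triL_mul_int (hΛ : 0 < Λ) {f : ℝ → ℂ} (hf : Continuous f) : 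
    Integrable (fun t => f t * (tri (t / Λ) : ℂ)) := by
  apply Continuous.integrable_of_hasCompactSupport
  · have := tri_cont
    fun_prop
  · exact (triL_supp hΛ).mul_left

lemma mm_int (hΛ : 0 < Λ) (hq : Integrable q) (hqn : ∀ u < 0, q u = 0) (hr : Integrable r)
    (hrn : ∀ u < 0, r u = 0) (n : ℕ) {δ : ℝ} (hδ : 0 < δ) : Integrable (mm q r Λ n δ) := by
  unfold mm
  simp_rw [← mul_assoc]
  refine triL_mul_int hΛ ?_
  have h1 := EE_cont hq hqn hr hrn hδ
  have h2 := FF_cont (hv_dm_int hδ)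
  fun_prop

lemma good_zero (hΛ : 0 < Λ) : Good (fun δ => BB (mm q r Λ 0 δ)) (fun x => ∫ u, (hv (x - u) : ℂ) * (kk Λ u : ℂ))
   (∫ x, fej x) (∫ x, fej x : ℝ) := by
  have e : ∀ δ > 0, ∀ x, BB (mm q r Λ 0 δ) x = ∫ u, dm hv δ (x - u) * (kk Λ u : ℂ) := by
    intro δ hδ x
    have h1 := conv_BB (hv_dm_int hδ) (tri_int Λ hΛ) x
    unfold mm
    simp only [pow_zero, one_mul]
    rw [← h1, ← integral_sub_left_eq_self _ _ x]
    congr 1; ext u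
    rw [kk_BB Λ hΛ]; simp
  rw [← kk_integral Λ hΛ]
  have hb : ∀ δ > 0, ∀ x u, ‖dm hv δ (x - u) * (kk Λ u : ℂ)‖ ≤ kk Λ u := by
    intro δ hδ x u
    rw [norm_mul, Complex.norm_real, Real.norm_of_nonneg (kk_nonneg Λ hΛ u)]
    refine mul_le_of_le_one_left (kk_nonneg Λ hΛ u) ?_
    exact (dm_norm hv_neg hδ _).trans (hv_le _)
  have hm : ∀ δ x, AEStronglyMeasurable (fun u => dm hv δ (x - u) * (kk Λ u : ℂ)) := by
    intro δ x
    refine Measurable.aestronglyMeasurable ?_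
    have := hv_meas
    have := (kk_cont Λ).measurable
    unfold dm; fun_prop
  refine ⟨?_, ?_, ?_, ?_⟩
  · intro δ hδ
    apply BB_cont
    unfold mm
    simp only [pow_zero, one_mul]
    exact triL_mul_int hΛ (FF_cont (hv_dm_int hδ))
  · intro δ hδ h1 x
    rw [e δ hδ]
    refine norm_integral_le_of_norm_le (kk_int Λ hΛ) ?_
    filter_upwards with u using hb δ hδ x u
  · intro x
    have : Tendsto (fun δ => ∫ u, dm hv δ (x - u) * (kk Λ u : ℂ)) (𝓝[>] 0) (𝓝 (∫ u, (hv (x - u) : ℂ) * (kk Λ u : ℂ))) := by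
      refine tendsto_integral_filter_of_dominated_convergence (kk Λ) ?_ ?_ (kk_int Λ hΛ) ?_
      · filter_upwards with δ using hm δ x
      · filter_upwards [evd] with δ hδ
        filter_upwards with u using hb δ hδ.1 x u
      · filter_upwards with u
        exact (dm_lim hv _).mul tendsto_const_nhds
    refine this.congr' ?_
    filter_upwards [evd] with δ hδ using (e δ hδ.1 x).symm
  · rw [← integral_complex_ofReal]
    refine tendsto_integral_filter_of_dominated_convergence (kk Λ) ?_ ?_ (kk_int Λ hΛ) ?_
    · filter_upwards with x
      refine Measurable.aestronglyMeasurable ?_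
      have := hv_meas
      have := (kk_cont Λ).measurable
      fun_prop
    · filter_upwards with x
      filter_upwards with u
      rw [norm_mul, Complex.norm_real, Complex.norm_real, Real.norm_of_nonneg (kk_nonneg Λ hΛ u)]
      exact mul_le_of_le_one_left (kk_nonneg Λ hΛ u) (hv_le _)
    · filter_upwards with u
      refine tendsto_const_nhds.congr' ?_
      filter_upwards [eventually_gt_atTop u] with x hx
      simp [hv, hx]

lemma BB_add {f g : ℝ → ℂ} (hf : Integrable f) (hg : Integrable g) (x : ℝ) :
    BB (fun t => f t + g t) x = BB f x + BB g x := by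
  unfold BB
  rw [← integral_add]
  · congr 1; ext t; ring
  · refine hf.norm.mono' (hf.1.mul (by fun_prop)) ?_
    filter_upwards with t
    rw [norm_mul, norm_char, mul_one]
  · refine hg.norm.mono' (hg.1.mul (by fun_prop)) ?_
    filter_upwards with t
    rw [norm_mul, norm_char, mul_one]

lemma FF_mul_int {f m : ℝ → ℂ} (hf : Integrable f) (hm : Integrable m) : 
    Integrable (fun t => FF f t * m t) := by
  refine (hm.norm.const_mul (∫ u, ‖f u‖)).mono' ((FF_cont hf).aestronglyMeasurable.mul hm.1) ?_
  filter_upwards with t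
  rw [norm_mul]
  exact mul_le_mul_of_nonneg_right (FF_bound t) (norm_nonneg _)

lemma good_succ (hΛ : 0 < Λ) (hq : Integrable q) (hqn : ∀ u < 0, q u = 0) (hr : Integrable r)
    (hrn : ∀ u < 0, r u = 0) {K : ℝ → ℂ} (hK : Integrable K)
    (hK1 : ∀ t, |t| ≤ Λ → FF K t = t * Complex.I) (n : ℕ) (h0 : ℝ → ℂ) (C : ℝ) (L : ℂ)
    (H : Good (fun δ => BB (mm q r Λ n δ)) h0 C L) :
    ∃ h0', Good (fun δ => BB (mm q r Λ (n+1) δ)) h0' 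
      (((∫ u, |q u|) + 2 * (∫ u, |r u|) + (∫ u, |r u|) * (∫ u, ‖K u‖)) * C) 
      (((∫ u, q u) + (∫ u, r u) : ℝ) * L) := by
  have hmi := fun δ hδ => mm_int hΛ hq hqn hr hrn n (δ := δ) hδ
  have G1 := H.conv (fun δ => dm q δ) (fun u => (q u : ℂ)) (fun u => |q u|) hq.norm
    (fun δ _ => dm_meas hq.1 δ) hq.ofReal.1 (fun δ hδ _ u => dm_norm hqn hδ u) (dm_lim q)
    (fun δ hδ => by
      simp_rw [conv_BB (dm_int hq hqn hδ) (hmi δ hδ)]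
      exact BB_cont (FF_mul_int (dm_int hq hqn hδ) (hmi δ hδ)))
  have G2 := H.conv (fun δ u => (1 + δ) * dm r δ u) (fun u => (r u : ℂ)) (fun u => 2 * |r u|) (hr.norm.const_mul 2)
    (fun δ _ => (dm_meas hr.1 δ).const_mul _) hr.ofReal.1 
    (fun δ hδ h1 u => by
      rw [norm_mul]
      refine mul_le_mul ?_ (dm_norm hrn hδ u) (norm_nonneg _) (by norm_num)
      rw [← Complex.ofReal_one, ← Complex.ofReal_add, Complex.norm_real, Real.norm_of_nonneg (by linarith)]
      linarith) 
    (fun u => by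
      have h1 : Tendsto (fun δ : ℝ => (1 + (δ:ℂ))) (𝓝[>] 0) (𝓝 1) := by
        have : Continuous (fun δ : ℝ => (1 + (δ:ℂ))) := by fun_prop
        have := (this.tendsto 0).mono_left (nhdsWithin_le_nhds (s := Ioi (0:ℝ)))
        simpa using this
      simpa using h1.mul (dm_lim r u))
    (fun δ hδ => by
      simp_rw [conv_BB ((dm_int hr hrn hδ).const_mul (1 + (δ:ℂ))) (hmi δ hδ)]
      exact BB_cont (FF_mul_int ((dm_int hr hrn hδ).const_mul _) (hmi δ hδ)))
  have G3 := H.conv (fun δ => K) K (fun u => ‖K u‖) hK.norm (fun _ _ => hK.1) hK.1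
    (fun _ _ _ _ => le_rfl) (fun _ => tendsto_const_nhds) (fun δ hδ => by
      simp_rw [conv_BB hK (hmi δ hδ)]
      exact BB_cont (FF_mul_int hK (hmi δ hδ)))
  have G3' := G3.congr (h' := fun δ => BB (fun t => FF K t * mm q r Λ n δ t)) 
    (fun δ hδ x => (conv_BB hK (hmi δ hδ) x).symm)
  have G4 := G3'.conv (fun δ => dm r δ) (fun u => (r u : ℂ)) (fun u => |r u|) hr.norm
    (fun δ _ => dm_meas hr.1 δ) hr.ofReal.1 (fun δ hδ _ u => dm_norm hrn hδ u) (dm_lim r)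
    (fun δ hδ => by
      simp_rw [conv_BB (dm_int hr hrn hδ) (FF_mul_int hK (hmi δ hδ))]
      exact BB_cont (FF_mul_int (dm_int hr hrn hδ) (FF_mul_int hK (hmi δ hδ))))
  have G := ((G1.add G2).add G4).congr (h' := fun δ => BB (mm q r Λ (n+1) δ)) (by
    intro δ hδ x
    have i1 := dm_int hq hqn hδ
    have i2 := dm_int hr hrn hδ
    have i2' : Integrable (fun u => (1 + (δ:ℂ)) * dm r δ u) := i2.const_mul _
    have i3 := hmi δ hδ
    rw [conv_BB i1 i3, conv_BB i2' i3, conv_BB i2 (FF_mul_int hK i3),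
     ← BB_add (FF_mul_int i1 i3) (FF_mul_int i2' i3), 
     ← BB_add (f := fun t => FF (dm q δ) t * mm q r Λ n δ t + FF (fun u => (1 + (δ:ℂ)) * dm r δ u) t * mm q r Λ n δ t)
       ((FF_mul_int i1 i3).add (FF_mul_int i2' i3)) (FF_mul_int i2 (FF_mul_int hK i3))]
    congr 1
    ext t
    have e2 : FF (fun u => (1 + (δ:ℂ)) * dm r δ u) t = (1 + δ) * FF (dm r δ) t := by
      unfold FF
      rw [← integral_const_mul]; congr 1; ext u; ring
    rw [e2]
    have e3 : FF K t * mm q r Λ n δ t = t * Complex.I * mm q r Λ n δ t := by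
      by_cases h : |t| ≤ Λ
      · rw [hK1 t h]
      · have : mm q r Λ n δ t = 0 := by
          unfold mm
          rw [tri_zero]; · simp
          push Not at h
          rw [abs_div, abs_of_pos hΛ, le_div_iff₀ hΛ]; linarith
        rw [this]; simp
    rw [e3]
    unfold mm EE
    ring)
  have hK0 : ∫ u, K u = 0 := by
    have := hK1 0 (by simpa using hΛ.le)
    simpa [FF] using this
  rw [hK0, integral_complex_ofReal, integral_complex_ofReal, integral_const_mul] at G
  have e1 : ((∫ u, |q u|) + 2 * (∫ u, |r u|) + (∫ u, |r u|) * (∫ u, ‖K u‖)) * C =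
    (∫ u, |q u|) * C + (2 * ∫ u, |r u|) * C + (∫ u, |r u|) * ((∫ u, ‖K u‖) * C) := by ring
  have e2 : (((∫ u, q u) + (∫ u, r u) : ℝ) : ℂ) * L =
    ((∫ u, q u : ℝ) : ℂ) * L + ((∫ u, r u : ℝ) : ℂ) * L + ((∫ u, r u : ℝ) : ℂ) * (0 * L) := by
    push_cast; ring
  rw [e1, e2]
  exact ⟨_, G⟩

lemma good_all (hΛ : 0 < Λ) (hq : Integrable q) (hqn : ∀ u < 0, q u = 0) (hr : Integrable r)
    (hrn : ∀ u < 0, r u = 0) : ∃ M : ℝ, 0 ≤ M ∧ ∃ h0 : ℕ → ℝ → ℂ, ∀ n, 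
      Good (fun δ => BB (mm q r Λ n δ)) (h0 n) (M ^ n * ∫ x, fej x) 
        ((((∫ u, q u) + (∫ u, r u) : ℝ) : ℂ) ^ n * (∫ x, fej x : ℝ)) := by
  obtain ⟨K, hK, hK1⟩ := exists_K1 Λ hΛ
  refine ⟨((∫ u, |q u|) + 2 * (∫ u, |r u|) + (∫ u, |r u|) * (∫ u, ‖K u‖)), ?_, ?_⟩
  rotate_left
  · have : ∀ n, ∃ h0, Good (fun δ => BB (mm q r Λ n δ)) h0
        (((∫ u, |q u|) + 2 * (∫ u, |r u|) + (∫ u, |r u|) * (∫ u, ‖K u‖)) ^ n * ∫ x, fej x)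
        ((((∫ u, q u) + (∫ u, r u) : ℝ) : ℂ) ^ n * (∫ x, fej x : ℝ)) := by
      intro n
      induction n with
      | zero => 
        rw [pow_zero, pow_zero, one_mul, one_mul]
        exact ⟨_, good_zero hΛ⟩
      | succ n ih => 
        obtain ⟨h0, H⟩ := ih
        rw [pow_succ', pow_succ', mul_assoc, mul_assoc]
        exact good_succ hΛ hq hqn hr hrn hK hK1 n h0 _ _ H
    choose h0 H using this
    exact ⟨h0, H⟩
  · have : 0 ≤ ∫ u, |r u| := integral_nonneg (fun _ => abs_nonneg _)
    have : 0 ≤ ∫ u, |q u| := integral_nonneg (fun _ => abs_nonneg _)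
    have : 0 ≤ ∫ u, ‖K u‖ := integral_nonneg (fun _ => norm_nonneg _)
    positivity

end core

section core2
variable {τ q r : ℝ → ℝ} {c Λ : ℝ}

lemma exp_sum (hΛ : 0 < Λ) (hq : Integrable q) (hqn : ∀ u < 0, q u = 0) (hr : Integrable r)
    (hrn : ∀ u < 0, r u = 0) {δ : ℝ} (hδ : 0 < δ) (x : ℝ) :
    HasSum (fun n : ℕ => BB (mm q r Λ n δ) x * ((n.factorial : ℂ)⁻¹))
      (BB (fun t => Complex.exp (EE q r δ t) * (FF (dm hv δ) t * (tri (t / Λ) : ℂ))) x) := by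
  have hE := EE_cont hq hqn hr hrn hδ
  have hG : Integrable (fun t => FF (dm hv δ) t * (tri (t / Λ) : ℂ)) := 
    triL_mul_int hΛ (FF_cont (hv_dm_int hδ))
  obtain ⟨B, hB⟩ := (isCompact_Icc (a := -Λ) (b := Λ)).exists_bound_of_continuousOn hE.continuousOn
  have key : ∀ n t, ‖mm q r Λ n δ t‖ ≤ |B| ^ n * ‖FF (dm hv δ) t * (tri (t / Λ) : ℂ)‖ := by
    intro n t
    unfold mm
    rw [norm_mul, norm_pow]
    by_cases h : |t| ≤ Λ
    · gcongr
      exact (hB t (abs_le.1 h)).trans (le_abs_self B)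
    · have : tri (t / Λ) = 0 := by
        apply tri_zero
        push Not at h
        rw [abs_div, abs_of_pos hΛ, le_div_iff₀ hΛ]; linarith
      rw [this]; simp
  have e : ∀ n, BB (mm q r Λ n δ) x * ((n.factorial : ℂ)⁻¹) = 
      ∫ t, mm q r Λ n δ t * Complex.exp ((x * t : ℝ) * Complex.I) * ((n.factorial : ℂ)⁻¹) := by
    intro n
    rw [integral_mul_const]; rfl
  simp_rw [e]
  unfold BB
  refine hasSum_integral_of_dominated_convergence
    (fun n t => |B| ^ n / n.factorial * ‖FF (dm hv δ) t * (tri (t / Λ) : ℂ)‖) ?_ ?_ ?_ ?_ ?_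
  · intro n
    refine AEStronglyMeasurable.mul_const ?_ _
    exact (mm_int hΛ hq hqn hr hrn n hδ).1.mul (by fun_prop)
  · intro n
    filter_upwards with t
    rw [norm_mul, norm_mul, norm_char, mul_one, norm_inv, Complex.norm_natCast, div_mul_eq_mul_div,
      div_eq_mul_inv]
    gcongr
    exact key n t
  · filter_upwards with t
    exact (Real.summable_pow_div_factorial |B|).mul_right _
  · simp_rw [tsum_mul_right]
    exact hG.norm.const_mul _
  · filter_upwards with t
    have h1 : HasSum (fun n : ℕ => EE q r δ t ^ n / (n.factorial : ℂ)) (Complex.exp (EE q r δ t)) := by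
      have := NormedSpace.expSeries_div_hasSum_exp (EE q r δ t)
      rwa [← Complex.exp_eq_exp_ℂ] at this
    have h2 := (h1.mul_right (FF (dm hv δ) t * (tri (t / Λ) : ℂ))).mul_right (Complex.exp ((x * t : ℝ) * Complex.I))
    refine h2.congr_fun ?_ |> fun h => h
    intro n
    unfold mm
    ring

lemma core_lim (hΛ : 0 < Λ) (hτ0 : ∀ u, 0 ≤ τ u) (hτm : Measurable τ) (hτn : ∀ u < 0, τ u = 0)
    (hτi : ∀ δ > 0, Integrable (dm τ δ))
    (hq : Integrable q) (hqn : ∀ u < 0, q u = 0) (hr : Integrable r)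
    (hrn : ∀ u < 0, r u = 0) 
    (hlap : ∀ δ > 0, ∀ t : ℝ, FF (dm τ δ) t = ((δ : ℂ) + t * Complex.I)⁻¹ * Complex.exp (c + EE q r δ t)) :
    (∀ x, Integrable (fun u => τ u * kk Λ (x - u))) ∧ 
    Tendsto (fun x => ∫ u, τ u * kk Λ (x - u)) atTop 
      (𝓝 (Real.exp (c + ((∫ u, q u) + ∫ u, r u)) * ∫ x, fej x)) := by
  obtain ⟨M, hM, h0, H⟩ := good_all hΛ hq hqn hr hrn
  set I := ∫ x, fej x with hI
  have hIp : 0 < I := fej_pos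
  set A := (∫ u, q u) + ∫ u, r u with hA
  let W : ℝ → ℝ → ℝ := fun δ x => ∫ u, τ u * Real.exp (-(δ * u)) * kk Λ (x - u)
  let S : ℝ → ℂ := fun x => Complex.exp c * ∑' n : ℕ, h0 n x * ((n.factorial : ℂ)⁻¹)
  have hint : ∀ δ > 0, ∀ x, Integrable (fun u => τ u * Real.exp (-(δ * u)) * kk Λ (x - u)) := by
    intro δ hδ x
    have h1 : Integrable (fun u => τ u * Real.exp (-(δ * u))) := by
      exact (hτi δ hδ).re
    refine h1.mul_bdd (c := Λ * 1) ((kk_cont Λ).comp (by fun_prop)).aestronglyMeasurable ?_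
    filter_upwards with u
    rw [Real.norm_of_nonneg (kk_nonneg Λ hΛ _)]
    unfold kk
    gcongr
    generalize Λ * (x - u) = y
    unfold fej
    split_ifs with h
    · rfl
    · have h2 := Real.one_sub_sq_div_two_le_cos (x := y)
      rw [div_le_one (by positivity)]; linarith
  have hW : ∀ δ > 0, ∀ x, (W δ x : ℂ) = Complex.exp c * ∑' n : ℕ, BB (mm q r Λ n δ) x * ((n.factorial : ℂ)⁻¹) := by
    intro δ hδ x
    rw [(exp_sum hΛ hq hqn hr hrn hδ x).tsum_eq]
    have h1 := conv_BB (hτi δ hδ) (tri_int Λ hΛ) x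
    have h2 : (W δ x : ℂ) = ∫ u, dm τ δ u * BB (fun t => (tri (t / Λ) : ℂ)) (x - u) := by
      simp only [W]
      rw [← integral_complex_ofReal]
      congr 1; ext u
      rw [kk_BB Λ hΛ]; simp [dm]
    rw [h2, h1]
    unfold BB
    rw [← integral_const_mul]
    congr 1; ext t
    beta_reduce
    rw [hlap δ hδ, hv_FF hδ, Complex.exp_add]
    ring
  have hsum : Summable (fun n : ℕ => M ^ n * I * ((n.factorial : ℝ)⁻¹)) := by
    have := (Real.summable_pow_div_factorial M).mul_right I
    refine this.congr ?_
    intro n; ring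
  have hS : ∀ x, Tendsto (fun δ => (W δ x : ℂ)) (𝓝[>] 0) (𝓝 (S x)) := by
    intro x
    have : Tendsto (fun δ => Complex.exp c * ∑' n : ℕ, BB (mm q r Λ n δ) x * ((n.factorial : ℂ)⁻¹)) (𝓝[>] 0) (𝓝 (S x)) := by
      refine Tendsto.const_mul _ ?_
      refine tendsto_tsum_of_dominated_convergence hsum ?_ ?_
      · intro n
        exact ((H n).lim x).mul_const _
      · filter_upwards [evd] with δ hδ n
        rw [norm_mul, norm_inv, Complex.norm_natCast]
        gcongr
        exact (H n).bound δ hδ.1 hδ.2 x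
    refine this.congr' ?_
    filter_upwards [evd] with δ hδ using (hW δ hδ.1 x).symm
  have hStop : Tendsto S atTop (𝓝 ((Real.exp (c + A) * I : ℝ) : ℂ)) := by
    have h1 : ((Real.exp (c + A) * I : ℝ) : ℂ) = Complex.exp c * ∑' n : ℕ, ((A : ℂ) ^ n * (I : ℂ)) * ((n.factorial : ℂ)⁻¹) := by
      have h1 : HasSum (fun n : ℕ => (A : ℂ) ^ n / (n.factorial : ℂ)) (Complex.exp A) := by
        have := NormedSpace.expSeries_div_hasSum_exp (A : ℂ)
        rwa [← Complex.exp_eq_exp_ℂ] at this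
      have h2 := (h1.mul_right (I : ℂ)).tsum_eq
      have h3 : ∑' n : ℕ, ((A : ℂ) ^ n * (I : ℂ)) * ((n.factorial : ℂ)⁻¹) = ∑' n : ℕ, (A : ℂ) ^ n / (n.factorial : ℂ) * (I : ℂ) := by
        congr 1; ext n; ring
      rw [h3, h2]
      push_cast
      rw [Complex.exp_add]; ring
    rw [h1]
    refine Tendsto.const_mul _ ?_
    refine tendsto_tsum_of_dominated_convergence hsum ?_ ?_
    · intro n
      exact ((H n).top).mul_const _
    · filter_upwards with x n
      rw [norm_mul, norm_inv, Complex.norm_natCast]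
      gcongr
      exact (H n).bound0 x
  have hSre : ∀ x, Tendsto (fun δ => W δ x) (𝓝[>] 0) (𝓝 (S x).re) := by
    intro x
    have := (Complex.continuous_re.tendsto _).comp (hS x)
    simpa [Function.comp_def] using this
  -- monotone convergence
  have hseq : Tendsto (fun n : ℕ => (1 : ℝ) / ((n : ℝ) + 1)) atTop (𝓝[>] 0) := by
    rw [tendsto_nhdsWithin_iff]
    refine ⟨tendsto_one_div_add_atTop_nhds_zero_nat, ?_⟩
    filter_upwards with n
    simp only [mem_Ioi]; positivity
  have hWnn : ∀ δ x, 0 ≤ W δ x := by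
    intro δ x
    refine integral_nonneg fun u => ?_
    have := hτ0 u
    have := kk_nonneg Λ hΛ (x - u)
    simp only [Pi.zero_apply]
    positivity
  have hSnn : ∀ x, 0 ≤ (S x).re := fun x => ge_of_tendsto' (hSre x) (fun δ => hWnn δ x)
  have hlint : ∀ x, ∫⁻ u, ENNReal.ofReal (τ u * kk Λ (x - u)) = ENNReal.ofReal (S x).re := by
    intro x
    have hkm := (kk_cont Λ).measurable
    have h1 : Tendsto (fun n : ℕ => ∫⁻ u, ENNReal.ofReal (τ u * Real.exp (-((1 : ℝ) / ((n : ℝ) + 1) * u)) * kk Λ (x - u))) atTop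
        (𝓝 (∫⁻ u, ENNReal.ofReal (τ u * kk Λ (x - u)))) := by
      refine lintegral_tendsto_of_tendsto_of_monotone ?_ ?_ ?_
      · intro n
        refine Measurable.aemeasurable ?_
        fun_prop
      · filter_upwards with u
        intro n m hnm
        refine ENNReal.ofReal_le_ofReal ?_
        refine mul_le_mul_of_nonneg_right ?_ (kk_nonneg Λ hΛ _)
        rcases lt_or_ge u 0 with h | h
        · simp [hτn u h]
        · refine mul_le_mul_of_nonneg_left ?_ (hτ0 u)
          refine Real.exp_le_exp.2 (neg_le_neg ?_)
          refine mul_le_mul_of_nonneg_right ?_ h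
          exact Nat.one_div_le_one_div hnm
      · filter_upwards with u
        refine (ENNReal.continuous_ofReal.tendsto _).comp ?_
        refine Tendsto.mul_const _ ?_
        have hc : Continuous (fun δ : ℝ => τ u * Real.exp (-(δ * u))) := by fun_prop
        have := (hc.tendsto 0).comp tendsto_one_div_add_atTop_nhds_zero_nat
        simpa [Function.comp_def] using this
    have h2 : Tendsto (fun n : ℕ => ENNReal.ofReal (W ((1 : ℝ) / ((n : ℝ) + 1)) x)) atTop (𝓝 (ENNReal.ofReal (S x).re)) :=
      (ENNReal.continuous_ofReal.tendsto _).comp ((hSre x).comp hseq)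
    refine tendsto_nhds_unique h1 (h2.congr ?_)
    intro n
    simp only [W]
    rw [ofReal_integral_eq_lintegral_ofReal (hint _ (by positivity) x)]
    filter_upwards with u
    have := hτ0 u
    have := kk_nonneg Λ hΛ (x - u)
    simp only [Pi.zero_apply]
    positivity
  have hnn : ∀ x, 0 ≤ᵐ[volume] (fun u => τ u * kk Λ (x - u)) := by
    intro x
    filter_upwards with u using mul_nonneg (hτ0 u) (kk_nonneg Λ hΛ _)
  have hms : ∀ x, AEStronglyMeasurable (fun u => τ u * kk Λ (x - u)) := by
    intro x
    have hkm := (kk_cont Λ).measurable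
    refine Measurable.aestronglyMeasurable ?_
    fun_prop
  constructor
  · intro x
    refine ⟨hms x, ?_⟩
    rw [hasFiniteIntegral_iff_ofReal (hnn x), hlint]
    exact ENNReal.ofReal_lt_top
  · have h1 : (fun x => ∫ u, τ u * kk Λ (x - u)) = fun x => (S x).re := by
      ext x
      rw [integral_eq_lintegral_of_nonneg_ae (hnn x) (hms x), hlint, ENNReal.toReal_ofReal (hSnn x)]
    rw [h1]
    have := (Complex.continuous_re.tendsto _).comp hStop
    rw [Complex.ofReal_re] at this
    exact this

end core2

noncomputable def jj (Λ ε : ℝ) : ℝ → ℝ := (Icc (-ε) ε).indicator (kk Λ)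

lemma jj_int (Λ ε : ℝ) (hΛ : 0 < Λ) : Integrable (jj Λ ε) := (kk_int Λ hΛ).indicator measurableSet_Icc

lemma jj_lim (ε : ℝ) (hε : 0 < ε) : Tendsto (fun Λ => ∫ y, jj Λ ε y) atTop (𝓝 (∫ y, fej y)) := by
  have h1 : ∀ Λ > 0, ∫ y, jj Λ ε y = ∫ y, (Icc (-(Λ * ε)) (Λ * ε)).indicator fej y := by
    intro Λ hΛ
    have := Measure.integral_comp_mul_left (fun y => (Icc (-(Λ * ε)) (Λ * ε)).indicator fej y) Λ
    rw [abs_of_pos (by positivity), smul_eq_mul] at this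
    have h2 : ∫ y, (Icc (-(Λ * ε)) (Λ * ε)).indicator fej y = Λ * ∫ x, (Icc (-(Λ * ε)) (Λ * ε)).indicator fej (Λ * x) := by
      rw [this]; field_simp
    rw [h2, ← integral_const_mul]
    congr 1; ext y
    unfold jj
    rw [indicator_apply, indicator_apply]
    have : y ∈ Icc (-ε) ε ↔ Λ * y ∈ Icc (-(Λ * ε)) (Λ * ε) := by
      simp only [mem_Icc]
      rw [← mul_neg, mul_le_mul_iff_right₀ hΛ, mul_le_mul_iff_right₀ hΛ]
    simp only [this, kk]
    split_ifs <;> simp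
  have h2 : Tendsto (fun Λ => ∫ y, (Icc (-(Λ * ε)) (Λ * ε)).indicator fej y) atTop (𝓝 (∫ y, fej y)) := by
    refine tendsto_integral_filter_of_dominated_convergence fej ?_ ?_ fej_int ?_
    · filter_upwards with Λ
      exact (fej_int.indicator measurableSet_Icc).1
    · filter_upwards with Λ
      filter_upwards with y
      rw [indicator_apply]
      split_ifs
      · rw [Real.norm_of_nonneg (fej_nonneg y)]
      · simpa using fej_nonneg y
    · filter_upwards with y
      refine tendsto_const_nhds.congr' ?_
      filter_upwards [eventually_ge_atTop (|y| / ε)] with Λ hΛ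
      rw [div_le_iff₀ hε] at hΛ
      rw [indicator_of_mem]
      exact abs_le.1 hΛ
  refine h2.congr' ?_
  filter_upwards [eventually_gt_atTop 0] with Λ hΛ using (h1 Λ hΛ).symm

theorem taub {τ q r : ℝ → ℝ} {c : ℝ} (hτ0 : ∀ u, 0 ≤ τ u) (hτm : Measurable τ) (hτn : ∀ u < 0, τ u = 0)
    (hmono : ∀ x y, x ≤ y → Real.exp x * τ x ≤ Real.exp y * τ y)
    (hτi : ∀ δ > 0, Integrable (dm τ δ))
    (hq : Integrable q) (hqn : ∀ u < 0, q u = 0) (hr : Integrable r)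
    (hrn : ∀ u < 0, r u = 0) 
    (hlap : ∀ δ > 0, ∀ t : ℝ, FF (dm τ δ) t = ((δ : ℂ) + t * Complex.I)⁻¹ * Complex.exp (c + EE q r δ t)) :
    Tendsto τ atTop (𝓝 (Real.exp (c + ((∫ u, q u) + ∫ u, r u)))) := by
  have core := fun Λ (hΛ : 0 < Λ) => core_lim hΛ hτ0 hτm hτn hτi hq hqn hr hrn hlap
  set a := Real.exp (c + ((∫ u, q u) + ∫ u, r u)) with ha
  have hap : 0 < a := Real.exp_pos _
  set I := ∫ y, fej y with hI
  have hIp : 0 < I := fej_pos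
  have hcmp : ∀ x y, x ≤ y → Real.exp (x - y) * τ x ≤ τ y := by
    intro x y h
    have := hmono x y h
    rw [Real.exp_sub, div_mul_eq_mul_div, div_le_iff₀ (Real.exp_pos _)]
    linarith
  have U : ∀ Λ > 0, ∀ ε > 0, ∀ x, τ x * Real.exp (-(2 * ε)) * ∫ y, jj Λ ε y ≤ ∫ u, τ u * kk Λ (x + ε - u) := by
    intro Λ hΛ ε hε x
    rw [← integral_sub_left_eq_self (jj Λ ε) volume (x + ε), ← integral_const_mul]
    refine integral_mono (((jj_int Λ ε hΛ).comp_sub_left _).const_mul _) ((core Λ hΛ).1 _) ?_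
    intro u
    simp only [jj]
    rw [indicator_apply]
    have hk := kk_nonneg Λ hΛ (x + ε - u)
    split_ifs with h
    · refine mul_le_mul_of_nonneg_right ?_ hk
      obtain ⟨h1, h2⟩ := h
      refine le_trans ?_ (hcmp x u (by linarith))
      rw [mul_comm]
      refine mul_le_mul_of_nonneg_right (Real.exp_le_exp.2 (by linarith)) (hτ0 x)
    · rw [mul_zero]
      exact mul_nonneg (hτ0 u) hk
  -- boundedness
  obtain ⟨C, hC0, hC⟩ : ∃ C, 0 ≤ C ∧ ∀ x, τ x ≤ C := by
    obtain ⟨Λ, hΛ, hJ⟩ := ((eventually_gt_atTop 0).and ((jj_lim 1 one_pos).eventually (lt_mem_nhds hIp))).exists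
    have h1 := ((core Λ hΛ).2.eventually (gt_mem_nhds (lt_add_one (a * I))))
    obtain ⟨X, hX⟩ := eventually_atTop.1 h1
    set D := Real.exp (-(2 * 1)) * ∫ y, jj Λ 1 y with hD
    have hDp : 0 < D := mul_pos (Real.exp_pos _) hJ
    refine ⟨max ((a * I + 1) / D) (Real.exp X * τ X), ?_, ?_⟩
    · exact le_max_of_le_left (by positivity)
    · intro x
      rcases le_or_gt X x with h | h
      · refine le_max_of_le_left ?_
        rw [le_div_iff₀ hDp, hD, ← mul_assoc]
        exact (U Λ hΛ 1 one_pos x).trans (hX (x + 1) (by linarith)).le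
      · refine le_max_of_le_right ?_
        rcases lt_or_ge x 0 with h' | h'
        · rw [hτn x h']; exact mul_nonneg (Real.exp_pos _).le (hτ0 _)
        · refine le_trans ?_ (hmono x X h.le)
          exact le_mul_of_one_le_left (hτ0 x) (Real.one_le_exp h')
  have L : ∀ Λ > 0, ∀ ε > 0, ∀ x, ∫ u, τ u * kk Λ (x - ε - u) ≤ 
      τ x * Real.exp (2 * ε) * I + C * (I - ∫ y, jj Λ ε y) := by
    intro Λ hΛ ε hε x
    have hi1 := (jj_int Λ ε hΛ).comp_sub_left (x - ε)
    have hi2 := (kk_int Λ hΛ).comp_sub_left (x - ε)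
    have hle : ∀ y, jj Λ ε y ≤ kk Λ y := by
      intro y; unfold jj; rw [indicator_apply]
      split_ifs
      · rfl
      · exact kk_nonneg Λ hΛ y
    have e : τ x * Real.exp (2 * ε) * I + C * (I - ∫ y, jj Λ ε y) = 
       ∫ u, (τ x * Real.exp (2 * ε) * kk Λ (x - ε - u) + C * (kk Λ (x - ε - u) - jj Λ ε (x - ε - u))) := by
      have hi3 : Integrable (fun u => kk Λ (x - ε - u) - jj Λ ε (x - ε - u)) := hi2.sub hi1
      rw [integral_add (hi2.const_mul _) (hi3.const_mul _), integral_const_mul, integral_const_mul,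
        integral_sub hi2 hi1, integral_sub_left_eq_self (jj Λ ε) volume, integral_sub_left_eq_self (kk Λ) volume,
        kk_integral Λ hΛ]
    rw [e]
    refine integral_mono ((core Λ hΛ).1 _) ((hi2.const_mul _).add ((hi2.sub hi1).const_mul _)) ?_
    intro u
    have hk := kk_nonneg Λ hΛ (x - ε - u)
    have hx := hτ0 x
    have hx' := Real.exp_pos (2 * ε)
    simp only [jj]
    rw [indicator_apply]
    split_ifs with h
    · rw [sub_self, mul_zero, add_zero]
      refine mul_le_mul_of_nonneg_right ?_ hk
      obtain ⟨h1, h2⟩ := h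
      have h3 := hcmp u x (by linarith)
      have h4 : Real.exp (-(2 * ε)) * τ u ≤ τ x := by
        refine le_trans ?_ h3
        refine mul_le_mul_of_nonneg_right (Real.exp_le_exp.2 (by linarith)) (hτ0 u)
      rw [Real.exp_neg, inv_mul_le_iff₀ hx'] at h4
      linarith
    · rw [sub_zero]
      have : τ u * kk Λ (x - ε - u) ≤ C * kk Λ (x - ε - u) := mul_le_mul_of_nonneg_right (hC u) hk
      have : 0 ≤ τ x * Real.exp (2 * ε) * kk Λ (x - ε - u) := by positivity
      linarith
  have hexp : ∀ b : ℝ, Tendsto (fun ε => b * Real.exp (2 * ε)) (𝓝[>] 0) (𝓝 b) := by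
    intro b
    have : Continuous (fun ε => b * Real.exp (2 * ε)) := by fun_prop
    have := (this.tendsto 0).mono_left (nhdsWithin_le_nhds (s := Ioi (0:ℝ)))
    simpa using this
  rw [tendsto_order]
  constructor
  · intro b hb
    obtain ⟨ε, hε, hbε⟩ := (evd.and ((hexp b).eventually (gt_mem_nhds hb))).exists
    have h1 : Tendsto (fun Λ => b * Real.exp (2 * ε) * I + C * (I - ∫ y, jj Λ ε y)) atTop (𝓝 (b * Real.exp (2 * ε) * I + C * (I - I))) :=
      tendsto_const_nhds.add ((tendsto_const_nhds.sub (jj_lim ε hε.1)).const_mul C)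
    have h2 : b * Real.exp (2 * ε) * I + C * (I - I) < a * I := by
      rw [sub_self, mul_zero, add_zero]; exact mul_lt_mul_of_pos_right hbε hIp
    obtain ⟨Λ, hΛ, hJ⟩ := ((eventually_gt_atTop 0).and (h1.eventually (gt_mem_nhds h2))).exists
    have h3 := ((core Λ hΛ).2.comp (tendsto_atTop_add_const_right atTop (-ε) tendsto_id)).eventually (lt_mem_nhds hJ)
    filter_upwards [h3] with x hx
    simp only [Function.comp_def, id] at hx
    have h4 := L Λ hΛ ε hε.1 x
    rw [sub_eq_add_neg x ε] at h4
    have h5 : b * Real.exp (2 * ε) * I < τ x * Real.exp (2 * ε) * I := by linarith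
    have := (mul_lt_mul_iff_left₀ hIp).1 h5
    exact (mul_lt_mul_iff_left₀ (Real.exp_pos _)).1 this
  · intro b hb
    obtain ⟨ε, hε, hbε⟩ := (evd.and ((hexp a).eventually (gt_mem_nhds hb))).exists
    have h1 : Tendsto (fun Λ => b * Real.exp (-(2 * ε)) * ∫ y, jj Λ ε y) atTop (𝓝 (b * Real.exp (-(2 * ε)) * I)) :=
      (jj_lim ε hε.1).const_mul _
    have h2 : a * I < b * Real.exp (-(2 * ε)) * I := by
      refine mul_lt_mul_of_pos_right ?_ hIp
      rw [Real.exp_neg, ← div_eq_mul_inv, lt_div_iff₀ (Real.exp_pos _)]; exact hbε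
    obtain ⟨Λ, hΛ, hJ, hJ2⟩ := ((eventually_gt_atTop 0).and ((h1.eventually (lt_mem_nhds h2)).and ((jj_lim ε hε.1).eventually (lt_mem_nhds hIp)))).exists
    have h3 := ((core Λ hΛ).2.comp (tendsto_atTop_add_const_right atTop ε tendsto_id)).eventually (gt_mem_nhds hJ)
    filter_upwards [h3] with x hx
    simp only [Function.comp_def, id] at hx
    have h4 := U Λ hΛ ε hε.1 x
    have h5 := lt_of_le_of_lt h4 hx
    have := (mul_lt_mul_iff_left₀ hJ2).1 h5
    exact (mul_lt_mul_iff_left₀ (Real.exp_pos _)).1 this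

theorem int_tail_C {s : ℂ} (hs : 0 < s.re) (l : ℝ) :
    Integrable (fun u : ℝ => (Ici l).indicator (fun u : ℝ => Complex.exp (-s * u)) u) ∧
    ∫ u : ℝ, (Ici l).indicator (fun u : ℝ => Complex.exp (-s * u)) u = Complex.exp (-s * l) / s := by
  have h1 : (-s).re < 0 := by simpa using hs
  constructor
  · rw [integrable_indicator_iff measurableSet_Ici, integrableOn_Ici_iff_integrableOn_Ioi]
    exact integrableOn_exp_mul_complex_Ioi h1 l
  · rw [integral_indicator measurableSet_Ici, integral_Ici_eq_integral_Ioi, integral_exp_mul_complex_Ioi h1 l]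
    rw [neg_div_neg_eq]

theorem norm_cexp_mul (s : ℂ) (u : ℝ) : ‖Complex.exp (-s * u)‖ = Real.exp (-s.re * u) := by
  rw [Complex.norm_exp]; simp

theorem int_tail_R {σ : ℝ} (hs : 0 < σ) (l : ℝ) :
    Integrable (fun u : ℝ => (Ici l).indicator (fun u : ℝ => Real.exp (-σ * u)) u) ∧
    ∫ u : ℝ, (Ici l).indicator (fun u : ℝ => Real.exp (-σ * u)) u = Real.exp (-σ * l) / σ := by
  have h1 : -σ < 0 := by simpa using hs
  constructor
  · rw [integrable_indicator_iff measurableSet_Ici, integrableOn_Ici_iff_integrableOn_Ioi]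
    exact integrableOn_exp_mul_Ioi h1 l
  · rw [integral_indicator measurableSet_Ici, integral_Ici_eq_integral_Ioi, integral_exp_mul_Ioi h1 l]
    rw [neg_div_neg_eq]

theorem cnt_hasSum {ι : Type*} [Countable ι] {w l : ι → ℝ} (hw : ∀ i, 0 ≤ w i) {s : ℂ} (hs : 0 < s.re)
    (hsum : Summable fun i => w i * Real.exp (-s.re * l i)) :
    HasSum (fun i => (w i : ℂ) * Complex.exp (-s * l i) / s)
      (∫ u : ℝ, ((∑' i, if l i ≤ u then w i else 0 : ℝ) : ℂ) * Complex.exp (-s * u)) := by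
  have key := hasSum_integral_of_summable_integral_norm (μ := (volume : Measure ℝ))
    (F := fun i (u : ℝ) => (w i : ℂ) * (Ici (l i)).indicator (fun u : ℝ => Complex.exp (-s * u)) u)
    (fun i => (int_tail_C hs (l i)).1.const_mul _) ?_
  · have e1 : (fun i => (w i : ℂ) * Complex.exp (-s * l i) / s) = fun i => ∫ u : ℝ, (w i : ℂ) *
        (Ici (l i)).indicator (fun u : ℝ => Complex.exp (-s * u)) u := by
      funext i
      rw [integral_const_mul, (int_tail_C hs (l i)).2]; ring
    have e2 : (∫ u : ℝ, ((∑' i, if l i ≤ u then w i else 0 : ℝ) : ℂ) * Complex.exp (-s * u)) =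
        ∫ u : ℝ, ∑' i, (w i : ℂ) * (Ici (l i)).indicator (fun u : ℝ => Complex.exp (-s * u)) u := by
      refine integral_congr_ae (Eventually.of_forall fun u => ?_)
      simp only
      rw [Complex.ofReal_tsum, ← tsum_mul_right]
      refine tsum_congr fun i => ?_
      by_cases h : l i ≤ u
      · simp [h]
      · simp [h]
    rw [e1, e2]
    exact key
  · refine (hsum.div_const s.re).congr fun i => ?_
    have : ∀ u, ‖(w i : ℂ) * (Ici (l i)).indicator (fun u : ℝ => Complex.exp (-s * u)) u‖ =
        w i * (Ici (l i)).indicator (fun u : ℝ => Real.exp (-s.re * u)) u := by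
      intro u
      rw [norm_mul, Complex.norm_real, Real.norm_of_nonneg (hw i), norm_indicator_eq_indicator_norm]
      simp only [norm_cexp_mul]
    simp only [this]
    rw [integral_const_mul, (int_tail_R hs (l i)).2]; ring

theorem cnt_summable {ι : Type*} {w l : ι → ℝ} (hw : ∀ i, 0 ≤ w i) {σ : ℝ} (hs : 0 < σ)
    (hfs : ∀ u : ℝ, Summable fun i => if l i ≤ u then w i else 0)
    (hint : Integrable fun u : ℝ => (∑' i, if l i ≤ u then w i else 0) * Real.exp (-σ * u)) :
    Summable fun i => w i * Real.exp (-σ * l i) := by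
  refine summable_of_sum_le (c := σ * ∫ u : ℝ, (∑' i, if l i ≤ u then w i else 0) * Real.exp (-σ * u))
    (fun i => mul_nonneg (hw i) (Real.exp_pos _).le) fun S => ?_
  have h1 : ∑ i ∈ S, w i * Real.exp (-σ * l i) = σ * ∫ u : ℝ, ∑ i ∈ S, w i *
     (Ici (l i)).indicator (fun u : ℝ => Real.exp (-σ * u)) u := by
    rw [integral_finsetSum _ fun i _ => (int_tail_R hs (l i)).1.const_mul _, Finset.mul_sum]
    refine Finset.sum_congr rfl fun i _ => ?_
    rw [integral_const_mul, (int_tail_R hs (l i)).2]; field_simp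
  rw [h1]
  refine mul_le_mul_of_nonneg_left ?_ hs.le
  refine integral_mono (integrable_finsetSum _ fun i _ => (int_tail_R hs (l i)).1.const_mul _) hint fun u => ?_
  have h2 : ∑ i ∈ S, w i * (Ici (l i)).indicator (fun u : ℝ => Real.exp (-σ * u)) u =
    (∑ i ∈ S, if l i ≤ u then w i else 0) * Real.exp (-σ * u) := by
    rw [Finset.sum_mul]
    refine Finset.sum_congr rfl fun i _ => ?_
    by_cases h : l i ≤ u <;> simp [h]
  simp only [h2]
  refine mul_le_mul_of_nonneg_right ?_ (Real.exp_pos _).le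
  exact (hfs u).sum_le_tsum S fun i _ => by split_ifs; exacts [hw i, le_rfl]

theorem tsum_ite_card {ι : Type*} (P : ι → Prop) (c : ℝ) :
    ∑' i, (if P i then c else 0) = (Nat.card {i // P i} : ℝ) * c := by
  have := tsum_subtype {i | P i} (fun _ => c)
  rw [tsum_const] at this
  rw [nsmul_eq_mul] at this
  exact this.symm

noncomputable def boxS (n : ℕ) : Finset (ℕ →₀ ℕ) := (Finset.range n).finsupp fun _ => Finset.range n

theorem mem_boxS {n : ℕ} {α : ℕ →₀ ℕ} : α ∈ boxS n ↔ α.support ⊆ Finset.range n ∧ ∀ i, i < n → α i < n := by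
  rw [boxS, Finset.mem_finsupp_iff]; simp

theorem boxS_mono : Monotone boxS := by
  intro a b hab α hα
  rw [mem_boxS] at *
  refine ⟨hα.1.trans (Finset.range_mono hab), fun i _ => ?_⟩
  by_cases hi : i < a
  · exact (hα.2 i hi).trans_le hab
  · have : α i = 0 := by
      by_contra h
      exact hi (Finset.mem_range.1 (hα.1 (Finsupp.mem_support_iff.2 h)))
    omega

theorem boxS_ex (α : ℕ →₀ ℕ) : ∃ n, α ∈ boxS n := by
  refine ⟨(∑ i ∈ α.support, (i + 1)) + (∑ i ∈ α.support, α i) + 1, mem_boxS.2 ⟨fun i hi => ?_, fun i _ => ?_⟩⟩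
  · have := Finset.single_le_sum (f := fun i => i + 1) (fun _ _ => Nat.zero_le _) hi
    rw [Finset.mem_range]; omega
  · by_cases hi : i ∈ α.support
    · have := Finset.single_le_sum (f := fun i => α i) (fun _ _ => Nat.zero_le _) hi
      omega
    · rw [Finsupp.notMem_support_iff.1 hi]; omega

theorem boxS_tendsto : Tendsto boxS atTop atTop :=
  Filter.tendsto_atTop_finset_of_monotone boxS_mono boxS_ex

theorem box_prod {R : Type*} [CommRing R] (x : ℕ → R) (n : ℕ) :
    ∑ α ∈ boxS n, α.prod (fun k e => x k ^ e) = ∏ k ∈ Finset.range n, ∑ e ∈ Finset.range n, x k ^ e := by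
  rw [Finset.prod_sum, boxS, Finset.finsupp, Finset.sum_map]
  refine Finset.sum_congr (by congr!) fun f hf => ?_
  simp only [Function.Embedding.coeFn_mk]
  rw [Finsupp.prod_of_support_subset _ (Finsupp.support_indicator_subset _ _) _ (by simp)]
  rw [← Finset.prod_attach]
  refine Finset.prod_congr rfl fun k _ => ?_
  rw [Finsupp.indicator_of_mem k.2]

theorem euler_summable {y : ℕ → ℝ} (hy0 : ∀ k, 0 ≤ y k) (hy1 : ∀ k, y k < 1)
    (hs : Summable fun kj : ℕ × ℕ => y kj.1 ^ (kj.2 + 1) / ((kj.2 : ℝ) + 1)) :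
    Summable fun α : ℕ →₀ ℕ => α.prod fun k e => y k ^ e := by
  have hL : HasSum (fun k => -Real.log (1 - y k)) (∑' kj : ℕ × ℕ, y kj.1 ^ (kj.2 + 1) / ((kj.2 : ℝ) + 1)) :=
    hs.hasSum.prod_fiberwise fun k => Real.hasSum_pow_div_log_of_abs_lt_one (by rw [abs_of_nonneg (hy0 k)]; exact hy1 k)
  have hnn : ∀ α : ℕ →₀ ℕ, 0 ≤ α.prod fun k e => y k ^ e := fun α =>
    Finset.prod_nonneg fun k _ => pow_nonneg (hy0 k) _
  refine summable_of_sum_le (c := Real.exp (∑' kj : ℕ × ℕ, y kj.1 ^ (kj.2 + 1) / ((kj.2 : ℝ) + 1))) hnn fun T => ?_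
  obtain ⟨n, hn⟩ := (boxS_tendsto.eventually (eventually_ge_atTop T)).exists
  refine (Finset.sum_le_sum_of_subset_of_nonneg hn fun _ _ _ => hnn _).trans ?_
  rw [box_prod]
  calc ∏ k ∈ Finset.range n, ∑ e ∈ Finset.range n, y k ^ e
      ≤ ∏ k ∈ Finset.range n, Real.exp (-Real.log (1 - y k)) := by
        refine Finset.prod_le_prod (fun k _ => Finset.sum_nonneg fun _ _ => pow_nonneg (hy0 k) _) fun k _ => ?_
        rw [Real.exp_neg, Real.exp_log (by linarith [hy1 k]), ← tsum_geometric_of_lt_one (hy0 k) (hy1 k)]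
        exact (summable_geometric_of_lt_one (hy0 k) (hy1 k)).sum_le_tsum _ fun _ _ => pow_nonneg (hy0 k) _
    _ = Real.exp (∑ k ∈ Finset.range n, -Real.log (1 - y k)) := (Real.exp_sum _ _).symm
    _ ≤ _ := by
        refine Real.exp_le_exp.2 (sum_le_hasSum _ (fun k _ => ?_) hL)
        have := Real.log_nonpos (x := 1 - y k) (by linarith [hy1 k]) (by linarith [hy0 k])
        linarith

theorem norm_nat_add_one (n : ℕ) : ‖(n : ℂ) + 1‖ = (n : ℝ) + 1 := by
  have : (n : ℂ) + 1 = ((n + 1 : ℕ) : ℂ) := by push_cast; rfl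
  rw [this, Complex.norm_natCast]; push_cast; rfl

theorem hasSum_fib_C (f : ℕ × ℕ → ℂ) (g : ℕ → ℂ) (a : ℂ) (h : HasSum f a)
    (h2 : ∀ k, HasSum (fun j => f (k, j)) (g k)) : HasSum g a := h.prod_fiberwise h2

theorem euler_prod {x : ℕ → ℂ} (hy1 : ∀ k, ‖x k‖ < 1)
    (hs : Summable fun kj : ℕ × ℕ => ‖x kj.1‖ ^ (kj.2 + 1) / ((kj.2 : ℝ) + 1)) :
    ∑' α : ℕ →₀ ℕ, (α.prod fun k e => x k ^ e) =
      Complex.exp (∑' kj : ℕ × ℕ, x kj.1 ^ (kj.2 + 1) / ((kj.2 : ℂ) + 1)) := by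
  have hsC : Summable fun kj : ℕ × ℕ => x kj.1 ^ (kj.2 + 1) / ((kj.2 : ℂ) + 1) := by
    refine Summable.of_norm (hs.congr fun kj => ?_)
    rw [norm_div, norm_pow]
    rw [norm_nat_add_one]
  have hL : HasSum (fun k => -Complex.log (1 - x k)) (∑' kj : ℕ × ℕ, x kj.1 ^ (kj.2 + 1) / ((kj.2 : ℂ) + 1)) := by
    have h2 : ∀ k, HasSum (fun j : ℕ => x k ^ (j + 1) / ((j : ℂ) + 1)) (-Complex.log (1 - x k)) := fun k => by
      have := Complex.hasSum_taylorSeries_neg_log' (hy1 k)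
      exact this
    have h3 := hsC.hasSum
    generalize (∑' kj : ℕ × ℕ, x kj.1 ^ (kj.2 + 1) / ((kj.2 : ℂ) + 1)) = A at h3
    refine hasSum_fib_C _ _ A h3 ?_
    exact h2
  have hsumα : Summable fun α : ℕ →₀ ℕ => α.prod fun k e => x k ^ e := by
    refine Summable.of_norm ((euler_summable (fun k => norm_nonneg (x k)) hy1 hs).congr fun α => ?_)
    simp [Finsupp.prod, norm_prod]
  have l1 : Tendsto (fun n => ∑ α ∈ boxS n, α.prod (fun k e => x k ^ e)) atTop
      (𝓝 (∑' α : ℕ →₀ ℕ, (α.prod fun k e => x k ^ e))) := hsumα.hasSum.comp boxS_tendsto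
  have hne : ∀ k, 1 - x k ≠ 0 := fun k h => by
    have := hy1 k
    rw [← sub_eq_zero.1 h] at this; simp at this
  have e1 : ∀ n, ∑ α ∈ boxS n, α.prod (fun k e => x k ^ e) =
      (∏ k ∈ Finset.range n, (1 + -(x k ^ n))) * Complex.exp (∑ k ∈ Finset.range n, -Complex.log (1 - x k)) := by
    intro n
    rw [box_prod, Complex.exp_sum, ← Finset.prod_mul_distrib]
    refine Finset.prod_congr rfl fun k _ => ?_
    rw [Complex.exp_neg, Complex.exp_log (hne k), geom_sum_eq (fun h => hne k (by rw [h]; ring))]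
    have h2 : x k - 1 ≠ 0 := fun h => hne k (by linear_combination -h)
    have h3 := hne k
    field_simp
    ring
  have hsy : Summable fun k => ‖x k‖ := by
    have := hs.comp_injective (i := fun k : ℕ => (k, 0)) (fun a b h => by simpa using h)
    simpa [Function.comp_def] using this
  have l2 : Tendsto (fun n => ∑' k, ‖x k‖ ^ n) atTop (𝓝 (∑' _ : ℕ, (0:ℝ))) := by
    refine tendsto_tsum_of_dominated_convergence hsy (fun k => tendsto_pow_atTop_nhds_zero_of_lt_one (norm_nonneg _) (hy1 k)) ?_
    filter_upwards [eventually_ge_atTop 1] with n hn k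
    rw [norm_pow, norm_norm]
    exact pow_le_of_le_one (norm_nonneg _) (hy1 k).le (by omega)
  rw [tsum_zero] at l2
  have l3 : Tendsto (fun n => ∏ k ∈ Finset.range n, (1 + -(x k ^ n))) atTop (𝓝 1) := by
    rw [tendsto_iff_norm_sub_tendsto_zero]
    have l4 : Tendsto (fun n => Real.exp (∑' k, ‖x k‖ ^ n) - 1) atTop (𝓝 0) := by
      have := ((Real.continuous_exp.tendsto 0).comp l2).sub_const 1
      simpa using this
    refine squeeze_zero' (Eventually.of_forall fun _ => norm_nonneg _) ?_ l4
    filter_upwards [eventually_ge_atTop 1] with n hn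
    refine (Finset.norm_prod_one_add_sub_one_le _ _).trans ?_
    refine sub_le_sub_right (Real.exp_le_exp.2 ?_) _
    simp only [norm_neg, norm_pow]
    refine Summable.sum_le_tsum _ (fun _ _ => by positivity) ?_
    exact Summable.of_nonneg_of_le (fun _ => by positivity)
      (fun k => pow_le_of_le_one (norm_nonneg _) (hy1 k).le (by omega)) hsy
  have l5 := l3.mul ((Complex.continuous_exp.tendsto _).comp hL.tendsto_sum_nat)
  rw [one_mul] at l5
  refine tendsto_nhds_unique l1 (l5.congr fun n => ?_)
  rw [e1]; rfl

noncomputable def wP (kj : ℕ × ℕ) : ℝ := 1 / ((kj.2 : ℝ) + 1)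
noncomputable def lP (p : ℕ → ℝ) (kj : ℕ × ℕ) : ℝ := ((kj.2 : ℝ) + 1) * Real.log (p kj.1)

theorem wP_nonneg (kj : ℕ × ℕ) : 0 ≤ wP kj := by unfold wP; positivity

section
variable {p : ℕ → ℝ} (hmono : Monotone p) (hp1 : 1 < p 0) (hptop : Tendsto p atTop atTop)
include hmono hp1

theorem p_gt (k : ℕ) : 1 < p k := hp1.trans_le (hmono (Nat.zero_le k))

theorem logp_ge (k : ℕ) : Real.log (p 0) ≤ Real.log (p k) :=
  Real.log_le_log (by linarith) (hmono (Nat.zero_le k))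

theorem logp_pos (k : ℕ) : 0 < Real.log (p k) := Real.log_pos (p_gt hmono hp1 k)

theorem lP_nonneg (kj : ℕ × ℕ) : 0 < lP p kj := mul_pos (by positivity) (logp_pos hmono hp1 _)

include hptop

theorem lP_fin (u : ℝ) : {kj : ℕ × ℕ | lP p kj ≤ u}.Finite := by
  have h1 : {k : ℕ | Real.log (p k) ≤ u}.Finite := by
    have h := hptop.eventually_gt_atTop (Real.exp u)
    obtain ⟨n, hn⟩ := eventually_atTop.1 h
    refine (Set.finite_lt_nat n).subset fun k hk => ?_
    by_contra h2
    have h3 := hn k (not_lt.1 h2)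
    have := (Real.lt_log_iff_exp_lt (by linarith [p_gt hmono hp1 k])).2 h3
    exact absurd hk (not_le.2 this)
  obtain ⟨m, hm⟩ := exists_nat_gt (u / Real.log (p 0))
  refine (h1.prod (Set.finite_lt_nat m)).subset fun kj hkj => ?_
  have hkj : ((kj.2 : ℝ) + 1) * Real.log (p kj.1) ≤ u := hkj
  have a1 := logp_pos hmono hp1 kj.1
  have a2 := logp_ge hmono hp1 kj.1
  have a3 := logp_pos hmono hp1 0
  have a4 : (0:ℝ) ≤ kj.2 := by positivity
  rw [div_lt_iff₀ a3] at hm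
  refine ⟨?_, ?_⟩
  · show Real.log (p kj.1) ≤ u
    nlinarith
  · show kj.2 < m
    have : (kj.2 : ℝ) < m := by
      by_contra h
      push Not at h
      nlinarith
    exact_mod_cast this

theorem P_summable (u : ℝ) : Summable fun kj => if lP p kj ≤ u then wP kj else 0 := by
  refine summable_of_hasFiniteSupport ((lP_fin hmono hp1 hptop u).subset fun kj h => ?_)
  by_contra h2
  have h2 : ¬ lP p kj ≤ u := h2
  simp [h2] at h

theorem P_eq (u : ℝ) : PiCount p (Real.exp u) = ∑' kj, if lP p kj ≤ u then wP kj else 0 := by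
  rw [(P_summable hmono hp1 hptop u).tsum_prod]
  have hs := P_summable hmono hp1 hptop u
  rw [← Summable.tsum_comm (f := fun k j => if lP p (k, j) ≤ u then wP (k, j) else 0) hs]
  unfold PiCount
  refine tsum_congr fun j => ?_
  rw [div_eq_mul_one_div, ← tsum_ite_card]
  refine tsum_congr fun k => ?_
  have : p k ≤ Real.exp u ^ ((1:ℝ) / (j + 1)) ↔ lP p (k, j) ≤ u := by
    rw [← Real.exp_mul, ← Real.log_le_iff_le_exp (by linarith [p_gt hmono hp1 k]), mul_one_div,
      le_div_iff₀ (by positivity), mul_comm]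
    rfl
  simp only [this, wP]

theorem P_neg (u : ℝ) (hu : u < 0) : PiCount p (Real.exp u) = 0 := by
  rw [P_eq hmono hp1 hptop]
  convert tsum_zero with kj
  rw [if_neg]
  have := lP_nonneg hmono hp1 kj
  linarith

theorem P_nonneg (u : ℝ) : 0 ≤ PiCount p (Real.exp u) := by
  rw [P_eq hmono hp1 hptop]
  exact tsum_nonneg fun kj => by split_ifs; exacts [wP_nonneg _, le_rfl]

theorem P_mono : Monotone fun u => PiCount p (Real.exp u) := by
  intro a b hab
  simp only [P_eq hmono hp1 hptop]
  refine Summable.tsum_le_tsum (fun kj => ?_) (P_summable hmono hp1 hptop a) (P_summable hmono hp1 hptop b)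
  have := wP_nonneg kj
  split_ifs with h1 h2 h2
  · exact le_rfl
  · exact absurd (h1.trans hab) h2
  · exact this
  · exact le_rfl

omit hptop

theorem nval_pos (α : ℕ →₀ ℕ) : 0 < nval p α :=
  Finset.prod_pos fun k _ => pow_pos (by linarith [p_gt hmono hp1 k]) _

theorem nval_ge_one (α : ℕ →₀ ℕ) : 1 ≤ nval p α := by
  unfold nval Finsupp.prod
  refine Finset.prod_induction _ (fun x : ℝ => 1 ≤ x) (fun a b ha hb => one_le_mul_of_one_le_of_one_le ha hb) le_rfl fun k _ => one_le_pow₀ (p_gt hmono hp1 k).le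

theorem N_eq (u : ℝ) : (Ncount p (Real.exp u) : ℝ) = ∑' α : ℕ →₀ ℕ, if Real.log (nval p α) ≤ u then (1:ℝ) else 0 := by
  rw [tsum_ite_card, mul_one]
  unfold Ncount
  simp only [Real.log_le_iff_le_exp (nval_pos hmono hp1 _)]

theorem exp_log_nval (s : ℂ) (α : ℕ →₀ ℕ) : Complex.exp (-s * Real.log (nval p α)) =
    α.prod fun k e => Complex.exp (-s * Real.log (p k)) ^ e := by
  unfold nval Finsupp.prod
  rw [Real.log_prod fun k _ => (pow_pos (by linarith [p_gt hmono hp1 k]) _).ne']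
  simp only [Real.log_pow]
  push_cast
  rw [Finset.mul_sum, Complex.exp_sum]
  refine Finset.prod_congr rfl fun k _ => ?_
  rw [← Complex.exp_nat_mul]
  congr 1
  ring

end

section
variable {p : ℕ → ℝ} (hmono : Monotone p) (hp1 : 1 < p 0) (hptop : Tendsto p atTop atTop)
include hmono hp1 hptop

theorem xk_term (s : ℂ) (kj : ℕ × ℕ) : Complex.exp (-s * Real.log (p kj.1)) ^ (kj.2 + 1) / ((kj.2 : ℂ) + 1) =
    (wP kj : ℂ) * Complex.exp (-s * lP p kj) := by
  rw [← Complex.exp_nat_mul, wP, lP]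
  push_cast
  rw [div_eq_mul_one_div, mul_comm]
  congr 2
  ring

theorem xk_term_norm (s : ℂ) (kj : ℕ × ℕ) : ‖Complex.exp (-s * Real.log (p kj.1))‖ ^ (kj.2 + 1) / ((kj.2 : ℝ) + 1) =
    wP kj * Real.exp (-s.re * lP p kj) := by
  rw [norm_cexp_mul, ← Real.exp_nat_mul, wP, lP]
  push_cast
  rw [div_eq_mul_one_div, mul_comm]
  congr 2
  ring

theorem P_sum_exp {σ : ℝ} (hσ : 0 < σ) (hint : Integrable fun u => PiCount p (Real.exp u) * Real.exp (-σ * u)) :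
    Summable fun kj => wP kj * Real.exp (-σ * lP p kj) := by
  refine cnt_summable wP_nonneg hσ (P_summable hmono hp1 hptop) ?_
  simpa only [P_eq hmono hp1 hptop] using hint

theorem xk_norm_lt {s : ℂ} (hs : 0 < s.re) (k : ℕ) : ‖Complex.exp (-s * Real.log (p k))‖ < 1 := by
  rw [norm_cexp_mul, Real.exp_lt_one_iff]
  have := mul_pos hs (logp_pos hmono hp1 k)
  linarith

theorem N_sum_exp {σ : ℝ} (hσ : 0 < σ) (hint : Integrable fun u => PiCount p (Real.exp u) * Real.exp (-σ * u)) :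
    Summable fun α : ℕ →₀ ℕ => (1:ℝ) * Real.exp (-σ * Real.log (nval p α)) := by
  have h1 := P_sum_exp hmono hp1 hptop hσ hint
  have hσ' : 0 < (σ : ℂ).re := by simpa using hσ
  have h2 := euler_summable (y := fun k => ‖Complex.exp (-(σ:ℂ) * Real.log (p k))‖) (fun k => norm_nonneg _)
    (xk_norm_lt hmono hp1 hptop hσ') (h1.congr fun kj => by rw [xk_term_norm hmono hp1 hptop]; simp)
  refine h2.congr fun α => ?_
  have h3 := congrArg norm (exp_log_nval hmono hp1 (σ : ℂ) α)
  rw [norm_cexp_mul] at h3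
  rw [one_mul]
  simp only [Complex.ofReal_re] at h3
  rw [h3]
  simp [Finsupp.prod, norm_prod]

theorem N_fin {σ : ℝ} (hσ : 0 < σ) (hint : Integrable fun u => PiCount p (Real.exp u) * Real.exp (-σ * u)) (x : ℝ) :
    {α : ℕ →₀ ℕ | nval p α ≤ x}.Finite := by
  have h := (N_sum_exp hmono hp1 hptop hσ hint).tendsto_cofinite_zero
  have h2 := h.eventually (gt_mem_nhds (Real.exp_pos (-σ * Real.log x)))
  rw [eventually_cofinite] at h2
  refine h2.subset fun α hα => ?_
  have hα : nval p α ≤ x := hα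
  simp only [Set.mem_setOf_eq, not_lt, one_mul]
  refine Real.exp_le_exp.2 ?_
  have := Real.log_le_log (nval_pos hmono hp1 α) hα
  nlinarith

theorem N_laplace {s : ℂ} (hs : 0 < s.re) (hint : Integrable fun u => PiCount p (Real.exp u) * Real.exp (-s.re * u)) :
    ∫ u : ℝ, ((Ncount p (Real.exp u) : ℝ) : ℂ) * Complex.exp (-s * u) =
      Complex.exp (s * ∫ u : ℝ, (PiCount p (Real.exp u) : ℂ) * Complex.exp (-s * u)) / s := by
  have hs0 : s ≠ 0 := fun h => by simp [h] at hs
  have h1 := P_sum_exp hmono hp1 hptop hs hint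
  have hP := cnt_hasSum wP_nonneg hs h1
  have hN := cnt_hasSum (fun _ => zero_le_one) hs (N_sum_exp hmono hp1 hptop hs hint)
  simp only [← P_eq hmono hp1 hptop] at hP
  simp only [← N_eq hmono hp1] at hN
  have hE := euler_prod (x := fun k => Complex.exp (-s * Real.log (p k))) (xk_norm_lt hmono hp1 hptop hs)
    (h1.congr fun kj => by rw [xk_term_norm hmono hp1 hptop])
  simp only [xk_term hmono hp1 hptop, ← exp_log_nval hmono hp1] at hE
  rw [← hN.tsum_eq, ← hP.tsum_eq, tsum_div_const, tsum_div_const, mul_div_cancel₀ _ hs0]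
  simp only [Complex.ofReal_one, one_mul]
  rw [hE]

theorem N_int {σ : ℝ} (hσ : 0 < σ) (hint : Integrable fun u => PiCount p (Real.exp u) * Real.exp (-σ * u)) :
    Integrable fun u : ℝ => ((Ncount p (Real.exp u) : ℝ) : ℂ) * Complex.exp (-(σ:ℂ) * u) := by
  by_contra h
  have h1 := N_laplace hmono hp1 hptop (s := (σ:ℂ)) (by simpa using hσ) (by simpa using hint)
  rw [integral_undef h] at h1
  have : (σ:ℂ) ≠ 0 := by exact_mod_cast hσ.ne'
  exact (div_ne_zero (Complex.exp_ne_zero _) this) h1.symm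

theorem N_mono {σ : ℝ} (hσ : 0 < σ) (hint : Integrable fun u => PiCount p (Real.exp u) * Real.exp (-σ * u)) :
    Monotone (Ncount p) := by
  intro a b hab
  exact Nat.card_mono (N_fin hmono hp1 hptop hσ hint b) (fun α (hα : nval p α ≤ a) => (hα.trans hab : nval p α ≤ b))

theorem N_neg {x : ℝ} (hx : x < 1) : Ncount p x = 0 := by
  unfold Ncount
  rw [Nat.card_eq_zero]
  left
  exact ⟨fun α => by have := nval_ge_one hmono hp1 α.1; have := α.2; linarith⟩

end

noncomputable def q0 (u : ℝ) : ℝ := ∫ v in Ioc (0:ℝ) 1, Real.exp (-(u * v))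
noncomputable def q1 (u : ℝ) : ℝ := ∫ v in Ioc (0:ℝ) 1, v * Real.exp (-(u * v))
noncomputable def LL (w : ℂ) : ℂ := ∫ v in Ioc (0:ℝ) 1, (w + v)⁻¹

theorem wv_ne {w : ℂ} (hw : 0 < w.re) {v : ℝ} (hv : 0 ≤ v) : w + v ≠ 0 := fun h => by
  have := congrArg Complex.re h
  simp at this; linarith

theorem LL_exp {w : ℂ} (hw : 0 < w.re) : Complex.exp (LL w) = (1 + w) / w := by
  have h0 : w ≠ 0 := fun h => by simp [h] at hw
  have hc : ContinuousOn (fun v : ℝ => (w + v)⁻¹) (uIcc 0 1) := by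
    refine ContinuousOn.inv₀ (by fun_prop) fun v hv => wv_ne hw ?_
    rw [uIcc_of_le zero_le_one] at hv; exact hv.1
  have : LL w = Complex.log (w + (1:ℝ)) - Complex.log (w + (0:ℝ)) := by
    unfold LL
    rw [← intervalIntegral.integral_of_le zero_le_one]
    refine intervalIntegral.integral_eq_sub_of_hasDerivAt (f := fun v : ℝ => Complex.log (w + v)) (fun v hv => ?_) hc.intervalIntegrable
    rw [uIcc_of_le zero_le_one] at hv
    have h1 : HasDerivAt (fun v : ℝ => w + (v:ℂ)) 1 v := (Complex.ofRealCLM.hasDerivAt (x := v)).const_add w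
    have h2 := h1.clog_real (f := fun v : ℝ => w + (v:ℂ)) (by
      left; simp only [Complex.add_re, Complex.ofReal_re]; linarith [hv.1])
    simpa using h2
  rw [this, Complex.exp_sub, Complex.exp_log (wv_ne hw zero_le_one), Complex.exp_log (wv_ne hw le_rfl)]
  simp [add_comm]

theorem LL_one {w : ℂ} (hw : 0 < w.re) : ∫ v in Ioc (0:ℝ) 1, (v:ℂ) * (w + v)⁻¹ = 1 - w * LL w := by
  have hc : ContinuousOn (fun v : ℝ => (w + v)⁻¹) (uIcc 0 1) := by
    refine ContinuousOn.inv₀ (by fun_prop) fun v hv => wv_ne hw ?_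
    rw [uIcc_of_le zero_le_one] at hv; exact hv.1
  unfold LL
  rw [← intervalIntegral.integral_of_le zero_le_one, ← intervalIntegral.integral_of_le zero_le_one,
    ← intervalIntegral.integral_const_mul]
  have : (1:ℂ) = ∫ v in (0:ℝ)..1, (1:ℂ) := by simp
  rw [this, ← intervalIntegral.integral_sub (by simp) (hc.intervalIntegrable.const_mul _)]
  refine intervalIntegral.integral_congr fun v hv => ?_
  rw [uIcc_of_le zero_le_one] at hv
  have := wv_ne hw hv.1
  field_simp
  ring

theorem q1_prod : Integrable (fun z : ℝ × ℝ => z.2 * Real.exp (-(z.1 * z.2)))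
    ((volume.restrict (Ioi (0:ℝ))).prod (volume.restrict (Ioc (0:ℝ) 1))) := by
  have hcont : Continuous (fun z : ℝ × ℝ => z.2 * Real.exp (-(z.1 * z.2))) := by fun_prop
  rw [integrable_prod_iff' hcont.aestronglyMeasurable]
  have e : ∀ v : ℝ, (fun u : ℝ => v * Real.exp (-(u * v))) = fun u : ℝ => v * Real.exp (-v * u) := by
    intro v; funext u; congr 2; ring
  constructor
  · filter_upwards [ae_restrict_mem measurableSet_Ioc] with v hv
    simp only [e]
    exact (integrableOn_exp_mul_Ioi (by linarith [hv.1]) 0).const_mul _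
  · have : (fun _ : ℝ => (1:ℝ)) =ᵐ[volume.restrict (Ioc (0:ℝ) 1)]
        fun v => ∫ u in Ioi (0:ℝ), ‖v * Real.exp (-(u * v))‖ := by
      filter_upwards [ae_restrict_mem measurableSet_Ioc] with v hv
      have : ∀ u : ℝ, ‖v * Real.exp (-(u * v))‖ = v * Real.exp (-v * u) := fun u => by
        rw [Real.norm_of_nonneg (mul_nonneg hv.1.le (Real.exp_pos _).le)]; congr 2; ring
      simp only [this]
      rw [integral_const_mul, integral_exp_mul_Ioi (by linarith [hv.1])]
      simp
      rw [mul_inv_cancel₀ hv.1.ne']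
    exact (integrable_const (1:ℝ)).congr this

theorem q1_int : IntegrableOn q1 (Ioi 0) := q1_prod.integral_prod_left

theorem inner_int {w : ℂ} (hw : 0 < w.re) {v : ℝ} (hv : 0 ≤ v) :
    ∫ u in Ioi (0:ℝ), (Real.exp (-(u * v)) : ℂ) * Complex.exp (-w * u) = (w + v)⁻¹ := by
  have e : ∀ u : ℝ, (Real.exp (-(u * v)) : ℂ) * Complex.exp (-w * u) = Complex.exp (-(w + v) * u) := fun u => by
    push_cast
    rw [← Complex.exp_add]; congr 1; ring
  simp only [e]
  rw [integral_exp_mul_complex_Ioi (by simp; linarith)]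
  rw [Complex.ofReal_zero, mul_zero, Complex.exp_zero, neg_div_neg_eq, one_div]

theorem q1_lap {w : ℂ} (hw : 0 < w.re) :
    ∫ u in Ioi (0:ℝ), (q1 u : ℂ) * Complex.exp (-w * u) = 1 - w * LL w := by
  have hi : Integrable (fun z : ℝ × ℝ => ((z.2 * Real.exp (-(z.1 * z.2)) : ℝ) : ℂ) * Complex.exp (-w * z.1))
      ((volume.restrict (Ioi (0:ℝ))).prod (volume.restrict (Ioc (0:ℝ) 1))) := by
    refine q1_prod.mono (Continuous.aestronglyMeasurable (by fun_prop)) ?_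
    rw [Measure.prod_restrict]
    filter_upwards [ae_restrict_mem (measurableSet_Ioi.prod measurableSet_Ioc)] with z hz
    rw [norm_mul, Complex.norm_real, norm_cexp_mul]
    refine mul_le_of_le_one_right (norm_nonneg _) (Real.exp_le_one_iff.2 ?_)
    have : 0 < z.1 := hz.1
    nlinarith
  rw [← LL_one hw]
  have h := integral_integral_swap (f := fun (u v : ℝ) => ((v * Real.exp (-(u * v)) : ℝ) : ℂ) * Complex.exp (-w * u)) hi
  convert h using 1
  · refine integral_congr_ae (Eventually.of_forall fun u => ?_)
    simp only
    rw [integral_mul_const, integral_complex_ofReal]; rfl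
  · refine setIntegral_congr_fun measurableSet_Ioc fun v hv => ?_
    rw [← inner_int hw hv.1.le, ← integral_const_mul]
    refine integral_congr_ae (Eventually.of_forall fun u => ?_)
    simp only
    push_cast; ring

theorem q0_lap {w : ℂ} (hw : 0 < w.re) :
    IntegrableOn (fun u : ℝ => (q0 u : ℂ) * Complex.exp (-w * u)) (Ioi 0) ∧
    ∫ u in Ioi (0:ℝ), (q0 u : ℂ) * Complex.exp (-w * u) = LL w := by
  have hi : Integrable (fun z : ℝ × ℝ => ((Real.exp (-(z.1 * z.2)) : ℝ) : ℂ) * Complex.exp (-w * z.1))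
      ((volume.restrict (Ioi (0:ℝ))).prod (volume.restrict (Ioc (0:ℝ) 1))) := by
    have h1 : Integrable (fun u : ℝ => Real.exp (-w.re * u)) (volume.restrict (Ioi (0:ℝ))) :=
      integrableOn_exp_mul_Ioi (by linarith) 0
    have h2 : Integrable (fun _ : ℝ => (1:ℝ)) (volume.restrict (Ioc (0:ℝ) 1)) := integrable_const _
    refine (h1.mul_prod h2).mono (Continuous.aestronglyMeasurable (by fun_prop)) ?_
    rw [Measure.prod_restrict]
    filter_upwards [ae_restrict_mem (measurableSet_Ioi.prod measurableSet_Ioc)] with z hz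
    rw [norm_mul, Complex.norm_real, norm_cexp_mul, mul_one, Real.norm_of_nonneg (Real.exp_pos _).le,
      Real.norm_of_nonneg (Real.exp_pos _).le]
    refine mul_le_of_le_one_left (Real.exp_pos _).le (Real.exp_le_one_iff.2 ?_)
    have h3 : 0 < z.1 := hz.1
    have h4 : 0 < z.2 := hz.2.1
    nlinarith
  have e : (fun u : ℝ => (q0 u : ℂ) * Complex.exp (-w * u)) =
      fun u : ℝ => ∫ v in Ioc (0:ℝ) 1, ((Real.exp (-(u * v)) : ℝ) : ℂ) * Complex.exp (-w * u) := by
    funext u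
    rw [integral_mul_const, integral_complex_ofReal]; rfl
  rw [e]
  refine ⟨hi.integral_prod_left, ?_⟩
  have h := integral_integral_swap (f := fun (u v : ℝ) => ((Real.exp (-(u * v)) : ℝ) : ℂ) * Complex.exp (-w * u)) hi
  rw [h]
  refine setIntegral_congr_fun measurableSet_Ioc fun v hv => ?_
  rw [← inner_int hw hv.1.le]

theorem q0_eq {u : ℝ} (hu : u ≠ 0) : q0 u = 1 / u - Real.exp (-u) / u := by
  unfold q0
  rw [← intervalIntegral.integral_of_le zero_le_one]
  have := intervalIntegral.integral_eq_sub_of_hasDerivAt (a := 0) (b := 1) (f := fun v : ℝ => -Real.exp (-(u * v)) / u)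
    (f' := fun v => Real.exp (-(u * v))) (fun v hv => ?_) (Continuous.intervalIntegrable (by fun_prop) _ _)
  · rw [this]; simp; ring
  · have h := ((((hasDerivAt_id v).const_mul u).neg.exp).neg).div_const u
    have e : -(Real.exp ((-fun y => u * id y) v) * -(u * 1)) / u = Real.exp (-(u * v)) := by
      have : (-fun y => u * id y) v = -(u * v) := rfl
      rw [this]; field_simp
    rw [e] at h
    exact h

theorem q0_bd {u : ℝ} (hu : 0 ≤ u) : 0 ≤ q0 u ∧ q0 u ≤ 1 := by
  unfold q0
  refine ⟨setIntegral_nonneg measurableSet_Ioc fun v hv => (Real.exp_pos _).le, ?_⟩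
  have : ∫ v in Ioc (0:ℝ) 1, Real.exp (-(u * v)) ≤ ∫ v in Ioc (0:ℝ) 1, (1:ℝ) := by
    refine setIntegral_mono_on ?_ (integrable_const _) measurableSet_Ioc fun v hv => Real.exp_le_one_iff.2 ?_
    · exact ((Continuous.integrableOn_Icc (by fun_prop)).mono_set Ioc_subset_Icc_self)
    · have := hv.1; nlinarith
  simpa using this

noncomputable def rr (p : ℕ → ℝ) (u : ℝ) : ℝ :=
  (Ioi (0:ℝ)).indicator (fun u => Real.exp (-u) * PiCount p (Real.exp u) - q0 u) u

noncomputable def qq (u : ℝ) : ℝ := (Ioi (0:ℝ)).indicator (fun u => -q1 u) u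

theorem q0_cont : Measurable q0 := by
  have : StronglyMeasurable q0 := by
    unfold q0
    refine StronglyMeasurable.integral_prod_right (f := fun u v : ℝ => Real.exp (-(u * v))) ?_
    exact Continuous.stronglyMeasurable (by fun_prop)
  exact this.measurable

theorem FF_dm (f : ℝ → ℝ) (δ t : ℝ) : FF (dm f δ) t = ∫ u : ℝ, (f u : ℂ) * Complex.exp (-(δ + t * Complex.I) * u) := by
  unfold FF dm
  refine integral_congr_ae (Eventually.of_forall fun u => ?_)
  simp only
  push_cast
  rw [mul_assoc, ← Complex.exp_add]
  congr 2
  ring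

section
variable {p : ℕ → ℝ} (hmono : Monotone p) (hp1 : 1 < p 0) (hptop : Tendsto p atTop atTop)
include hmono hp1 hptop

theorem P_meas : Measurable fun u => PiCount p (Real.exp u) := (P_mono hmono hp1 hptop).measurable

theorem rr_int (hL1 : ∫⁻ x in Set.Ici (2:ℝ),
      ENNReal.ofReal (|PiCount p x - x / Real.log x| / x ^ 2) < ⊤) : Integrable (rr p) := by
  have hm := P_meas hmono hp1 hptop
  have hl2 : 0 < Real.log 2 := Real.log_pos (by norm_num)
  have hE : Measurable fun u => Real.exp (-u) * PiCount p (Real.exp u) := (by fun_prop : Measurable fun u : ℝ => Real.exp (-u)).mul hm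
  unfold rr
  rw [integrable_indicator_iff measurableSet_Ioi]
  rw [← Ioc_union_Ioi_eq_Ioi hl2.le]
  refine IntegrableOn.union ?_ ?_
  · refine Measure.integrableOn_of_bounded (M := PiCount p (Real.exp (Real.log 2)) + 1) (by simp) (hE.sub q0_cont).aestronglyMeasurable ?_
    filter_upwards [ae_restrict_mem measurableSet_Ioc] with u hu
    have h1 := q0_bd hu.1.le
    have h2 := P_nonneg hmono hp1 hptop u
    have h3 : PiCount p (Real.exp u) ≤ PiCount p (Real.exp (Real.log 2)) := P_mono hmono hp1 hptop hu.2
    have h4 : Real.exp (-u) ≤ 1 := Real.exp_le_one_iff.2 (by linarith [hu.1])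
    have h5 := Real.exp_pos (-u)
    have h6 : Real.exp (-u) * PiCount p (Real.exp u) ≤ PiCount p (Real.exp u) := mul_le_of_le_one_left h2 h4
    have h7 : 0 ≤ Real.exp (-u) * PiCount p (Real.exp u) := by positivity
    rw [Real.norm_eq_abs, abs_le]
    constructor <;> linarith
  · have e : Real.exp '' Ici (Real.log 2) = Ici (2:ℝ) := by
      ext x
      constructor
      · rintro ⟨u, hu, rfl⟩
        exact (Real.log_le_iff_le_exp (by norm_num)).1 hu
      · intro hx
        have hx : (2:ℝ) ≤ x := hx
        exact ⟨Real.log x, Real.log_le_log (by norm_num) hx, Real.exp_log (by linarith)⟩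
    rw [← e, lintegral_image_eq_lintegral_abs_deriv_mul measurableSet_Ici
      (fun u _ => (Real.hasDerivAt_exp u).hasDerivWithinAt) Real.exp_injective.injOn] at hL1
    have h1 : IntegrableOn (fun u => Real.exp (-u) * PiCount p (Real.exp u) - 1 / u) (Ici (Real.log 2)) := by
      have hmm : Measurable fun u => Real.exp (-u) * PiCount p (Real.exp u) - 1 / u :=
        hE.sub (measurable_const.div measurable_id)
      refine ⟨hmm.aestronglyMeasurable, ?_⟩
      rw [hasFiniteIntegral_iff_norm]
      refine lt_of_eq_of_lt ?_ hL1
      refine lintegral_congr fun u => ?_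
      rw [← ENNReal.ofReal_mul (abs_nonneg _), Real.log_exp, abs_of_pos (Real.exp_pos u)]
      congr 1
      have hx := Real.exp_pos u
      have h3 : Real.exp (-u) * PiCount p (Real.exp u) - 1 / u =
          (Real.exp u)⁻¹ * (PiCount p (Real.exp u) - Real.exp u / u) := by
        rw [Real.exp_neg, mul_sub]
        congr 1
        rw [mul_div_assoc', inv_mul_cancel₀ hx.ne']
      rw [h3, norm_mul, Real.norm_eq_abs, Real.norm_eq_abs, abs_of_pos (inv_pos.2 hx)]
      field_simp
    have h2 : IntegrableOn (fun u => Real.exp (-u) / u) (Ioi (Real.log 2)) := by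
      have h0 : IntegrableOn (fun u : ℝ => Real.exp (-1 * u) * (Real.log 2)⁻¹) (Ioi (Real.log 2)) :=
        (integrableOn_exp_mul_Ioi (by norm_num) _).mul_const _
      refine Integrable.mono' h0 (Measurable.aestronglyMeasurable
        ((by fun_prop : Measurable fun u : ℝ => Real.exp (-u)).div measurable_id)) ?_
      filter_upwards [ae_restrict_mem measurableSet_Ioi] with u hu
      have hu : Real.log 2 < u := hu
      have hu0 : 0 < u := hl2.trans hu
      rw [Real.norm_of_nonneg (by positivity), div_eq_mul_inv, neg_one_mul]
      gcongr
    refine ((h1.mono_set Ioi_subset_Ici_self).add h2).congr_fun (fun u hu => ?_) measurableSet_Ioi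
    have hu : Real.log 2 < u := hu
    have hu0 : u ≠ 0 := (hl2.trans hu).ne'
    simp only [Pi.add_apply]
    rw [q0_eq hu0]; ring

theorem P_split {w : ℂ} (hw : 0 < w.re) (hr : Integrable (rr p)) :
    Integrable (fun u : ℝ => (PiCount p (Real.exp u) : ℂ) * Complex.exp (-(1 + w) * u)) ∧
    ∫ u : ℝ, (PiCount p (Real.exp u) : ℂ) * Complex.exp (-(1 + w) * u) =
      (∫ u : ℝ, (rr p u : ℂ) * Complex.exp (-w * u)) + LL w := by
  have hq := q0_lap hw
  have hq' : Integrable (fun u : ℝ => (Ioi (0:ℝ)).indicator (fun u : ℝ => (q0 u : ℂ) * Complex.exp (-w * u)) u) :=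
    (integrable_indicator_iff measurableSet_Ioi).2 hq.1
  have hr' : Integrable (fun u : ℝ => (rr p u : ℂ) * Complex.exp (-w * u)) := by
    refine hr.mono (hr.1.aemeasurable.complex_ofReal.aestronglyMeasurable.mul (Continuous.aestronglyMeasurable (by fun_prop))) ?_
    refine Eventually.of_forall fun u => ?_
    rw [norm_mul, Complex.norm_real, norm_cexp_mul]
    by_cases hu : 0 < u
    · refine mul_le_of_le_one_right (norm_nonneg _) (Real.exp_le_one_iff.2 ?_)
      nlinarith
    · have : rr p u = 0 := by simp [rr, hu]
      simp [this]
  have hae : (fun u : ℝ => (PiCount p (Real.exp u) : ℂ) * Complex.exp (-(1 + w) * u)) =ᵐ[volume]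
      fun u => (rr p u : ℂ) * Complex.exp (-w * u) +
        (Ioi (0:ℝ)).indicator (fun u : ℝ => (q0 u : ℂ) * Complex.exp (-w * u)) u := by
    filter_upwards [compl_mem_ae_iff.2 (measure_singleton (0:ℝ))] with u hu0
    have hu0 : u ≠ 0 := hu0
    by_cases hu : 0 < u
    · simp only [rr, indicator_of_mem (show u ∈ Ioi (0:ℝ) from hu)]
      push_cast
      have : Complex.exp (-(1 + w) * u) = Complex.exp (-u) * Complex.exp (-w * u) := by
        rw [← Complex.exp_add]; congr 1; ring
      rw [this]; ring
    · rw [P_neg hmono hp1 hptop u (lt_of_le_of_ne (not_lt.1 hu) hu0)]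
      simp [rr, hu]
  refine ⟨(hr'.add hq').congr hae.symm, ?_⟩
  rw [integral_congr_ae hae, integral_add hr' hq', integral_indicator measurableSet_Ioi, hq.2]

theorem P_int {δ : ℝ} (hδ : 0 < δ) (hr : Integrable (rr p)) :
    Integrable (fun u : ℝ => PiCount p (Real.exp u) * Real.exp (-(1 + δ) * u)) := by
  have h := (P_split hmono hp1 hptop (w := (δ:ℂ)) (by simpa using hδ) hr).1.norm
  refine h.congr (Eventually.of_forall fun u => ?_)
  simp only
  rw [norm_mul, Complex.norm_real, norm_cexp_mul, Real.norm_of_nonneg (P_nonneg hmono hp1 hptop u)]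
  simp

theorem main_aux (hr : Integrable (rr p)) : ∃ a : ℝ, 0 < a ∧
    Tendsto (fun u : ℝ => Real.exp (-u) * (Ncount p (Real.exp u) : ℝ)) atTop (𝓝 a) := by
  have hPi := fun δ (hδ : (0:ℝ) < δ) => P_int hmono hp1 hptop hδ hr
  have hN := N_mono hmono hp1 hptop (σ := 1 + 1) (by norm_num) (hPi 1 one_pos)
  have hNe : Monotone fun u : ℝ => (Ncount p (Real.exp u) : ℝ) := fun a b hab => by
    exact Nat.cast_le.2 (hN (Real.exp_le_exp.2 hab))
  have hqi : Integrable qq := (integrable_indicator_iff measurableSet_Ioi).2 q1_int.neg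
  have key : ∀ (δ t u : ℝ), ((Real.exp (-u) * (Ncount p (Real.exp u) : ℝ) : ℝ) : ℂ) *
      Complex.exp (-(δ + t * Complex.I) * u) =
      ((Ncount p (Real.exp u) : ℝ) : ℂ) * Complex.exp (-(1 + (δ + t * Complex.I)) * u) := by
    intro δ t u
    have : Complex.exp (-(1 + (δ + t * Complex.I)) * u) = Complex.exp (-u) * Complex.exp (-(δ + t * Complex.I) * u) := by
      rw [← Complex.exp_add]; congr 1; ring
    rw [this]; push_cast; ring
  refine ⟨_, Real.exp_pos _, taub (τ := fun u => Real.exp (-u) * (Ncount p (Real.exp u) : ℝ)) (c := 1) (q := qq) (r := rr p)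
    (fun u => by positivity) ?_ ?_ ?_ ?_ hqi ?_ hr ?_ ?_⟩
  · exact (by fun_prop : Measurable fun u : ℝ => Real.exp (-u)).mul hNe.measurable
  · intro u hu
    rw [N_neg hmono hp1 hptop (Real.exp_lt_one_iff.2 hu)]; simp
  · intro x y hxy
    rw [← mul_assoc, ← mul_assoc, ← Real.exp_add, ← Real.exp_add]
    simpa using hNe hxy
  · intro δ hδ
    have h := N_int hmono hp1 hptop (σ := 1 + δ) (by linarith) (hPi δ hδ)
    refine h.congr (Eventually.of_forall fun u => ?_)
    simp only [dm]
    have := key δ 0 u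
    push_cast
    rw [mul_right_comm, ← Complex.exp_add, mul_comm]
    congr 2
    ring
  · intro u hu; simp [qq, hu.le]
  · intro u hu; simp [rr, hu.le]
  · intro δ hδ t
    set w : ℂ := δ + t * Complex.I with hwdef
    have hwre : w.re = δ := by simp [hwdef]
    have hw : 0 < w.re := by rw [hwre]; exact hδ
    have hw0 : w ≠ 0 := fun h => by simp [h] at hw
    have hs0 : 1 + w ≠ 0 := fun h => by
      have := congrArg Complex.re h
      simp at this; linarith
    rw [FF_dm]
    simp only [key]
    rw [← hwdef, N_laplace hmono hp1 hptop (s := 1 + w) (by simp; linarith) (by simpa [hwre] using hPi δ hδ),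
      (P_split hmono hp1 hptop hw hr).2]
    unfold EE
    rw [FF_dm, FF_dm, ← hwdef]
    have hQ : ∫ u : ℝ, (qq u : ℂ) * Complex.exp (-w * u) = -(1 - w * LL w) := by
      rw [← q1_lap hw, ← integral_neg, ← integral_indicator measurableSet_Ioi]
      refine integral_congr_ae (Eventually.of_forall fun u => ?_)
      by_cases hu : 0 < u
      · simp [qq, hu]
      · simp [qq, hu]
    rw [hQ]
    generalize (∫ u : ℝ, (rr p u : ℂ) * Complex.exp (-w * u)) = R
    have e1 : (1 + w) * (R + LL w) = LL w + (w * LL w + (1 + w) * R) := by ring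
    have e2 : ((1:ℝ) : ℂ) + (-(1 - w * LL w) + (1 + δ + t * Complex.I) * R) = w * LL w + (1 + w) * R := by
      rw [hwdef]; push_cast; ring
    rw [e1, e2, Complex.exp_add, LL_exp hw]
    field_simp

end

theorem main_thm (p : ℕ → ℝ) (hmono : Monotone p) (hp1 : 1 < p 0)
    (hptop : Tendsto p atTop atTop)
    (hL1 : ∫⁻ x in Set.Ici (2:ℝ),
      ENNReal.ofReal (|PiCount p x - x / Real.log x| / x ^ 2) < ⊤) :
    ∃ a : ℝ, 0 < a ∧ Tendsto (fun x : ℝ => (Ncount p x : ℝ) / x) atTop (𝓝 a) := by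
  obtain ⟨a, ha, h⟩ := main_aux hmono hp1 hptop (rr_int hmono hp1 hptop hL1)
  refine ⟨a, ha, (h.comp Real.tendsto_log_atTop).congr' ?_⟩
  filter_upwards [eventually_gt_atTop 0] with x hx
  simp only [Function.comp]
  rw [Real.exp_neg, Real.exp_log hx, inv_mul_eq_div]

/-- Diamond's L¹ criterion: if `∫_2^∞ |Π(x) - x/log x| x^{-2} dx < ∞`, then the generalized
integers have a positive asymptotic density. -/
theorem stmt_0 (p : ℕ → ℝ) (hmono : Monotone p) (hp1 : 1 < p 0)
    (hptop : Tendsto p atTop atTop)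
    (hL1 : ∫⁻ x in Set.Ici (2:ℝ),
      ENNReal.ofReal (|PiCount p x - x / Real.log x| / x ^ 2) < ⊤) :
    ∃ a : ℝ, 0 < a ∧ Tendsto (fun x : ℝ => (Ncount p x : ℝ) / x) atTop (𝓝 a) :=
  main_thm p hmono hp1 hptop hL1
end

section
/- Let a Beurling generalized number system be given. If ζ(s) converges for every s with Re s > 1 and the function s ↦ log ζ(s) + Log(s − 1) has A_loc-boundary behavior on the whole boundary line 1 + iℝ, then there exists a > 0 such that N(x)/x → a as x → ∞. -/
open Filter MeasureTheory Set Topology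
open scoped Classical

namespace BT

/-- Fourier transform with the sign convention of the statement. -/
noncomputable def FT (g : ℝ → ℂ) (t : ℝ) : ℂ := ∫ x : ℝ, g x * Complex.exp (-(t * x) * Complex.I)

/-- Inverse type Fourier transform. -/
noncomputable def KT (q : ℝ → ℂ) (x : ℝ) : ℂ := ∫ t : ℝ, q t * Complex.exp ((t * x) * Complex.I)

lemma norm_e (a b : ℝ) : ‖Complex.exp ((a * b) * Complex.I)‖ = 1 := by
  have := Complex.norm_exp_ofReal_mul_I (a * b)
  push_cast at this
  exact this

lemma norm_e' (a b : ℝ) : ‖Complex.exp (-(a * b) * Complex.I)‖ = 1 := by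
  have := Complex.norm_exp_ofReal_mul_I (-(a * b))
  push_cast at this
  exact this

lemma FT_cont {g : ℝ → ℂ} (hg : Integrable g) : Continuous (FT g) := by
  unfold FT
  apply continuous_of_dominated (bound := fun x => ‖g x‖)
  · intro t
    exact hg.1.mul (Continuous.aestronglyMeasurable (by fun_prop))
  · intro t
    refine Eventually.of_forall fun x => ?_
    rw [norm_mul, norm_e', mul_one]
  · exact hg.norm
  · refine Eventually.of_forall fun x => ?_
    fun_prop

lemma KT_cont {g : ℝ → ℂ} (hg : Integrable g) : Continuous (KT g) := by
  unfold KT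
  apply continuous_of_dominated (bound := fun x => ‖g x‖)
  · intro t
    exact hg.1.mul (Continuous.aestronglyMeasurable (by fun_prop))
  · intro t
    refine Eventually.of_forall fun x => ?_
    rw [norm_mul, norm_e, mul_one]
  · exact hg.norm
  · refine Eventually.of_forall fun x => ?_
    fun_prop

lemma FT_bound (g : ℝ → ℂ) (t : ℝ) : ‖FT g t‖ ≤ ∫ x, ‖g x‖ := by
  unfold FT
  refine (norm_integral_le_integral_norm _).trans (le_of_eq ?_)
  congr 1; ext x
  rw [norm_mul, norm_e', mul_one]

lemma KT_bound (g : ℝ → ℂ) (t : ℝ) : ‖KT g t‖ ≤ ∫ x, ‖g x‖ := by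
  unfold KT
  refine (norm_integral_le_integral_norm _).trans (le_of_eq ?_)
  congr 1; ext x
  rw [norm_mul, norm_e, mul_one]

lemma mul_FT_int {q g : ℝ → ℂ} (hq : Integrable q) (hg : Integrable g) :
    Integrable (fun t => q t * FT g t) := by
  refine hq.mul_bdd (c := ∫ x, ‖g x‖) (FT_cont hg).aestronglyMeasurable ?_
  exact Eventually.of_forall fun t => FT_bound g t

lemma KT_mul_FT {q g : ℝ → ℂ} (hq : Integrable q) (hg : Integrable g) (x : ℝ) :
    KT (fun t => q t * FT g t) x = ∫ y, g y * KT q (x - y) := by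
  unfold KT FT
  have h1 : ∀ t : ℝ, q t * (∫ y : ℝ, g y * Complex.exp (-(t * y) * Complex.I)) *
      Complex.exp ((t * x) * Complex.I) =
      ∫ y : ℝ, q t * g y * Complex.exp ((t * (x - y)) * Complex.I) := by
    intro t
    rw [← integral_const_mul, ← integral_mul_const]
    congr 1; ext y
    rw [mul_assoc, mul_assoc, ← Complex.exp_add, ← mul_assoc]
    congr 2; ring
  simp_rw [h1]
  rw [integral_integral_swap]
  · congr 1; ext y
    rw [← integral_const_mul]
    congr 1; ext t
    push_cast
    ring
  · have := hq.mul_prod hg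
    refine this.mul_bdd (c := 1) (Continuous.aestronglyMeasurable (by fun_prop)) ?_
    refine Eventually.of_forall fun z => ?_
    have := norm_e z.1 (x - z.2)
    push_cast at this
    exact this.le

lemma KT_mul_FT_conv {q g : ℝ → ℂ} (hq : Integrable q) (hg : Integrable g) :
    KT (fun t => q t * FT g t) =
      convolution g (KT q) (ContinuousLinearMap.mul ℂ ℂ) volume := by
  ext x
  rw [KT_mul_FT hq hg]
  rfl

lemma KT_mul_int {q g : ℝ → ℂ} (hq : Integrable q) (hg : Integrable g)
    (hK : Integrable (KT q)) : Integrable (KT (fun t => q t * FT g t)) := by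
  rw [KT_mul_FT_conv hq hg]
  exact hg.integrable_convolution _ hK

lemma KT_mul_integral {q g : ℝ → ℂ} (hq : Integrable q) (hg : Integrable g)
    (hK : Integrable (KT q)) :
    ∫ x, KT (fun t => q t * FT g t) x = (∫ x, g x) * ∫ x, KT q x := by
  rw [KT_mul_FT_conv hq hg, integral_convolution _ hg hK]
  rfl

lemma KT_mul_norm {q g : ℝ → ℂ} (hq : Integrable q) (hg : Integrable g)
    (hK : Integrable (KT q)) :
    ∫ x, ‖KT (fun t => q t * FT g t) x‖ ≤ (∫ x, ‖g x‖) * ∫ x, ‖KT q x‖ := by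
  have h := integral_convolution (ContinuousLinearMap.mul ℝ ℝ) hg.norm hK.norm
  have h2 : (∫ x, ‖g x‖) * ∫ x, ‖KT q x‖ = ∫ x, convolution (fun x => ‖g x‖) (fun x => ‖KT q x‖)
      (ContinuousLinearMap.mul ℝ ℝ) volume x := by
    rw [h]; rfl
  rw [h2]
  apply integral_mono (KT_mul_int hq hg hK).norm
    (hg.norm.integrable_convolution (ContinuousLinearMap.mul ℝ ℝ) hK.norm)
  intro x
  dsimp only
  rw [KT_mul_FT hq hg]
  refine (norm_integral_le_integral_norm _).trans (le_of_eq ?_)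
  unfold convolution
  congr 1; ext y
  simp

/-- terms of the exponential series -/
noncomputable def qn (q g : ℝ → ℂ) (n : ℕ) (t : ℝ) : ℂ := q t * (FT g t ^ n / n.factorial)

lemma qn_succ (q g : ℝ → ℂ) (n : ℕ) :
    qn q g (n + 1) = fun t => ((n + 1 : ℂ))⁻¹ * (qn q g n t * FT g t) := by
  ext t
  unfold qn
  rw [Nat.factorial_succ]
  have : (n.factorial : ℂ) ≠ 0 := by exact_mod_cast n.factorial_ne_zero
  have h2 : (n + 1 : ℂ) ≠ 0 := by exact_mod_cast n.succ_ne_zero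
  push_cast
  field_simp
  try ring

lemma KT_const_mul (c : ℂ) (q : ℝ → ℂ) : KT (fun t => c * q t) = fun x => c * KT q x := by
  ext x
  unfold KT
  rw [← integral_const_mul]
  congr 1; ext t; ring

lemma qn_all {q g : ℝ → ℂ} (hq : Integrable q) (hg : Integrable g)
    (hK : Integrable (KT q)) (n : ℕ) :
    Integrable (qn q g n) ∧ Integrable (KT (qn q g n)) ∧
    ∫ x, KT (qn q g n) x = (∫ x, g x) ^ n / n.factorial * ∫ x, KT q x ∧
    ∫ x, ‖KT (qn q g n) x‖ ≤ (∫ x, ‖g x‖) ^ n / n.factorial * ∫ x, ‖KT q x‖ := by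
  induction n with
  | zero =>
    have : qn q g 0 = q := by ext t; simp [qn]
    rw [this]
    simp [hq, hK]
  | succ n ih =>
    obtain ⟨h1, h2, h3, h4⟩ := ih
    have hf : (n.factorial : ℂ) ≠ 0 := by exact_mod_cast n.factorial_ne_zero
    have hn2 : (n + 1 : ℂ) ≠ 0 := by exact_mod_cast n.succ_ne_zero
    have hf' : (n.factorial : ℝ) ≠ 0 := by exact_mod_cast n.factorial_ne_zero
    have hn2' : (n + 1 : ℝ) ≠ 0 := by exact_mod_cast n.succ_ne_zero
    rw [qn_succ, KT_const_mul]
    refine ⟨(mul_FT_int h1 hg).const_mul _, (KT_mul_int h1 hg h2).const_mul _, ?_, ?_⟩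
    · rw [integral_const_mul, KT_mul_integral h1 hg h2, h3, Nat.factorial_succ]
      push_cast
      field_simp
      ring
    · simp_rw [norm_mul]
      rw [integral_const_mul]
      have hnn : ‖((n : ℂ) + 1)⁻¹‖ = ((n : ℝ) + 1)⁻¹ := by
        rw [norm_inv]
        congr 1
        have : ((n : ℂ) + 1) = ((n + 1 : ℕ) : ℂ) := by push_cast; rfl
        rw [this, Complex.norm_natCast]; push_cast; rfl
      rw [hnn]
      calc ((n : ℝ) + 1)⁻¹ * ∫ x, ‖KT (fun t => qn q g n t * FT g t) x‖
          ≤ ((n : ℝ) + 1)⁻¹ * ((∫ x, ‖g x‖) * ((∫ x, ‖g x‖) ^ n / n.factorial * ∫ x, ‖KT q x‖)) := by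
            refine mul_le_mul_of_nonneg_left ?_ (by positivity)
            refine (KT_mul_norm h1 hg h2).trans ?_
            exact mul_le_mul_of_nonneg_left h4 (integral_nonneg fun x => norm_nonneg _)
        _ = _ := by
            rw [Nat.factorial_succ]
            push_cast
            field_simp
            ring

lemma int_exp {q g : ℝ → ℂ} (hq : Integrable q) (hg : Integrable g) :
    Integrable (fun t => q t * Complex.exp (FT g t)) := by
  refine hq.mul_bdd (c := Real.exp (∫ x, ‖g x‖)) ?_ ?_
  · exact (Complex.continuous_exp.comp (FT_cont hg)).aestronglyMeasurable
  · refine Eventually.of_forall fun t => ?_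
    rw [Complex.norm_exp]
    exact Real.exp_le_exp.2 (((Complex.re_le_norm _).trans (FT_bound g t)))

lemma KT_exp_sum {q g : ℝ → ℂ} (hq : Integrable q) (hg : Integrable g)
    (hK : Integrable (KT q)) (x : ℝ) :
    HasSum (fun n => KT (qn q g n) x) (KT (fun t => q t * Complex.exp (FT g t)) x) := by
  have key : ∀ t : ℝ, q t * Complex.exp (FT g t) * Complex.exp ((t * x) * Complex.I) =
      ∑' n, qn q g n t * Complex.exp ((t * x) * Complex.I) := by
    intro t
    have h := NormedSpace.expSeries_div_hasSum_exp (FT g t)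
    rw [← Complex.exp_eq_exp_ℂ] at h
    have h2 := (h.mul_left (q t)).mul_right (Complex.exp ((t * x) * Complex.I))
    exact h2.tsum_eq.symm
  have e : KT (fun t => q t * Complex.exp (FT g t)) x =
      ∫ t : ℝ, ∑' n, qn q g n t * Complex.exp ((t * x) * Complex.I) := by
    unfold KT
    simp_rw [key]
  rw [e]
  apply hasSum_integral_of_summable_integral_norm
  · intro n
    refine (qn_all hq hg hK n).1.mul_bdd (c := 1) (Continuous.aestronglyMeasurable (by fun_prop)) ?_
    exact Eventually.of_forall fun t => (norm_e t x).le
  · have hs : Summable fun n : ℕ => (∫ x, ‖q x‖) * ((∫ x, ‖g x‖) ^ n / n.factorial) :=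
      (Real.summable_pow_div_factorial _).mul_left _
    refine hs.of_nonneg_of_le (fun n => integral_nonneg fun x => norm_nonneg _) ?_
    intro n
    rw [← integral_mul_const]
    apply integral_mono_of_nonneg (Eventually.of_forall fun t => norm_nonneg _)
      (hq.norm.mul_const _)
    refine Eventually.of_forall fun t => ?_
    dsimp only
    rw [norm_mul, norm_e, mul_one, qn, norm_mul, norm_div, norm_pow, Complex.norm_natCast]
    have := FT_bound g t
    gcongr

lemma KT_exp {q g : ℝ → ℂ} (hq : Integrable q) (hg : Integrable g)
    (hK : Integrable (KT q)) :
    Integrable (KT (fun t => q t * Complex.exp (FT g t))) ∧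
    ∫ x, KT (fun t => q t * Complex.exp (FT g t)) x = Complex.exp (FT g 0) * ∫ x, KT q x := by
  have e : KT (fun t => q t * Complex.exp (FT g t)) = fun x => ∑' n, KT (qn q g n) x := by
    ext x; exact (KT_exp_sum hq hg hK x).tsum_eq.symm
  have hs : Summable fun n : ℕ => ∫ x, ‖KT (qn q g n) x‖ := by
    have hs : Summable fun n : ℕ => ((∫ x, ‖g x‖) ^ n / n.factorial) * (∫ x, ‖KT q x‖) :=
      (Real.summable_pow_div_factorial _).mul_right _
    exact hs.of_nonneg_of_le (fun n => integral_nonneg fun x => norm_nonneg _)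
      fun n => (qn_all hq hg hK n).2.2.2
  constructor
  · refine ⟨(KT_cont (int_exp hq hg)).aestronglyMeasurable, ?_⟩
    rw [e]
    unfold HasFiniteIntegral
    have h1 : ∀ x, ‖∑' n, KT (qn q g n) x‖ₑ ≤ ∑' n, ‖KT (qn q g n) x‖ₑ := fun x =>
      enorm_tsum_le_tsum_enorm
    refine (lintegral_mono h1).trans_lt ?_
    rw [lintegral_tsum (fun n => (qn_all hq hg hK n).2.1.1.enorm)]
    have h2 : ∀ n, ∫⁻ x, ‖KT (qn q g n) x‖ₑ = ENNReal.ofReal (∫ x, ‖KT (qn q g n) x‖) := by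
      intro n
      rw [ofReal_integral_norm_eq_lintegral_enorm (qn_all hq hg hK n).2.1]
    simp_rw [h2]
    rw [← ENNReal.ofReal_tsum_of_nonneg (fun n => integral_nonneg fun x => norm_nonneg _) hs]
    exact ENNReal.ofReal_lt_top
  · have h := hasSum_integral_of_summable_integral_norm (fun n => (qn_all hq hg hK n).2.1) hs
    simp_rw [(qn_all hq hg hK _).2.2.1] at h
    rw [e, ← h.tsum_eq, tsum_mul_right]
    congr 1
    have h := NormedSpace.expSeries_div_hasSum_exp (FT g 0)
    rw [← Complex.exp_eq_exp_ℂ] at h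
    rw [← h.tsum_eq]
    simp [FT]

end BT
namespace BT

/-- triangle function -/
noncomputable def tri (t : ℝ) : ℝ := max (1 - |t|) 0

noncomputable def phi (l t : ℝ) : ℂ := (tri (t / l) : ℂ)

noncomputable def kf (l y : ℝ) : ℝ := (KT (phi l) y).re

lemma tri_cont : Continuous tri := by unfold tri; fun_prop

lemma tri_nonneg (t : ℝ) : 0 ≤ tri t := le_max_right _ _

lemma tri_zero {t : ℝ} (h : 1 ≤ |t|) : tri t = 0 := by
  unfold tri; exact max_eq_right (by linarith)

lemma tri_le (t : ℝ) : tri t ≤ 1 := by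
  unfold tri; exact max_le (by linarith [abs_nonneg t]) zero_le_one

lemma phi_cont (l : ℝ) : Continuous (phi l) := by
  unfold phi
  exact Complex.continuous_ofReal.comp (tri_cont.comp (continuous_id.div_const l))

lemma phi_zero {l t : ℝ} (hl : 0 < l) (h : t ∉ Icc (-l) l) : phi l t = 0 := by
  unfold phi
  rw [tri_zero, Complex.ofReal_zero]
  rw [abs_div, abs_of_pos hl, le_div_iff₀ hl, one_mul]
  by_contra hc
  push Not at hc
  exact h (abs_le.1 hc.le)

lemma phi_int {l : ℝ} (hl : 0 < l) : Integrable (phi l) := by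
  apply (phi_cont l).integrable_of_hasCompactSupport
  refine HasCompactSupport.intro (isCompact_Icc (a := -l) (b := l)) ?_
  intro t ht
  exact phi_zero hl ht

lemma KT_phi_scale {l : ℝ} (hl : 0 < l) (y : ℝ) : KT (phi l) y = l * KT (phi 1) (l * y) := by
  have h := Measure.integral_comp_div
    (fun t : ℝ => phi 1 t * Complex.exp ((t * (l * y)) * Complex.I)) l
  rw [abs_of_pos hl] at h
  unfold KT
  have hl' : (l : ℂ) ≠ 0 := by exact_mod_cast hl.ne'
  rw [Complex.real_smul] at h
  push_cast
  rw [← h]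
  congr 1; ext t
  simp only [phi, div_one]
  congr 3
  push_cast
  field_simp

lemma tri_right {y : ℝ} (hy : y ≠ 0) : ∫ t in (0:ℝ)..1, (tri t : ℂ) * Complex.exp ((t * y) * Complex.I)
    = -Complex.exp (y * Complex.I) / y ^ 2 - 1 / (Complex.I * y) + 1 / (y : ℂ) ^ 2 := by
  have hy' : (y : ℂ) ≠ 0 := by exact_mod_cast hy
  have hI := Complex.I_ne_zero
  have h : ∀ t ∈ uIcc (0:ℝ) 1, HasDerivAt
      (fun t : ℝ => (1 - (t : ℂ)) * Complex.exp ((t * y) * Complex.I) / (Complex.I * y)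
        - Complex.exp ((t * y) * Complex.I) / (y : ℂ) ^ 2)
      ((tri t : ℂ) * Complex.exp ((t * y) * Complex.I)) t := by
    intro t ht
    rw [uIcc_of_le zero_le_one] at ht
    have h0 : HasDerivAt (fun t : ℝ => (t : ℂ)) 1 t := Complex.ofRealCLM.hasDerivAt
    have h1 := ((h0.mul_const (y : ℂ)).mul_const Complex.I).cexp
    have h2 := (((h0.const_sub 1).mul h1).div_const (Complex.I * y)).sub (h1.div_const ((y:ℂ)^2))
    refine h2.congr_deriv ?_
    have : tri t = 1 - t := by
      unfold tri
      rw [abs_of_nonneg ht.1, max_eq_left (by linarith [ht.2])]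
    rw [this]
    push_cast
    field_simp
    ring_nf
    try rw [Complex.I_sq]
    try ring
  rw [intervalIntegral.integral_eq_sub_of_hasDerivAt h]
  · simp
    field_simp
    try ring
  · apply Continuous.intervalIntegrable
    have := tri_cont
    fun_prop

lemma tri_left {y : ℝ} (hy : y ≠ 0) : ∫ t in (-1:ℝ)..0, (tri t : ℂ) * Complex.exp ((t * y) * Complex.I)
    = -Complex.exp (-y * Complex.I) / y ^ 2 + 1 / (Complex.I * y) + 1 / (y : ℂ) ^ 2 := by
  have hy' : (-y : ℝ) ≠ 0 := by simpa using hy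
  have h := tri_right hy'
  have h2 := intervalIntegral.integral_comp_neg (a := -1) (b := 0)
    (fun t : ℝ => (tri t : ℂ) * Complex.exp ((t * (-y : ℝ)) * Complex.I))
  simp only [neg_neg, neg_zero] at h2
  rw [h] at h2
  have h3 : ∀ t, tri (-t) = tri t := by intro t; simp [tri]
  simp only [h3] at h2
  push_cast at h2
  simp only [neg_mul_neg] at h2
  rw [h2]
  have hy'' : (y : ℂ) ≠ 0 := by exact_mod_cast hy
  field_simp
  try ring

lemma KT_phi_one {y : ℝ} (hy : y ≠ 0) : KT (phi 1) y = ((2 * (1 - Real.cos y) / y ^ 2 : ℝ) : ℂ) := by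
  have h1 : KT (phi 1) y = ∫ t in (-1:ℝ)..1, (tri t : ℂ) * Complex.exp ((t * y) * Complex.I) := by
    unfold KT
    rw [intervalIntegral.integral_of_le (by norm_num)]
    have : ∀ t, phi 1 t = (tri t : ℂ) := by intro t; simp [phi]
    simp only [this]
    rw [setIntegral_eq_integral_of_forall_compl_eq_zero]
    intro t ht
    rw [tri_zero]; · simp
    by_contra hc
    push Not at hc
    exact ht ⟨(abs_lt.1 hc).1, (abs_lt.1 hc).2.le⟩
  have hc : Continuous fun t : ℝ => (tri t : ℂ) * Complex.exp ((t * y) * Complex.I) := by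
    have := tri_cont
    fun_prop
  rw [h1, ← intervalIntegral.integral_add_adjacent_intervals (b := 0)
    (hc.intervalIntegrable _ _) (hc.intervalIntegrable _ _), tri_right hy, tri_left hy]
  have hy' : (y : ℂ) ≠ 0 := by exact_mod_cast hy
  push_cast
  rw [Complex.cos]
  field_simp
  ring

lemma KT_phi {l : ℝ} (hl : 0 < l) (y : ℝ) : KT (phi l) y = (kf l y : ℂ) := by
  by_cases hy : y = 0
  · subst hy
    unfold kf KT phi
    simp only [Complex.ofReal_zero, mul_zero, zero_mul, Complex.exp_zero, mul_one]
    rw [integral_complex_ofReal, Complex.ofReal_re]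
  · unfold kf
    rw [KT_phi_scale hl, KT_phi_one (mul_ne_zero hl.ne' hy), ← Complex.ofReal_mul, Complex.ofReal_re]

lemma kf_scale {l : ℝ} (hl : 0 < l) (y : ℝ) : kf l y = l * kf 1 (l * y) := by
  unfold kf
  rw [KT_phi_scale hl, Complex.re_ofReal_mul]

lemma kf_one {y : ℝ} (hy : y ≠ 0) : kf 1 y = 2 * (1 - Real.cos y) / y ^ 2 := by
  unfold kf
  rw [KT_phi_one hy, Complex.ofReal_re]

lemma kf_cont {l : ℝ} (hl : 0 < l) : Continuous (kf l) := 
  Complex.continuous_re.comp (KT_cont (phi_int hl))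

lemma kf_one_nonneg (y : ℝ) : 0 ≤ kf 1 y := by
  by_cases hy : y = 0
  · subst hy
    unfold kf KT phi
    simp only [Complex.ofReal_zero, mul_zero, zero_mul, Complex.exp_zero, mul_one]
    rw [integral_complex_ofReal, Complex.ofReal_re]
    exact integral_nonneg fun t => tri_nonneg _
  · rw [kf_one hy]
    have := Real.cos_le_one y
    apply div_nonneg <;> nlinarith [sq_nonneg y]

lemma kf_nonneg {l : ℝ} (hl : 0 < l) (y : ℝ) : 0 ≤ kf l y := by
  rw [kf_scale hl]
  exact mul_nonneg hl.le (kf_one_nonneg _)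

lemma kf_one_sq (y : ℝ) : y ^ 2 * kf 1 y ≤ 4 := by
  by_cases hy : y = 0
  · subst hy; simp
  · rw [kf_one hy]
    have := Real.neg_one_le_cos y
    field_simp
    linarith

lemma kf_bound {l : ℝ} (hl : 0 < l) : ∃ B : ℝ, 0 < B ∧ ∀ y, kf l y ≤ B ∧ y ^ 2 * kf l y ≤ B := by
  refine ⟨l * (∫ x, ‖phi 1 x‖) + 4 / l, ?_, ?_⟩
  · have : 0 ≤ ∫ x, ‖phi 1 x‖ := integral_nonneg fun _ => norm_nonneg _
    positivity
  · intro y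
    have h0 : 0 ≤ ∫ x, ‖phi 1 x‖ := integral_nonneg fun _ => norm_nonneg _
    have h1 : kf 1 (l * y) ≤ ∫ x, ‖phi 1 x‖ := (Complex.re_le_norm _).trans (KT_bound _ _)
    have h2 := kf_one_sq (l * y)
    rw [kf_scale hl]
    constructor
    · have : 0 ≤ 4 / l := by positivity
      have := mul_le_mul_of_nonneg_left h1 hl.le
      linarith
    · have h3 : y ^ 2 * (l * kf 1 (l * y)) = ((l * y) ^ 2 * kf 1 (l * y)) / l := by
        field_simp
      rw [h3]
      have : ((l * y) ^ 2 * kf 1 (l * y)) / l ≤ 4 / l := by gcongr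
      have := mul_nonneg hl.le h0
      linarith

lemma kf_int {l : ℝ} (hl : 0 < l) : Integrable (kf l) := by
  obtain ⟨B, hB, h⟩ := kf_bound hl
  refine (integrable_inv_one_add_sq.const_mul (2 * B)).mono' (kf_cont hl).aestronglyMeasurable ?_
  refine Eventually.of_forall fun y => ?_
  rw [Real.norm_of_nonneg (kf_nonneg hl y), ← div_eq_mul_inv, le_div_iff₀ (by positivity)]
  have := h y
  nlinarith [this.1, this.2]

/-- total mass -/
noncomputable def kap : ℝ := ∫ y, kf 1 y

lemma kf_integral {l : ℝ} (hl : 0 < l) : ∫ y, kf l y = kap := by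
  simp_rw [kf_scale hl]
  rw [integral_const_mul, Measure.integral_comp_mul_left]
  rw [abs_of_pos (by positivity), smul_eq_mul, ← mul_assoc, mul_inv_cancel₀ hl.ne', one_mul, kap]

lemma kap_pos : 0 < kap := by
  unfold kap
  rw [integral_pos_iff_support_of_nonneg kf_one_nonneg (kf_int one_pos)]
  have : Ioo (1:ℝ) 2 ⊆ Function.support (kf 1) := by
    intro y hy
    have h0 : y ≠ 0 := by linarith [hy.1]
    rw [Function.mem_support, kf_one h0]
    have : Real.cos y < 1 := by
      rw [← Real.cos_zero]
      apply Real.cos_lt_cos_of_nonneg_of_le_pi (le_refl 0) _ (by linarith [hy.1])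
      linarith [hy.2, Real.pi_gt_three]
    have : 0 < 2 * (1 - Real.cos y) / y ^ 2 := by
      apply div_pos; linarith; positivity
    exact this.ne'
  refine lt_of_lt_of_le ?_ (measure_mono this)
  simp [Real.volume_Ioo]

lemma kf_mass {d : ℝ} (hd : 0 < d) :
    Tendsto (fun l : ℝ => ∫ y in (-d)..d, kf l y) atTop (𝓝 kap) := by
  have h : (fun l : ℝ => ∫ y in (-d)..d, kf l y) =ᶠ[atTop]
      fun l : ℝ => ∫ y in (-(d * l))..(d * l), kf 1 y := by
    filter_upwards [eventually_gt_atTop 0] with l hl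
    simp_rw [kf_scale hl]
    rw [intervalIntegral.integral_const_mul, intervalIntegral.integral_comp_mul_left _ hl.ne', smul_eq_mul, ← mul_assoc,
      mul_inv_cancel₀ hl.ne', one_mul]
    congr 1 <;> ring
  refine Tendsto.congr' h.symm ?_
  have h1 : Tendsto (fun l : ℝ => d * l) atTop atTop := tendsto_id.const_mul_atTop hd
  exact intervalIntegral_tendsto_integral (kf_int one_pos) (tendsto_neg_atTop_atBot.comp h1) h1

/-- the half-line exponential -/
noncomputable def ex (r : ℝ) : ℂ := (Ioi (0:ℝ)).indicator (fun r : ℝ => Complex.exp (-1 * (r : ℂ))) r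

lemma ex_int : Integrable ex := by
  unfold ex
  rw [integrable_indicator_iff measurableSet_Ioi]
  exact integrableOn_exp_mul_complex_Ioi (by simp) 0

lemma ex_FT (t : ℝ) : FT ex t = 1 / (1 + t * Complex.I) := by
  unfold FT ex
  have : ∀ x : ℝ, (Ioi (0:ℝ)).indicator (fun r : ℝ => Complex.exp (-1 * (r : ℂ))) x *
      Complex.exp (-(t * x) * Complex.I) = 
      (Ioi (0:ℝ)).indicator (fun r : ℝ => Complex.exp ((-(1 + t * Complex.I)) * (r : ℂ))) x := by
    intro x
    by_cases h : x ∈ Ioi (0:ℝ)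
    · rw [indicator_of_mem h, indicator_of_mem h, ← Complex.exp_add]
      congr 1; ring
    · rw [indicator_of_notMem h, indicator_of_notMem h, zero_mul]
  simp_rw [this]
  rw [integral_indicator measurableSet_Ioi, integral_exp_mul_complex_Ioi (by simp)]
  simp only [Complex.ofReal_zero, mul_zero, Complex.exp_zero]
  rw [div_neg, neg_div, neg_neg]

lemma KT_phi_int {l : ℝ} (hl : 0 < l) : Integrable (KT (phi l)) := by
  have : KT (phi l) = fun y => (kf l y : ℂ) := by ext y; exact KT_phi hl y
  rw [this]
  exact (kf_int hl).ofReal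

lemma V_facts {l : ℝ} (hl : 0 < l) {g : ℝ → ℂ} (hg : Integrable g) :
    Integrable (fun t => phi l t * FT ex t * Complex.exp (FT g t)) ∧
    Integrable (KT (fun t => phi l t * FT ex t * Complex.exp (FT g t))) ∧
    ∫ x, KT (fun t => phi l t * FT ex t * Complex.exp (FT g t)) x = Complex.exp (FT g 0) * kap := by
  have h1 := mul_FT_int (phi_int hl) ex_int
  have h2 := KT_mul_int (phi_int hl) ex_int (KT_phi_int hl)
  refine ⟨int_exp h1 hg, (KT_exp h1 hg h2).1, ?_⟩
  rw [(KT_exp h1 hg h2).2, KT_mul_integral (phi_int hl) ex_int (KT_phi_int hl)]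
  have h3 : ∫ x, ex x = 1 := by
    have := ex_FT 0
    simpa [FT] using this
  rw [h3, one_mul]
  congr 1
  simp_rw [KT_phi hl]
  rw [integral_complex_ofReal, kf_integral hl]

end BT
namespace BT

section main
variable {H : ℝ → ℝ} {G : ℝ → ℝ → ℂ}

lemma re_ge_one {σ t : ℝ} (hσ : 1 < σ) : 1 ≤ ‖(σ + t * Complex.I : ℂ)‖ := by
  have := Complex.re_le_norm (σ + t * Complex.I : ℂ)
  simp at this
  linarith

lemma weight_int (hHm : Measurable H) (H0 : ∀ u, 0 ≤ H u) (Hneg : ∀ u < 0, H u = 0)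
    {e0 M : ℝ} (he0 : 0 < e0)
    (hIntegr : ∀ ε, 0 < ε → Integrable (fun u => H u * Real.exp (-ε * u)))
    (hM : ∀ ε, 0 < ε → ε < e0 → ε * ∫ u, H u * Real.exp (-ε * u) ≤ M) :
    Integrable (fun u => H u / (1 + u ^ 2)) := by
  set c : ℝ := e0 ^ 2 / 4 * Real.exp (-e0) with hc
  have hcpos : 0 < c := by positivity
  have hmeas : Measurable (Function.uncurry fun ε u : ℝ => ENNReal.ofReal (ε * (H u * Real.exp (-ε * u)))) := by
    apply ENNReal.measurable_ofReal.comp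
    have : Measurable fun p : ℝ × ℝ => H p.2 := hHm.comp measurable_snd
    fun_prop
  have hfin : ∫⁻ ε in Ioo 0 e0, ∫⁻ u, ENNReal.ofReal (ε * (H u * Real.exp (-ε * u))) < ⊤ := by
    have : ∫⁻ ε in Ioo 0 e0, ∫⁻ u, ENNReal.ofReal (ε * (H u * Real.exp (-ε * u))) ≤
        ∫⁻ ε in Ioo 0 e0, ENNReal.ofReal M := by
      apply setLIntegral_mono measurable_const
      intro ε hε
      rw [← ofReal_integral_eq_lintegral_ofReal ((hIntegr ε hε.1).const_mul ε)
        (Eventually.of_forall fun u => mul_nonneg hε.1.le (mul_nonneg (H0 u) (Real.exp_pos _).le)),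
        integral_const_mul]
      exact ENNReal.ofReal_le_ofReal (hM ε hε.1 hε.2)
    refine this.trans_lt ?_
    simp only [lintegral_const, Measure.restrict_apply MeasurableSet.univ, univ_inter, Real.volume_Ioo]
    exact ENNReal.mul_lt_top ENNReal.ofReal_lt_top ENNReal.ofReal_lt_top
  rw [lintegral_lintegral_swap hmeas.aemeasurable] at hfin
  have hle : ∀ u, ENNReal.ofReal (c * (H u / (1 + u ^ 2))) ≤
      ∫⁻ ε in Ioo 0 e0, ENNReal.ofReal (ε * (H u * Real.exp (-ε * u))) := by
    intro u
    by_cases hu : u < 0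
    · rw [Hneg u hu]; simp
    push Not at hu
    set r := Real.sqrt (1 + u ^ 2) with hr
    have hr2 : r ^ 2 = 1 + u ^ 2 := Real.sq_sqrt (by positivity)
    have hr1 : 1 ≤ r := by
      rw [hr]; apply Real.le_sqrt_of_sq_le; nlinarith [sq_nonneg u]
    have hru : u ≤ r := by
      rw [hr]; apply Real.le_sqrt_of_sq_le; linarith
    have hrpos : 0 < r := by linarith
    calc ENNReal.ofReal (c * (H u / (1 + u ^ 2)))
        = ∫⁻ ε in Ioo (e0 / (2 * r)) (e0 / r), ENNReal.ofReal (e0 / (2 * r) * (H u * Real.exp (-e0))) := by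
          simp only [lintegral_const, Measure.restrict_apply MeasurableSet.univ, univ_inter, Real.volume_Ioo]
          rw [← ENNReal.ofReal_mul]
          · congr 1
            rw [hc, ← hr2]
            field_simp
            ring
          · have := H0 u
            positivity
      _ ≤ ∫⁻ ε in Ioo (e0 / (2 * r)) (e0 / r), ENNReal.ofReal (ε * (H u * Real.exp (-ε * u))) := by
          apply setLIntegral_mono (hmeas.comp (measurable_id.prodMk measurable_const))
          intro ε hε
          apply ENNReal.ofReal_le_ofReal
          have h1 : 0 < e0 / (2 * r) := by positivity
          have h2 : ε * u ≤ e0 := by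
            have : ε * r ≤ e0 := by
              have := hε.2.le
              rwa [le_div_iff₀ hrpos] at this
            have h3 : 0 < ε := h1.trans hε.1
            nlinarith
          have := H0 u
          have := hε.1.le
          have h4 : Real.exp (-e0) ≤ Real.exp (-ε * u) := Real.exp_le_exp.2 (by linarith)
          change e0 / (2 * r) * (H u * Real.exp (-e0)) ≤ ε * (H u * Real.exp (-ε * u))
          have h5 : 0 ≤ ε := h1.le.trans this
          exact mul_le_mul this (mul_le_mul_of_nonneg_left h4 (H0 u))
            (mul_nonneg (H0 u) (Real.exp_pos _).le) h5
      _ ≤ _ := by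
          apply lintegral_mono_set
          apply Ioo_subset_Ioo (by positivity)
          apply div_le_self he0.le hr1
  have h3 : Integrable (fun u => c * (H u / (1 + u ^ 2))) := by
    refine ⟨Measurable.aestronglyMeasurable (by fun_prop), ?_⟩
    rw [hasFiniteIntegral_iff_ofReal]
    · exact (lintegral_mono hle).trans_lt hfin
    · refine Eventually.of_forall fun u => ?_
      have := H0 u
      simp only [Pi.zero_apply]
      positivity
  have h4 := h3.const_mul c⁻¹
  refine h4.congr (Eventually.of_forall fun u => ?_)
  dsimp only
  rw [← mul_assoc, inv_mul_cancel₀ hcpos.ne', one_mul]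

lemma kf_weight {l : ℝ} (hl : 0 < l) (x : ℝ) : ∃ C : ℝ, ∀ u, kf l (x - u) ≤ C / (1 + u ^ 2) := by
  obtain ⟨B, hB, h⟩ := kf_bound hl
  refine ⟨B * (3 + 2 * x ^ 2), fun u => ?_⟩
  rw [le_div_iff₀ (by positivity)]
  have h1 := (h (x - u)).1
  have h2 := (h (x - u)).2
  have h0 := kf_nonneg hl (x - u)
  have h3 : u ^ 2 ≤ 2 * (x - u) ^ 2 + 2 * x ^ 2 := by nlinarith [sq_nonneg (2 * x - u)]
  have h4 := mul_le_mul_of_nonneg_left h3 h0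
  have h5 := mul_le_mul_of_nonneg_left h1 (sq_nonneg x)
  nlinarith

lemma W_int {l : ℝ} (hl : 0 < l) (hHm : Measurable H) (H0 : ∀ u, 0 ≤ H u)
    (hw : Integrable (fun u => H u / (1 + u ^ 2))) (x : ℝ) :
    Integrable (fun u => H u * kf l (x - u)) := by
  obtain ⟨C, hC⟩ := kf_weight hl x
  refine (hw.const_mul C).mono' ?_ ?_
  · have := (kf_cont hl).measurable
    exact Measurable.aestronglyMeasurable (by fun_prop)
  · refine Eventually.of_forall fun u => ?_
    rw [Real.norm_of_nonneg (mul_nonneg (H0 u) (kf_nonneg hl _))]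
    have := mul_le_mul_of_nonneg_left (hC u) (H0 u)
    refine this.trans (le_of_eq ?_)
    ring

lemma W_sigma {l : ℝ} (hl : 0 < l) (hHm : Measurable H) (H0 : ∀ u, 0 ≤ H u)
    (Hneg : ∀ u < 0, H u = 0)
    (hw : Integrable (fun u => H u / (1 + u ^ 2))) (x : ℝ) :
    Tendsto (fun σ : ℝ => ∫ u, H u * Real.exp (-(σ - 1) * u) * kf l (x - u)) (𝓝[>] 1)
      (𝓝 (∫ u, H u * kf l (x - u))) := by
  have hk := (kf_cont hl).measurable
  apply tendsto_integral_filter_of_dominated_convergence (fun u => H u * kf l (x - u))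
  · refine Eventually.of_forall fun σ => ?_
    exact Measurable.aestronglyMeasurable (by fun_prop)
  · filter_upwards [self_mem_nhdsWithin] with σ hσ
    refine Eventually.of_forall fun u => ?_
    have h0 := H0 u
    have h1 := kf_nonneg hl (x - u)
    rw [Real.norm_of_nonneg (by positivity)]
    by_cases hu : u < 0
    · rw [Hneg u hu]; simp
    push Not at hu
    have : Real.exp (-(σ - 1) * u) ≤ 1 := by
      rw [Real.exp_le_one_iff]
      have : 0 < σ - 1 := sub_pos.2 hσ
      nlinarith
    gcongr
    exact mul_le_of_le_one_right h0 this
  · exact W_int hl hHm H0 hw x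
  · refine Eventually.of_forall fun u => ?_
    have : Continuous fun σ : ℝ => H u * Real.exp (-(σ - 1) * u) * kf l (x - u) := by fun_prop
    have h := this.tendsto 1
    simp only [sub_self, neg_zero, zero_mul, Real.exp_zero, mul_one] at h
    exact h.mono_left nhdsWithin_le_nhds

lemma W_bot {l : ℝ} (hl : 0 < l) (hHm : Measurable H) (H0 : ∀ u, 0 ≤ H u)
    (Hneg : ∀ u < 0, H u = 0)
    (hw : Integrable (fun u => H u / (1 + u ^ 2))) :
    Tendsto (fun y : ℝ => ∫ u, H u * kf l (y - u)) atBot (𝓝 0) := by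
  have hk := (kf_cont hl).measurable
  obtain ⟨B, hB, hb⟩ := kf_bound hl
  have e : (0 : ℝ) = ∫ u : ℝ, (0 : ℝ) := by simp
  rw [e]
  apply tendsto_integral_filter_of_dominated_convergence (fun u => 2 * B * (H u / (1 + u ^ 2)))
  · refine Eventually.of_forall fun σ => ?_
    exact Measurable.aestronglyMeasurable (by fun_prop)
  · filter_upwards [eventually_le_atBot 0] with y hy
    refine Eventually.of_forall fun u => ?_
    have h0 := H0 u
    have h1 := kf_nonneg hl (y - u)
    rw [Real.norm_of_nonneg (by positivity)]
    by_cases hu : u < 0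
    · rw [Hneg u hu]; simp
    push Not at hu
    have : kf l (y - u) ≤ 2 * B / (1 + u ^ 2) := by
      rw [le_div_iff₀ (by positivity)]
      have h3 := (hb (y - u)).1
      have h2 := (hb (y - u)).2
      have h4 : u ^ 2 ≤ (y - u) ^ 2 := by nlinarith
      have h5 := mul_le_mul_of_nonneg_right h4 h1
      linarith
    have := mul_le_mul_of_nonneg_left this h0
    refine this.trans (le_of_eq ?_)
    ring
  · exact hw.const_mul _
  · refine Eventually.of_forall fun u => ?_
    have h1 : Tendsto (fun y : ℝ => kf l (y - u)) atBot (𝓝 0) := by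
      have h2 : Tendsto (fun y : ℝ => B / (u - y)) atBot (𝓝 0) := by
        apply Tendsto.const_div_atTop
        exact tendsto_atTop_add_const_left _ u tendsto_neg_atBot_atTop
      refine tendsto_of_tendsto_of_tendsto_of_le_of_le' tendsto_const_nhds h2
        (Eventually.of_forall fun y => kf_nonneg hl _) ?_
      filter_upwards [eventually_le_atBot (u - 1)] with y hy
      rw [le_div_iff₀ (by linarith)]
      have h3 := (hb (y - u)).2
      have h1 := kf_nonneg hl (y - u)
      have h4 : (u - y) ≤ (y - u) ^ 2 := by nlinarith
      have h5 := mul_le_mul_of_nonneg_right h4 h1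
      linarith
    simpa using h1.const_mul (H u)

/-- the damped function -/
noncomputable def hs (H : ℝ → ℝ) (σ u : ℝ) : ℂ := ((H u * Real.exp (-(σ - 1) * u) : ℝ) : ℂ)

lemma W_KT {l : ℝ} (hl : 0 < l) {σ : ℝ}
    (hIntegr : Integrable (fun u => H u * Real.exp (-(σ - 1) * u))) (x : ℝ) :
    KT (fun t => phi l t * FT (hs H σ) t) x =
      ((∫ u, H u * Real.exp (-(σ - 1) * u) * kf l (x - u) : ℝ) : ℂ) := by
  rw [KT_mul_FT (phi_int hl) (by exact hIntegr.ofReal), ← integral_complex_ofReal]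
  congr 1; ext u
  rw [KT_phi hl, hs]
  push_cast
  rfl

/-- the kernel in the t variable -/
noncomputable def EE (x y σ t : ℝ) : ℂ := ∫ v in y..x, Complex.exp ((σ - 1 + t * Complex.I) * v)

lemma EE_eq {x y σ t : ℝ} (hσ : 1 < σ) : EE x y σ t =
    (Complex.exp ((σ - 1 + t * Complex.I) * x) - Complex.exp ((σ - 1 + t * Complex.I) * y)) /
      (σ - 1 + t * Complex.I) := by
  unfold EE
  rw [integral_exp_mul_complex]
  intro h
  have := congrArg Complex.re h
  simp at this
  linarith

lemma EE_bound {x y σ t : ℝ} (h1 : 1 < σ) (h2 : σ < 2) :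
    ‖EE x y σ t‖ ≤ Real.exp (|x| + |y|) * |x - y| := by
  unfold EE
  apply intervalIntegral.norm_integral_le_of_norm_le_const
  intro v hv
  rw [Complex.norm_exp]
  apply Real.exp_le_exp.2
  have : ((σ - 1 + t * Complex.I) * (v : ℂ) : ℂ).re = (σ - 1) * v := by simp
  rw [this]
  have hv' : v ≤ |x| + |y| := by
    have := hv.2
    rcases le_max_iff.1 this with h | h
    · linarith [le_abs_self y, abs_nonneg x]
    · linarith [le_abs_self x, abs_nonneg y]
  have : 0 ≤ |x| + |y| := by positivity
  by_cases hv0 : 0 ≤ v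
  · nlinarith
  · push Not at hv0
    nlinarith

lemma EE_tendsto (x y t : ℝ) : Tendsto (fun σ => EE x y σ t) (𝓝[>] 1) (𝓝 (EE x y 1 t)) := by
  have : Continuous fun σ => EE x y σ t := by
    unfold EE
    apply intervalIntegral.continuous_parametric_intervalIntegral_of_continuous' 
    unfold Function.uncurry
    fun_prop
  exact (this.tendsto 1).mono_left nhdsWithin_le_nhds

lemma diff_sigma {l : ℝ} (hl : 0 < l) {σ : ℝ} (hσ : 1 < σ)
    (hIntegr : Integrable (fun u => H u * Real.exp (-(σ - 1) * u)))
    (hL : ∀ t : ℝ, FT (hs H σ) t =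
      Complex.exp (G σ t) / ((σ + t * Complex.I) * (σ + t * Complex.I - 1))) (x y : ℝ) :
    (Integrable fun t => phi l t * Complex.exp (G σ t) / (σ + t * Complex.I) * EE x y σ t) ∧
    ((Real.exp ((σ - 1) * x) * (∫ u, H u * Real.exp (-(σ - 1) * u) * kf l (x - u)) -
     Real.exp ((σ - 1) * y) * (∫ u, H u * Real.exp (-(σ - 1) * u) * kf l (y - u)) : ℝ) : ℂ) =
      ∫ t, phi l t * Complex.exp (G σ t) / (σ + t * Complex.I) * EE x y σ t := by
  have hq := mul_FT_int (phi_int hl) (g := hs H σ) (by exact hIntegr.ofReal)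
  have hi : ∀ z : ℝ, Integrable fun t : ℝ => (Real.exp ((σ - 1) * z) : ℂ) *
      (phi l t * FT (hs H σ) t * Complex.exp ((t * z) * Complex.I)) := by
    intro z
    apply Integrable.const_mul
    refine hq.mul_bdd (c := 1) (Continuous.aestronglyMeasurable (by fun_prop)) ?_
    exact Eventually.of_forall fun t => (norm_e t z).le
  have hpt : ∀ t : ℝ, (Real.exp ((σ - 1) * x) : ℂ) *
      (phi l t * FT (hs H σ) t * Complex.exp ((t * x) * Complex.I)) - 
      (Real.exp ((σ - 1) * y) : ℂ) *
      (phi l t * FT (hs H σ) t * Complex.exp ((t * y) * Complex.I)) =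
      phi l t * Complex.exp (G σ t) / (σ + t * Complex.I) * EE x y σ t := by
    intro t
    have hz : ∀ z : ℝ, (Real.exp ((σ - 1) * z) : ℂ) * Complex.exp ((t * z) * Complex.I) =
        Complex.exp ((σ - 1 + t * Complex.I) * z) := by
      intro z
      rw [Complex.ofReal_exp, ← Complex.exp_add]
      congr 1; push_cast; ring
    have hs0 : (σ + t * Complex.I : ℂ) ≠ 0 := by
      intro h
      have := re_ge_one (t := t) hσ
      rw [h] at this; simp at this; linarith
    have hs1 : (σ - 1 + t * Complex.I : ℂ) ≠ 0 := by
      intro h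
      have := congrArg Complex.re h
      simp at this
      linarith
    rw [EE_eq hσ, hL, ← hz, ← hz]
    have e : (σ + t * Complex.I - 1 : ℂ) = σ - 1 + t * Complex.I := by ring
    rw [e]
    field_simp
    try ring
  constructor
  · refine ((hi x).sub (hi y)).congr (Eventually.of_forall fun t => ?_)
    exact hpt t
  · rw [← integral_congr_ae (Eventually.of_forall hpt)]
    rw [integral_sub (hi x) (hi y), integral_const_mul, integral_const_mul]
    push_cast
    have hx := W_KT hl hIntegr x
    have hy := W_KT hl hIntegr y
    rw [← hx, ← hy]
    rfl

lemma diff_lim {l : ℝ} (hl : 0 < l) (hHm : Measurable H) (H0 : ∀ u, 0 ≤ H u)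
    (Hneg : ∀ u < 0, H u = 0)
    (hw : Integrable (fun u => H u / (1 + u ^ 2)))
    (hIntegr : ∀ σ : ℝ, 1 < σ → Integrable (fun u => H u * Real.exp (-(σ - 1) * u)))
    (hL : ∀ σ : ℝ, 1 < σ → ∀ t : ℝ, FT (hs H σ) t =
      Complex.exp (G σ t) / ((σ + t * Complex.I) * (σ + t * Complex.I - 1)))
    {g : ℝ → ℂ} (hg : Integrable g)
    (hG : TendstoUniformlyOn G (FT g) (𝓝[>] 1) (Icc (-l) l)) (x y : ℝ) :
    (((∫ u, H u * kf l (x - u)) - (∫ u, H u * kf l (y - u)) : ℝ) : ℂ) =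
      ∫ v in y..x, KT (fun t => phi l t * FT ex t * Complex.exp (FT g t)) v := by
  have hz : ∀ z : ℝ, Tendsto (fun σ : ℝ => Real.exp ((σ - 1) * z) *
      (∫ u, H u * Real.exp (-(σ - 1) * u) * kf l (z - u))) (𝓝[>] 1)
      (𝓝 (∫ u, H u * kf l (z - u))) := by
    intro z
    have h1 : Tendsto (fun σ : ℝ => Real.exp ((σ - 1) * z)) (𝓝[>] 1) (𝓝 1) := by
      have : Continuous fun σ : ℝ => Real.exp ((σ - 1) * z) := by fun_prop
      have h := this.tendsto 1
      simp only [sub_self, zero_mul, Real.exp_zero] at h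
      exact h.mono_left nhdsWithin_le_nhds
    simpa using h1.mul (W_sigma hl hHm H0 Hneg hw z)
  have hleft := (Complex.continuous_ofReal.tendsto _).comp ((hz x).sub (hz y))
  have hright : Tendsto (fun σ : ℝ => ∫ t, phi l t * Complex.exp (G σ t) / (σ + t * Complex.I) * EE x y σ t)
      (𝓝[>] 1) (𝓝 (∫ t, phi l t * FT ex t * Complex.exp (FT g t) * EE x y 1 t)) := by
    apply tendsto_integral_filter_of_dominated_convergence
      (fun t => ‖phi l t‖ * (Real.exp ((∫ x, ‖g x‖) + 1) * (Real.exp (|x| + |y|) * |x - y|)))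
    · filter_upwards [self_mem_nhdsWithin] with σ hσ
      exact (diff_sigma hl hσ (hIntegr σ hσ) (hL σ hσ) x y).1.1
    · have hu := Metric.tendstoUniformlyOn_iff.1 hG 1 one_pos
      filter_upwards [self_mem_nhdsWithin, hu, mem_nhdsWithin_of_mem_nhds (Iio_mem_nhds (by norm_num : (1:ℝ) < 2))] with σ hσ hu hσ2
      refine Eventually.of_forall fun t => ?_
      by_cases ht : t ∈ Icc (-l) l
      · have h1 := hu t ht
        rw [dist_eq_norm] at h1
        have h2 : ‖Complex.exp (G σ t)‖ ≤ Real.exp ((∫ x, ‖g x‖) + 1) := by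
          rw [Complex.norm_exp]
          apply Real.exp_le_exp.2
          refine (Complex.re_le_norm _).trans ?_
          have h3 : ‖G σ t‖ ≤ ‖FT g t‖ + ‖FT g t - G σ t‖ := by
            have := norm_sub_le (FT g t) (FT g t - G σ t)
            simpa using this
          linarith [FT_bound g t]
        rw [norm_mul, norm_div, norm_mul]
        have h4 := EE_bound (x := x) (y := y) (t := t) hσ hσ2
        have h5 := re_ge_one (t := t) hσ
        calc ‖phi l t‖ * ‖Complex.exp (G σ t)‖ / ‖(σ + t * Complex.I : ℂ)‖ * ‖EE x y σ t‖
            ≤ ‖phi l t‖ * ‖Complex.exp (G σ t)‖ * ‖EE x y σ t‖ := by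
              gcongr
              exact div_le_self (by positivity) h5
          _ = ‖phi l t‖ * (‖Complex.exp (G σ t)‖ * ‖EE x y σ t‖) := by ring
          _ ≤ _ := by gcongr
      · rw [phi_zero hl ht]; simp
    · exact (phi_int hl).norm.mul_const _
    · refine Eventually.of_forall fun t => ?_
      by_cases ht : t ∈ Icc (-l) l
      · rw [ex_FT, mul_one_div]
        have h1 : Tendsto (fun σ => Complex.exp (G σ t)) (𝓝[>] 1) (𝓝 (Complex.exp (FT g t))) :=
          (Complex.continuous_exp.tendsto _).comp (hG.tendsto_at ht)
        have hne : (1 + t * Complex.I : ℂ) ≠ 0 := by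
          intro h
          have := congrArg Complex.re h
          simp at this
        have h2 : Tendsto (fun σ : ℝ => (σ + t * Complex.I : ℂ)) (𝓝[>] 1) (𝓝 (1 + t * Complex.I)) := by
          have : Continuous fun σ : ℝ => (σ + t * Complex.I : ℂ) := by fun_prop
          have h := this.tendsto 1
          simp only [Complex.ofReal_one] at h
          exact h.mono_left nhdsWithin_le_nhds
        have h3 := ((h1.const_mul (phi l t)).div h2 hne).mul (EE_tendsto x y t)
        have e : phi l t / (1 + t * Complex.I) * Complex.exp (FT g t) * EE x y 1 t =
          phi l t * Complex.exp (FT g t) / (1 + t * Complex.I) * EE x y 1 t := by ring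
        rw [e]
        exact h3
      · rw [phi_zero hl ht]; simp
  have heq : ∀ᶠ σ in 𝓝[>] (1:ℝ), (∫ t, phi l t * Complex.exp (G σ t) / (σ + t * Complex.I) * EE x y σ t) =
     ((Real.exp ((σ - 1) * x) * (∫ u, H u * Real.exp (-(σ - 1) * u) * kf l (x - u)) -
     Real.exp ((σ - 1) * y) * (∫ u, H u * Real.exp (-(σ - 1) * u) * kf l (y - u)) : ℝ) : ℂ) := by
    filter_upwards [self_mem_nhdsWithin] with σ hσ
    exact (diff_sigma hl hσ (hIntegr σ hσ) (hL σ hσ) x y).2.symm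
  have := tendsto_nhds_unique hleft (hright.congr' heq)
  rw [this]
  have hQ := (V_facts hl hg).1
  set Q := fun t => phi l t * FT ex t * Complex.exp (FT g t) with hQd
  have e1 : ∀ t, phi l t * FT ex t * Complex.exp (FT g t) * EE x y 1 t = 
      ∫ v in y..x, Q t * Complex.exp ((t * v) * Complex.I) := by
    intro t
    rw [intervalIntegral.integral_const_mul]
    unfold EE
    simp only [hQd]
    congr 2; ext v
    congr 1
    push_cast
    ring
  simp_rw [e1]
  unfold KT
  have sw : ∀ s : Set ℝ, volume s < ⊤ → ∫ t, ∫ v in s, Q t * Complex.exp ((t * v) * Complex.I) =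
      ∫ v in s, ∫ t, Q t * Complex.exp ((t * v) * Complex.I) := by
    intro s hsf
    have : IsFiniteMeasure (volume.restrict s) := ⟨by simpa using hsf⟩
    rw [integral_integral_swap]
    have := hQ.mul_prod (integrable_const (1:ℂ) : Integrable (fun _ : ℝ => (1:ℂ)) (volume.restrict s))
    simp only [mul_one] at this
    refine this.mul_bdd (c := 1) (Continuous.aestronglyMeasurable (by fun_prop)) ?_
    exact Eventually.of_forall fun t => (norm_e t.1 t.2).le
  simp_rw [intervalIntegral.intervalIntegral_eq_integral_uIoc]
  rw [integral_smul, sw _ (by simp [uIoc])]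

theorem main_limit (hHm : Measurable H) (H0 : ∀ u, 0 ≤ H u)
    (Hneg : ∀ u < 0, H u = 0)
    (hIntegr : ∀ σ : ℝ, 1 < σ → Integrable (fun u => H u * Real.exp (-(σ - 1) * u)))
    (hL : ∀ σ : ℝ, 1 < σ → ∀ t : ℝ, FT (hs H σ) t =
      Complex.exp (G σ t) / ((σ + t * Complex.I) * (σ + t * Complex.I - 1)))
    (hG : ∀ l : ℝ, 0 < l → ∃ g : ℝ → ℂ, Integrable g ∧ 
      TendstoUniformlyOn G (FT g) (𝓝[>] 1) (Icc (-l) l)) :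
    ∃ a : ℝ, 0 < a ∧ ∀ l : ℝ, 0 < l → (∀ x, Integrable (fun u => H u * kf l (x - u))) ∧
      Tendsto (fun x : ℝ => ∫ u, H u * kf l (x - u)) atTop (𝓝 (kap * a)) := by
  obtain ⟨g1, hg1, hG1⟩ := hG 1 one_pos
  have hreal : ∀ σ : ℝ, 1 < σ → Complex.exp (G σ 0) =
      ((σ * (σ - 1) * ∫ u, H u * Real.exp (-(σ - 1) * u) : ℝ) : ℂ) := by
    intro σ hσ
    have h := hL σ hσ 0
    have h1 : FT (hs H σ) 0 = ((∫ u, H u * Real.exp (-(σ - 1) * u) : ℝ) : ℂ) := by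
      unfold FT hs
      simp only [Complex.ofReal_zero, zero_mul, neg_zero, Complex.exp_zero, mul_one]
      exact integral_complex_ofReal
    have hs0 : (σ : ℂ) ≠ 0 := by exact_mod_cast (by linarith : σ ≠ 0)
    have hs1 : (σ - 1 : ℂ) ≠ 0 := by
      have : (σ - 1 : ℝ) ≠ 0 := by linarith
      exact_mod_cast this
    rw [h1] at h
    simp only [Complex.ofReal_zero, zero_mul, add_zero] at h
    rw [eq_div_iff (mul_ne_zero hs0 hs1)] at h
    rw [← h]
    push_cast
    ring
  have lim : ∀ {l : ℝ}, 0 < l → ∀ {g : ℝ → ℂ}, TendstoUniformlyOn G (FT g) (𝓝[>] 1) (Icc (-l) l) →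
      Tendsto (fun σ => Complex.exp (G σ 0)) (𝓝[>] 1) (𝓝 (Complex.exp (FT g 0))) := by
    intro l hl g hg
    exact (Complex.continuous_exp.tendsto _).comp (hg.tendsto_at ⟨by linarith, hl.le⟩)
  have lim1 := lim one_pos hG1
  set A := Complex.exp (FT g1 0) with hA
  have him : A.im = 0 := by
    have h1 := (Complex.continuous_im.tendsto _).comp lim1
    refine tendsto_nhds_unique (h1.congr' ?_) tendsto_const_nhds
    filter_upwards [self_mem_nhdsWithin] with σ hσ
    simp only [Function.comp]
    rw [hreal σ hσ, Complex.ofReal_im]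
  have hreT := (Complex.continuous_re.tendsto _).comp lim1
  have hreT' : Tendsto (fun σ : ℝ => σ * (σ - 1) * ∫ u, H u * Real.exp (-(σ - 1) * u)) (𝓝[>] 1) (𝓝 A.re) := by
    refine hreT.congr' ?_
    filter_upwards [self_mem_nhdsWithin] with σ hσ
    simp only [Function.comp]
    rw [hreal σ hσ, Complex.ofReal_re]
  have hre0 : 0 ≤ A.re := by
    refine ge_of_tendsto hreT' ?_
    filter_upwards [self_mem_nhdsWithin] with σ hσ
    have hσ' : 1 < σ := hσ
    apply mul_nonneg
    · nlinarith
    · exact integral_nonneg fun u => mul_nonneg (H0 u) (Real.exp_pos _).le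
  have hAre : A = (A.re : ℂ) := Complex.ext (by simp) (by simpa using him)
  have hpos : 0 < A.re := by
    refine lt_of_le_of_ne hre0 fun h => ?_
    have : A = 0 := by rw [hAre, ← h]; simp
    exact Complex.exp_ne_zero _ this
  have hw : Integrable (fun u => H u / (1 + u ^ 2)) := by
    have hev : ∀ᶠ σ in 𝓝[>] (1:ℝ), σ * (σ - 1) * (∫ u, H u * Real.exp (-(σ - 1) * u)) < A.re + 1 :=
      hreT'.eventually_lt_const (by linarith)
    obtain ⟨b, hb, hb2⟩ := mem_nhdsGT_iff_exists_Ioo_subset.1 hev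
    have hb1 : 1 < b := hb
    refine weight_int hHm H0 Hneg (e0 := b - 1) (M := A.re + 1) (by linarith) ?_ ?_
    · intro ε hε
      have := hIntegr (1 + ε) (by linarith)
      simpa using this
    · intro ε hε hε2
      have h := hb2 (⟨by linarith, by linarith⟩ : 1 + ε ∈ Ioo 1 b)
      simp only [mem_ofPred_eq, add_sub_cancel_left] at h
      have h0 : 0 ≤ ∫ u, H u * Real.exp (-ε * u) := 
        integral_nonneg fun u => mul_nonneg (H0 u) (Real.exp_pos _).le
      have : 0 ≤ ε * (ε * ∫ u, H u * Real.exp (-ε * u)) := by positivity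
      nlinarith
  refine ⟨A.re, hpos, fun l hl => ⟨W_int hl hHm H0 hw, ?_⟩⟩
  obtain ⟨g, hg, hGg⟩ := hG l hl
  have hAg : Complex.exp (FT g 0) = A := tendsto_nhds_unique (lim hl hGg) lim1
  obtain ⟨-, hV, hVi⟩ := V_facts hl hg
  rw [hAg] at hVi
  have h1 := intervalIntegral_tendsto_integral hV (tendsto_neg_atTop_atBot) tendsto_id
  rw [hVi] at h1
  simp only [id] at h1
  simp_rw [← diff_lim hl hHm H0 Hneg hw hIntegr hL hg hGg] at h1
  have h2 := (Complex.continuous_re.tendsto _).comp h1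
  simp only [Function.comp_def, Complex.ofReal_re] at h2
  have h3 := h2.add ((W_bot hl hHm H0 Hneg hw).comp tendsto_neg_atTop_atBot)
  simp only [Function.comp_def, sub_add_cancel, add_zero] at h3
  convert h3 using 2
  simp
  ring

end main
end BT
namespace BT

section tauber
variable {H : ℝ → ℝ}

lemma kf_shift (l z x d : ℝ) (hz : z = x - d) (hd : 0 < d) :
    ∫ u in Ioc (x - 2 * d) x, kf l (z - u) = ∫ y in (-d)..d, kf l y := by
  rw [← intervalIntegral.integral_of_le (by linarith), intervalIntegral.integral_comp_sub_left]
  congr 1 <;> rw [hz] <;> ring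

lemma H_le (hmono : Monotone (fun u => Real.exp u * H u)) {u x : ℝ} (h : u ≤ x) :
    H u ≤ Real.exp (x - u) * H x := by
  have := hmono h
  dsimp only at this
  rw [Real.exp_sub, div_mul_eq_mul_div, le_div_iff₀ (Real.exp_pos u)]
  linarith

lemma upper (hmono : Monotone (fun u => Real.exp u * H u)) (H0 : ∀ u, 0 ≤ H u)
    {l d : ℝ} (hl : 0 < l) (hd : 0 < d)
    (hi : ∀ x, Integrable (fun u => H u * kf l (x - u))) (x : ℝ) :
    H x * Real.exp (-(2 * d)) * (∫ y in (-d)..d, kf l y) ≤ ∫ u, H u * kf l (x + d - u) := by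
  rw [← kf_shift l (x + d) (x + 2 * d) d (by ring) hd, ← integral_const_mul]
  have hk : Integrable (fun u => kf l (x + d - u)) := (kf_int hl).comp_sub_left (x + d)
  refine le_trans ?_ (setIntegral_le_integral (s := Ioc (x + 2 * d - 2 * d) (x + 2 * d)) (hi (x + d))
    (Eventually.of_forall fun u => mul_nonneg (H0 u) (kf_nonneg hl _)))
  apply setIntegral_mono_on (hk.integrableOn.const_mul _) (hi (x + d)).integrableOn measurableSet_Ioc
  intro u hu
  have h1 : x ≤ u := by linarith [hu.1]
  have h2 := H_le hmono h1
  refine mul_le_mul_of_nonneg_right ?_ (kf_nonneg hl _)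
  rw [Real.exp_neg, ← div_eq_mul_inv, div_le_iff₀ (Real.exp_pos _)]
  refine h2.trans ?_
  rw [mul_comm]
  refine mul_le_mul_of_nonneg_left (Real.exp_le_exp.2 ?_) (H0 u)
  linarith [hu.2]

lemma lower (hmono : Monotone (fun u => Real.exp u * H u))
    {l d M : ℝ} (hl : 0 < l) (hd : 0 < d) (hM : ∀ u, H u ≤ M) (H0 : ∀ u, 0 ≤ H u)
    (hi : ∀ x, Integrable (fun u => H u * kf l (x - u))) (x : ℝ) :
    ∫ u, H u * kf l (x - d - u) ≤
      H x * Real.exp (2 * d) * (∫ y in (-d)..d, kf l y) + M * (kap - ∫ y in (-d)..d, kf l y) := by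
  have hk : Integrable (fun u => kf l (x - d - u)) := (kf_int hl).comp_sub_left (x - d)
  have htot : ∫ u, kf l (x - d - u) = kap := by
    rw [integral_sub_left_eq_self (fun u => kf l u), kf_integral hl]
  have hS : MeasurableSet (Ioc (x - 2 * d) x) := measurableSet_Ioc
  rw [← kf_shift l (x - d) x d rfl hd, ← htot, ← integral_add_compl hS hk, add_sub_cancel_left,
    ← integral_add_compl hS (hi (x - d)), ← integral_const_mul, ← integral_const_mul]
  apply add_le_add
  · apply setIntegral_mono_on (hi (x - d)).integrableOn (hk.integrableOn.const_mul _) hS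
    intro u hu
    refine mul_le_mul_of_nonneg_right ?_ (kf_nonneg hl _)
    refine (H_le hmono hu.2).trans ?_
    rw [mul_comm]
    refine mul_le_mul_of_nonneg_left (Real.exp_le_exp.2 ?_) (H0 x)
    linarith [hu.1]
  · apply setIntegral_mono_on (hi (x - d)).integrableOn (hk.integrableOn.const_mul _) hS.compl
    intro u hu
    exact mul_le_mul_of_nonneg_right (hM u) (kf_nonneg hl _)

theorem tauber (hmono : Monotone (fun u => Real.exp u * H u)) (H0 : ∀ u, 0 ≤ H u)
    (Hneg : ∀ u < 0, H u = 0) {a : ℝ} (ha : 0 < a)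
    (hW : ∀ l : ℝ, 0 < l → (∀ x, Integrable (fun u => H u * kf l (x - u))) ∧
      Tendsto (fun x : ℝ => ∫ u, H u * kf l (x - u)) atTop (𝓝 (kap * a))) :
    Tendsto H atTop (𝓝 a) := by
  have hup : ∀ b, a < b → ∀ᶠ x in atTop, H x < b := by
    intro b hb
    obtain ⟨d, hd, hd2⟩ : ∃ d : ℝ, 0 < d ∧ a < b * Real.exp (-(2 * d)) := by
      have hc : Continuous fun d : ℝ => b * Real.exp (-(2 * d)) := by fun_prop
      have h := (hc.tendsto 0).mono_left (nhdsWithin_le_nhds (s := Ioi 0))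
      simp only [mul_zero, neg_zero, Real.exp_zero, mul_one] at h
      obtain ⟨d, h1, h2⟩ := ((h.eventually_const_lt hb).and self_mem_nhdsWithin).exists
      exact ⟨d, h2, h1⟩
    obtain ⟨l, hl, hl2⟩ : ∃ l : ℝ, 0 < l ∧ kap * a < b * Real.exp (-(2 * d)) * ∫ y in (-d)..d, kf l y := by
      have h := (kf_mass hd).const_mul (b * Real.exp (-(2 * d)))
      have h0 : kap * a < b * Real.exp (-(2 * d)) * kap := by
        rw [mul_comm]; exact mul_lt_mul_of_pos_right hd2 kap_pos
      obtain ⟨l, h1, h2⟩ := ((h.eventually_const_lt h0).and (eventually_gt_atTop 0)).exists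
      exact ⟨l, h2, h1⟩
    obtain ⟨hi, ht⟩ := hW l hl
    have ht' := ht.comp (tendsto_atTop_add_const_right atTop d tendsto_id)
    filter_upwards [ht'.eventually_lt_const hl2] with x hx
    simp only [Function.comp, id] at hx
    have h1 := (upper hmono H0 hl hd hi x).trans_lt hx
    have hbp : 0 < b * Real.exp (-(2 * d)) := ha.trans hd2
    have hc : 0 < ∫ y in (-d)..d, kf l y := by
      have := mul_pos kap_pos ha
      exact pos_of_mul_pos_right (this.trans hl2) hbp.le
    have h2 := lt_of_mul_lt_mul_right h1 hc.le
    exact lt_of_mul_lt_mul_right h2 (Real.exp_pos _).le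
  obtain ⟨M, hM⟩ : ∃ M, ∀ u, H u ≤ M := by
    obtain ⟨X, hX⟩ := eventually_atTop.1 (hup (a + 1) (by linarith))
    refine ⟨a + 1 + Real.exp (max X 0) * H (max X 0), fun u => ?_⟩
    have h0 : 0 ≤ Real.exp (max X 0) * H (max X 0) := mul_nonneg (Real.exp_pos _).le (H0 _)
    by_cases hu : u < 0
    · rw [Hneg u hu]; linarith
    by_cases hu2 : X ≤ u
    · linarith [hX u hu2]
    · push Not at hu hu2
      have h1 := H_le hmono (le_trans hu2.le (le_max_left X 0))
      have h2 : Real.exp (max X 0 - u) * H (max X 0) ≤ Real.exp (max X 0) * H (max X 0) :=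
        mul_le_mul_of_nonneg_right (Real.exp_le_exp.2 (by linarith)) (H0 _)
      linarith
  have hlow : ∀ b, b < a → ∀ᶠ x in atTop, b < H x := by
    intro b hb
    by_cases hb0 : b < 0
    · exact Eventually.of_forall fun x => hb0.trans_le (H0 x)
    obtain ⟨d, hd, hd2⟩ : ∃ d : ℝ, 0 < d ∧ b * Real.exp (2 * d) < a := by
      have hc : Continuous fun d : ℝ => b * Real.exp (2 * d) := by fun_prop
      have h := (hc.tendsto 0).mono_left (nhdsWithin_le_nhds (s := Ioi 0))
      simp only [mul_zero, Real.exp_zero, mul_one] at h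
      obtain ⟨d, h1, h2⟩ := ((h.eventually_lt_const hb).and self_mem_nhdsWithin).exists
      exact ⟨d, h2, h1⟩
    obtain ⟨l, hl, hl2⟩ : ∃ l : ℝ, 0 < l ∧
        b * Real.exp (2 * d) * kap + M * (kap - ∫ y in (-d)..d, kf l y) < kap * a := by
      have h := (((kf_mass hd).const_sub kap).const_mul M).const_add (b * Real.exp (2 * d) * kap)
      have h0 : b * Real.exp (2 * d) * kap + M * (kap - kap) < kap * a := by
        rw [sub_self, mul_zero, add_zero, mul_comm kap]; exact mul_lt_mul_of_pos_right hd2 kap_pos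
      obtain ⟨l, h1, h2⟩ := ((h.eventually_lt_const h0).and (eventually_gt_atTop 0)).exists
      exact ⟨l, h2, h1⟩
    obtain ⟨hi, ht⟩ := hW l hl
    have ht' := ht.comp (tendsto_atTop_add_const_right atTop (-d) tendsto_id)
    filter_upwards [ht'.eventually_const_lt hl2] with x hx
    simp only [Function.comp, id, ← sub_eq_add_neg] at hx
    have h1 := hx.trans_le (lower hmono hl hd hM H0 hi x)
    have hck : ∫ y in (-d)..d, kf l y ≤ kap := by
      rw [← kf_integral hl, intervalIntegral.integral_of_le (by linarith)]
      exact setIntegral_le_integral (kf_int hl) (Eventually.of_forall fun u => kf_nonneg hl _)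
    have h2 : b * Real.exp (2 * d) * kap < H x * Real.exp (2 * d) * (∫ y in (-d)..d, kf l y) := by
      linarith
    have h3 : H x * Real.exp (2 * d) * (∫ y in (-d)..d, kf l y) ≤ H x * Real.exp (2 * d) * kap :=
      mul_le_mul_of_nonneg_left hck (mul_nonneg (H0 x) (Real.exp_pos _).le)
    have h4 := lt_of_mul_lt_mul_right (h2.trans_le h3) kap_pos.le
    exact lt_of_mul_lt_mul_right h4 (Real.exp_pos _).le
  exact tendsto_order.2 ⟨hlow, hup⟩

end tauber
end BT
namespace BT

section arith
variable {p : ℕ → ℝ}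

lemma prod_cpow (S : Finset ℕ) (f : ℕ → ℝ) (hf : ∀ k, 0 ≤ f k) (c : ℂ) :
    ((∏ k ∈ S, f k : ℝ) : ℂ) ^ c = ∏ k ∈ S, (f k : ℂ) ^ c := by
  induction S using Finset.induction_on with
  | empty => simp
  | insert a S ha ih =>
    rw [Finset.prod_insert ha, Finset.prod_insert ha, Complex.ofReal_mul,
      Complex.mul_cpow_ofReal_nonneg (hf a) (Finset.prod_nonneg fun k _ => hf k), ih]

lemma pow_cpow {x : ℝ} (hx : 0 ≤ x) (e : ℕ) (c : ℂ) :
    ((x ^ e : ℝ) : ℂ) ^ c = ((x : ℂ) ^ c) ^ e := by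
  have := prod_cpow (Finset.range e) (fun _ => x) (fun _ => hx) c
  simpa using this

lemma nval_cpow (hp : ∀ k, 1 < p k) (α : ℕ →₀ ℕ) (c : ℂ) :
    (nval p α : ℂ) ^ c = α.prod fun k e => ((p k : ℂ) ^ c) ^ e := by
  unfold nval Finsupp.prod
  rw [prod_cpow _ _ (fun k => pow_nonneg (by linarith [hp k]) _)]
  exact Finset.prod_congr rfl fun k _ => pow_cpow (by linarith [hp k]) _ _

lemma nval_one_le (hp : ∀ k, 1 < p k) (α : ℕ →₀ ℕ) : 1 ≤ nval p α := by
  unfold nval Finsupp.prod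
  refine Finset.prod_induction _ (fun x : ℝ => 1 ≤ x) (fun a b ha hb => ?_) le_rfl
    fun k _ => one_le_pow₀ (hp k).le
  exact one_le_mul_of_one_le_of_one_le ha hb

/-- an enumeration of the ordinary primes -/
noncomputable def enumP : ℕ ≃ Nat.Primes :=
  haveI : Infinite Nat.Primes := Nat.infinite_setOfPred_prime.to_subtype
  (Classical.choice (nonempty_equiv_of_countable (α := ℕ) (β := Nat.Primes)))

/-- the enumeration as an embedding -/
noncomputable def embP : ℕ ↪ ℕ := ⟨fun k => (enumP k : ℕ), fun a b h =>
  enumP.injective (Subtype.ext h)⟩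

/-- transported values -/
noncomputable def ZZ (z : ℕ → ℂ) (q : ℕ) : ℂ :=
  if hq : q.Prime then z (enumP.symm ⟨q, hq⟩) else 1

lemma ZZ_emb (z : ℕ → ℂ) (k : ℕ) : ZZ z (embP k) = z k := by
  have h : (embP k).Prime := (enumP k).2
  unfold ZZ
  rw [dif_pos h]
  congr 1
  exact enumP.symm_apply_apply k

/-- completely multiplicative function on ℕ -/
noncomputable def fM (z : ℕ → ℂ) : ℕ →*₀ ℂ where
  toFun n := if n = 0 then 0 else n.factorization.prod fun q e => ZZ z q ^ e
  map_zero' := by simp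
  map_one' := by simp
  map_mul' a b := by
    by_cases ha : a = 0
    · simp [ha]
    by_cases hb : b = 0
    · simp [hb]
    rw [if_neg ha, if_neg hb, if_neg (mul_ne_zero ha hb), Nat.factorization_mul ha hb,
      Finsupp.prod_add_index']
    · intro q; simp
    · intro q m n; exact pow_add _ _ _

noncomputable def iot (α : ℕ →₀ ℕ) : ℕ := (α.embDomain embP).prod (· ^ ·)

lemma iot_prime (α : ℕ →₀ ℕ) : ∀ q ∈ (α.embDomain embP).support, q.Prime := by
  intro q hq
  rw [Finsupp.support_embDomain, Finset.mem_map] at hq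
  obtain ⟨k, -, rfl⟩ := hq
  exact (enumP k).2

lemma iot_fact (α : ℕ →₀ ℕ) : (iot α).factorization = α.embDomain embP :=
  Nat.prod_pow_factorization_eq_self (iot_prime α)

lemma iot_ne (α : ℕ →₀ ℕ) : iot α ≠ 0 := by
  unfold iot Finsupp.prod
  rw [Finset.prod_ne_zero_iff]
  intro q hq
  exact pow_ne_zero _ (iot_prime α q hq).ne_zero

lemma iot_inj : Function.Injective iot := by
  intro a b h
  apply Finsupp.embDomain_injective embP
  rw [← iot_fact, ← iot_fact, h]

lemma fM_iot (z : ℕ → ℂ) (α : ℕ →₀ ℕ) : fM z (iot α) = α.prod fun k e => z k ^ e := by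
  change (if iot α = 0 then 0 else (iot α).factorization.prod fun q e => ZZ z q ^ e) = _
  rw [if_neg (iot_ne α), iot_fact, Finsupp.prod_embDomain]
  simp_rw [ZZ_emb]

lemma iot_surj {n : ℕ} (hn : n ≠ 0) : n ∈ range iot := by
  have h : (n.factorization.support : Set ℕ) ⊆ Set.range embP := by
    intro q hq
    have hq' : q.Prime := Nat.prime_of_mem_primeFactors (by simpa using hq)
    refine ⟨enumP.symm ⟨q, hq'⟩, ?_⟩
    exact congrArg (fun w : Nat.Primes => (w : ℕ)) (enumP.apply_symm_apply (⟨q, hq'⟩ : Nat.Primes))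
  refine ⟨Finsupp.comapDomain embP n.factorization embP.injective.injOn, ?_⟩
  unfold iot
  rw [Finsupp.embDomain_comapDomain h]
  exact Nat.prod_factorization_pow_eq_self hn

lemma euler (z : ℕ → ℂ) (hs : Summable fun α : ℕ →₀ ℕ => α.prod fun k e => z k ^ e) :
    Complex.exp (∑' k, -Complex.log (1 - z k)) = ∑' α : ℕ →₀ ℕ, α.prod fun k e => z k ^ e := by
  have h0 : ∀ n ∉ range iot, fM z n = 0 := by
    intro n hn
    by_cases h : n = 0
    · rw [h, map_zero]
    · exact absurd (iot_surj h) hn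
  have hsum : Summable fun n => ‖fM z n‖ := by
    have h1 : Summable (fM z ∘ iot) := by
      refine hs.congr fun α => ?_
      rw [Function.comp, fM_iot]
    exact (summable_norm_iff).2 ((iot_inj.summable_iff h0).1 h1)
  have h := EulerProduct.exp_tsum_primes_log_eq_tsum hsum
  rw [← enumP.tsum_eq] at h
  have h2 : ∀ k, fM z (enumP k : ℕ) = z k := by
    intro k
    have hk : (enumP k : ℕ).Prime := (enumP k).2
    change (if (enumP k : ℕ) = 0 then 0 else (enumP k : ℕ).factorization.prod fun q e => ZZ z q ^ e) = _
    rw [if_neg hk.ne_zero, hk.factorization, Finsupp.prod_single_index (by simp), pow_one]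
    exact ZZ_emb z k
  simp_rw [h2] at h
  rw [h, ← iot_inj.tsum_eq]
  · simp_rw [fM_iot]
  · intro n hn
    by_contra hc
    exact hn (h0 n hc)

lemma exp_logZeta (hp : ∀ k, 1 < p k) (hmono : Monotone p) {s : ℂ} (hs1 : 1 < s.re)
    (hsum : Summable fun α : ℕ →₀ ℕ => (nval p α : ℂ) ^ (-s)) :
    Complex.exp (logZeta p s) = ∑' α : ℕ →₀ ℕ, (nval p α : ℂ) ^ (-s) := by
  set z : ℕ → ℂ := fun k => (p k : ℂ) ^ (-s) with hz
  have hnorm : ∀ k, ‖z k‖ = p k ^ (-s.re) := by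
    intro k
    rw [hz]
    have := Complex.norm_cpow_eq_rpow_re_of_pos (by linarith [hp k] : 0 < p k) (-s)
    simpa using this
  have hlt : ∀ k, ‖z k‖ < 1 := by
    intro k
    rw [hnorm]
    exact Real.rpow_lt_one_of_one_lt_of_neg (hp k) (by linarith)
  have hle : ∀ k, ‖z k‖ ≤ ‖z 0‖ := by
    intro k
    rw [hnorm, hnorm]
    exact Real.rpow_le_rpow_of_nonpos (by linarith [hp 0]) (hmono (Nat.zero_le k)) (by linarith)
  simp_rw [nval_cpow hp] at hsum ⊢
  rw [← euler z hsum]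
  congr 1
  have hzs : Summable fun k => ‖z k‖ := by
    have hi : Function.Injective fun k : ℕ => Finsupp.single k (1:ℕ) :=
      Finsupp.single_left_injective one_ne_zero
    have h := (hsum.comp_injective hi).norm
    refine h.congr fun k => ?_
    simp only [Function.comp]
    rw [Finsupp.prod_single_index (by simp), pow_one]
  have hterm : ∀ j k : ℕ, ((p k : ℂ) ^ (-s * (j + 1))) / (j + 1) = z k ^ (j + 1) / (j + 1) := by
    intro j k
    congr 1
    have := Complex.cpow_mul_nat (p k : ℂ) (-s) (j + 1)
    push_cast at this
    exact this
  unfold logZeta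
  simp_rw [hterm]
  rw [Summable.tsum_comm]
  · congr 1; ext k
    have h := Complex.hasSum_taylorSeries_neg_log (hlt k)
    rw [← hasSum_nat_add_iff' 1] at h
    simp at h
    exact h.tsum_eq
  · have h1 : Summable fun j : ℕ => ‖z 0‖ ^ j := summable_geometric_of_lt_one (norm_nonneg _) (hlt 0)
    have h2 := hzs.mul_of_nonneg h1 (fun k => norm_nonneg _) (fun j => pow_nonneg (norm_nonneg _) _)
    refine Summable.of_norm_bounded h2 ?_
    rintro ⟨k, j⟩
    simp only [Function.uncurry]
    rw [norm_div, norm_pow]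
    have h3 : (1:ℝ) ≤ ‖(j + 1 : ℂ)‖ := by
      have : ((j : ℂ) + 1) = ((j + 1 : ℕ) : ℂ) := by push_cast; rfl
      rw [this, Complex.norm_natCast]; push_cast; linarith [(Nat.cast_nonneg j : (0:ℝ) ≤ j)]
    refine (div_le_self (pow_nonneg (norm_nonneg _) _) h3).trans ?_
    rw [pow_succ, mul_comm]
    exact mul_le_mul_of_nonneg_left (pow_le_pow_left₀ (norm_nonneg _) (hle k) _) (norm_nonneg _)

lemma fin_set (hp : ∀ k, 1 < p k)
    (hsum : Summable fun α : ℕ →₀ ℕ => (nval p α : ℂ) ^ (-(2:ℂ))) (x : ℝ) :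
    Finite {α : ℕ →₀ ℕ // nval p α ≤ x} := by
  have h := hsum.norm.tendsto_cofinite_zero
  have hpos : (0:ℝ) < (max x 1) ^ (-2 : ℝ) := Real.rpow_pos_of_pos (by positivity) _
  have h2 := h.eventually_lt_const hpos
  rw [Filter.eventually_cofinite] at h2
  refine (h2.subset ?_).to_subtype (s := {α : ℕ →₀ ℕ | nval p α ≤ x})
  intro α hα
  have hα' : nval p α ≤ x := hα
  have h1 := nval_one_le hp α
  simp only [mem_setOf_eq, not_lt]
  rw [Complex.norm_cpow_eq_rpow_re_of_pos (by linarith)]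
  simp only [Complex.neg_re, Complex.re_ofNat]
  exact Real.rpow_le_rpow_of_nonpos (by linarith) (hα'.trans (le_max_left _ _)) (by norm_num)

/-- normalized counting function -/
noncomputable def HH (p : ℕ → ℝ) (u : ℝ) : ℝ := (Ncount p (Real.exp u) : ℝ) * Real.exp (-u)

lemma HH_mono (hfin : ∀ x, Finite {α : ℕ →₀ ℕ // nval p α ≤ x}) :
    Monotone (fun u => (Ncount p (Real.exp u) : ℝ)) := by
  intro u v huv
  dsimp only
  norm_cast
  unfold Ncount
  have := hfin (Real.exp v)
  have he := Real.exp_le_exp.2 huv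
  exact Nat.card_le_card_of_injective
    (fun α : {α : ℕ →₀ ℕ // nval p α ≤ Real.exp u} =>
      (⟨α.1, α.2.trans he⟩ : {α : ℕ →₀ ℕ // nval p α ≤ Real.exp v}))
    (fun a b h => Subtype.ext (congrArg (fun w => w.1) h))

lemma HH_exp (u : ℝ) : Real.exp u * HH p u = (Ncount p (Real.exp u) : ℝ) := by
  unfold HH
  rw [Real.exp_neg]
  field_simp

lemma HH_neg (hp : ∀ k, 1 < p k) (u : ℝ) (hu : u < 0) : HH p u = 0 := by
  unfold HH Ncount
  have : IsEmpty {α : ℕ →₀ ℕ // nval p α ≤ Real.exp u} := by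
    refine ⟨fun α => ?_⟩
    have h1 := nval_one_le hp α.1
    have h2 := α.2
    have h3 := Real.exp_lt_one_iff.2 hu
    linarith
  rw [Nat.card_of_isEmpty]
  simp

lemma laplace (hp : ∀ k, 1 < p k) {σ : ℝ} (hσ : 1 < σ) (t : ℝ)
    (hsum : Summable fun α : ℕ →₀ ℕ => (nval p α : ℂ) ^ (-(σ + t * Complex.I : ℂ))) :
    FT (hs (HH p) σ) t =
      (∑' α : ℕ →₀ ℕ, (nval p α : ℂ) ^ (-(σ + t * Complex.I : ℂ))) / (σ + t * Complex.I) := by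
  set s : ℂ := σ + t * Complex.I with hs'
  have hsre : s.re = σ := by simp [hs']
  have hs0 : s ≠ 0 := by
    intro h; rw [h] at hsre; simp at hsre; linarith
  set F : (ℕ →₀ ℕ) → ℝ → ℂ := fun α => (Ici (Real.log (nval p α))).indicator
    (fun u : ℝ => Complex.exp (-s * u)) with hF
  have hpos : ∀ α, 0 < nval p α := fun α => by linarith [nval_one_le hp α]
  have hexp : ∀ α, Complex.exp (-s * (Real.log (nval p α) : ℝ)) = (nval p α : ℂ) ^ (-s) := by
    intro α
    rw [Complex.cpow_def_of_ne_zero (by exact_mod_cast (hpos α).ne'), Complex.ofReal_log (hpos α).le,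
      mul_comm]
  have hsn : (-s).re < 0 := by rw [Complex.neg_re, hsre]; linarith
  have hFi : ∀ α, Integrable (F α) := by
    intro α
    rw [hF, integrable_indicator_iff measurableSet_Ici, integrableOn_Ici_iff_integrableOn_Ioi]
    exact integrableOn_exp_mul_complex_Ioi hsn _
  have hFint : ∀ α, ∫ u, F α u = (nval p α : ℂ) ^ (-s) / s := by
    intro α
    rw [hF, integral_indicator measurableSet_Ici, integral_Ici_eq_integral_Ioi,
      integral_exp_mul_complex_Ioi hsn, hexp, neg_div_neg_eq]
  have hFnorm : ∀ α, ∫ u, ‖F α u‖ = ‖(nval p α : ℂ) ^ (-s)‖ / σ := by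
    intro α
    have h1 : ∀ u, ‖F α u‖ = (Ici (Real.log (nval p α))).indicator (fun u : ℝ => Real.exp (-σ * u)) u := by
      intro u
      rw [hF, norm_indicator_eq_indicator_norm]
      congr 1; ext v
      rw [Complex.norm_exp]
      congr 1
      simp [hs']
    simp_rw [h1]
    rw [integral_indicator measurableSet_Ici, integral_Ici_eq_integral_Ioi,
      integral_exp_mul_Ioi (by linarith), ← hexp, Complex.norm_exp, neg_div_neg_eq]
    congr 2
    simp [hs']
  have hkey := hasSum_integral_of_summable_integral_norm hFi (by
    simp_rw [hFnorm]
    exact hsum.norm.div_const σ)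
  simp_rw [hFint] at hkey
  have hts : ∀ u : ℝ, ∑' α, F α u = hs (HH p) σ u * Complex.exp (-(t * u) * Complex.I) := by
    intro u
    have h1 : ∀ α, F α u = {α : ℕ →₀ ℕ | nval p α ≤ Real.exp u}.indicator
        (fun _ => Complex.exp (-s * u)) α := by
      intro α
      have : u ∈ Ici (Real.log (nval p α)) ↔ α ∈ {α : ℕ →₀ ℕ | nval p α ≤ Real.exp u} := by
        simp only [mem_Ici, mem_setOf_eq]
        exact Real.log_le_iff_le_exp (hpos α)
      by_cases h : u ∈ Ici (Real.log (nval p α))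
      · simp only [hF]
        rw [indicator_of_mem h, indicator_of_mem (this.1 h)]
      · simp only [hF]
        rw [indicator_of_notMem h, indicator_of_notMem (fun hc => h (this.2 hc))]
    simp_rw [h1]
    rw [← tsum_subtype, tsum_const, nsmul_eq_mul]
    unfold hs HH
    have e : Complex.exp (-s * u) = Complex.exp (-u) * Complex.exp (-(σ - 1) * u) *
        Complex.exp (-(t * u) * Complex.I) := by
      rw [← Complex.exp_add, ← Complex.exp_add]
      congr 1
      rw [hs']; ring
    rw [e]
    push_cast
    rw [mul_assoc, mul_assoc, mul_assoc]
    rfl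
  simp_rw [hts] at hkey
  unfold FT
  rw [← hkey.tsum_eq, tsum_div_const]

end arith
end BT

theorem stmt_2 (p : ℕ → ℝ) (hmono : Monotone p) (hp1 : 1 < p 0)
    (hptop : Tendsto p atTop atTop)
    (hzeta : ∀ s : ℂ, 1 < s.re → Summable fun α : ℕ →₀ ℕ => (nval p α : ℂ) ^ (-s))
    (ha : ALocBoundary (fun s => logZeta p s + Complex.log (s - 1)) Set.univ) :
    ∃ a : ℝ, 0 < a ∧ Tendsto (fun x : ℝ => (Ncount p x : ℝ) / x) atTop (𝓝 a) := by
  have hp : ∀ k, 1 < p k := fun k => hp1.trans_le (hmono (Nat.zero_le k))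
  have hfin := BT.fin_set hp (hzeta 2 (by norm_num))
  have hNm := BT.HH_mono hfin
  have hHm : Measurable (BT.HH p) := by
    unfold BT.HH
    exact hNm.measurable.mul (by fun_prop)
  have H0 : ∀ u, 0 ≤ BT.HH p u := fun u => by unfold BT.HH; positivity
  have hre : ∀ σ t : ℝ, (σ + t * Complex.I : ℂ).re = σ := by intro σ t; simp
  have hL : ∀ σ : ℝ, 1 < σ → ∀ t : ℝ, BT.FT (BT.hs (BT.HH p) σ) t =
      Complex.exp (logZeta p (σ + t * Complex.I) + Complex.log (σ + t * Complex.I - 1)) /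
        ((σ + t * Complex.I) * (σ + t * Complex.I - 1)) := by
    intro σ hσ t
    have h1 : 1 < (σ + t * Complex.I : ℂ).re := by rw [hre]; exact hσ
    have hne : (σ + t * Complex.I - 1 : ℂ) ≠ 0 := by
      intro h
      have := congrArg Complex.re h
      simp at this
      linarith
    rw [BT.laplace hp hσ t (hzeta _ h1), Complex.exp_add, Complex.exp_log hne,
      BT.exp_logZeta hp hmono h1 (hzeta _ h1), mul_div_mul_right _ _ hne]
  have hIntegr : ∀ σ : ℝ, 1 < σ →
      Integrable (fun u => BT.HH p u * Real.exp (-(σ - 1) * u)) := by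
    intro σ hσ
    have h := hL σ hσ 0
    have hs0 : (σ : ℂ) ≠ 0 := by exact_mod_cast (by linarith : σ ≠ 0)
    have hs1 : (σ - 1 : ℂ) ≠ 0 := by
      have : (σ - 1 : ℝ) ≠ 0 := by linarith
      exact_mod_cast this
    have hne : BT.FT (BT.hs (BT.HH p) σ) 0 ≠ 0 := by
      rw [h]
      apply div_ne_zero (Complex.exp_ne_zero _)
      simp only [Complex.ofReal_zero, zero_mul, add_zero]
      exact mul_ne_zero hs0 hs1
    have h2 : ∫ u, BT.hs (BT.HH p) σ u ≠ 0 := by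
      intro hc
      apply hne
      rw [← hc]
      simp [BT.FT]
    have h3 := (Integrable.of_integral_ne_zero h2).re
    exact h3
  have hG : ∀ l : ℝ, 0 < l → ∃ g : ℝ → ℂ, Integrable g ∧
      TendstoUniformlyOn (fun σ t : ℝ => logZeta p (σ + t * Complex.I) +
        Complex.log (σ + t * Complex.I - 1)) (BT.FT g) (𝓝[>] 1) (Icc (-l) l) := by
    intro l _
    exact ha (Icc (-l) l) (subset_univ _) isCompact_Icc
  obtain ⟨a, hapos, hW⟩ := BT.main_limit hHm H0 (BT.HH_neg hp) hIntegr hL hG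
  refine ⟨a, hapos, ?_⟩
  have hmonoH : Monotone (fun u => Real.exp u * BT.HH p u) := by
    simp_rw [BT.HH_exp]
    exact hNm
  have hT := (BT.tauber hmonoH H0 (BT.HH_neg hp) hapos hW).comp Real.tendsto_log_atTop
  refine hT.congr' ?_
  filter_upwards [eventually_gt_atTop 0] with x hx
  simp only [Function.comp, BT.HH]
  rw [Real.exp_neg, Real.exp_log hx, div_eq_mul_inv]
end
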